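/- Let q, q' ∈ (0,1)^ℤ. (a) If there exists ε > 0 such that κ_□(q_n, q'_n) ≤ 0 and q_n, q'_n ≤ 1 − ε for every n ∈ ℤ, then P^□_{q,q'}-almost surely there is no infinite open cluster. (b) If there exists δ > 0 such that κ_□(q_n, q'_n) ≤ −δ for every n ∈ ℤ, then there exist c, d > 0 such that for every vertex v, P^□_{q,q'}(|C_v| ≥ k) ≤ c·e^{−dk} for all k ≥ 0. (c) If there exists δ > 0 such that κ_□(q_n, q'_n) ≥ δ for every n ∈ ℤ, then P^□_{q,q'} is uniformly supercritical. -/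

import Mathlib

open MeasureTheory Set

set_option linter.unusedVariables false

namespace Perc

/-- Points of the plane. -/
abbrev Pt := ℝ × ℝ

/-- A lattice embedded in the plane, with edges indexed by `E`;
each edge is embedded as the segment between the two endpoints given by `ends`. -/
structure LatticeOn (E : Type) where
  ends : E → Pt × Pt

/-- Bond configurations. -/
abbrev Config (E : Type) := E → Bool

/-- `P` is the Bernoulli bond-percolation product measure in which edge `e`
is open with probability `p e`, independently over edges. -/
def IsBernoulliProduct {E : Type} (p : E → ℝ) (P : Measure (Config E)) : Prop :=
  IsProbabilityMeasure P ∧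
    ∀ (s : Finset E) (f : E → Bool),
      P {ω | ∀ e ∈ s, ω e = f e} =
        ∏ e ∈ s, ENNReal.ofReal (if f e then p e else 1 - p e)

/-- The union of the closed segments of the open edges. -/
def openEdgeSet {E : Type} (L : LatticeOn E) (ω : Config E) : Set Pt :=
  ⋃ e ∈ {e : E | ω e = true}, segment ℝ (L.ends e).1 (L.ends e).2

/-- There is an arc, contained in `S` and in the union of the open edges,
with one endpoint in `A` and the other in `B`. -/
def CrossingIn {E : Type} (L : LatticeOn E) (ω : Config E) (S A B : Set Pt) : Prop :=
  ∃ γ : ℝ → Pt, ContinuousOn γ (Icc 0 1) ∧ γ 0 ∈ A ∧ γ 1 ∈ B ∧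
    ∀ t ∈ Icc (0:ℝ) 1, γ t ∈ S ∩ openEdgeSet L ω

/-- Rotation of the plane by angle `θ`. -/
noncomputable def rot (θ : ℝ) (z : Pt) : Pt :=
  (Real.cos θ * z.1 - Real.sin θ * z.2, Real.sin θ * z.1 + Real.cos θ * z.2)

/-- `f` comprises a rotation and a translation. -/
def IsRotTrans (f : Pt → Pt) : Prop := ∃ θ : ℝ, ∃ t : Pt, f = fun z => rot θ z + t

def stdRect (h l : ℝ) : Set Pt := {z | 0 ≤ z.1 ∧ z.1 ≤ h ∧ 0 ≤ z.2 ∧ z.2 ≤ l}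
def leftSide (h l : ℝ) : Set Pt := {z | z.1 = 0 ∧ 0 ≤ z.2 ∧ z.2 ≤ l}
def rightSide (h l : ℝ) : Set Pt := {z | z.1 = h ∧ 0 ≤ z.2 ∧ z.2 ≤ l}
def bottomSide (h l : ℝ) : Set Pt := {z | z.2 = 0 ∧ 0 ≤ z.1 ∧ z.1 ≤ h}
def topSide (h l : ℝ) : Set Pt := {z | z.2 = l ∧ 0 ≤ z.1 ∧ z.1 ≤ h}

/-- The box `f(stdRect h l)` (where `f` is a rotation plus translation) possesses
open crossings in both directions. -/
def HasBoxCrossings {E : Type} (L : LatticeOn E) (ω : Config E) (h l : ℝ) (f : Pt → Pt) : Prop :=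
  CrossingIn L ω (f '' stdRect h l) (f '' leftSide h l) (f '' rightSide h l) ∧
  CrossingIn L ω (f '' stdRect h l) (f '' bottomSide h l) (f '' topSide h l)

/-- The box-crossing property: for every `α > 0` there is `δ > 0` such that every box
of size `αN × N` (any position and orientation) possesses open crossings with
probability at least `δ`, for all large `N`. -/
def BoxCrossingProperty {E : Type} (L : LatticeOn E) (P : Measure (Config E)) : Prop :=
  ∀ α : ℝ, 0 < α → ∃ δ : ℝ, 0 < δ ∧ ∃ N₀ : ℕ, ∀ N : ℕ, N₀ ≤ N →
    ∀ f : Pt → Pt, IsRotTrans f →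
      ENNReal.ofReal δ ≤ P {ω | HasBoxCrossings L ω (α * N) N f}

/-- Horizontal-crossing event of the box `[-m,m] × [0,n]`. -/
def Ch {E : Type} (L : LatticeOn E) (m n : ℝ) (ω : Config E) : Prop :=
  CrossingIn L ω {z | -m ≤ z.1 ∧ z.1 ≤ m ∧ 0 ≤ z.2 ∧ z.2 ≤ n}
    {z | z.1 = -m ∧ 0 ≤ z.2 ∧ z.2 ≤ n} {z | z.1 = m ∧ 0 ≤ z.2 ∧ z.2 ≤ n}

/-- Vertical-crossing event of the box `[-m,m] × [0,n]`. -/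
def Cv {E : Type} (L : LatticeOn E) (m n : ℝ) (ω : Config E) : Prop :=
  CrossingIn L ω {z | -m ≤ z.1 ∧ z.1 ≤ m ∧ 0 ≤ z.2 ∧ z.2 ≤ n}
    {z | z.2 = 0 ∧ -m ≤ z.1 ∧ z.1 ≤ m} {z | z.2 = n ∧ -m ≤ z.1 ∧ z.1 ≤ m}

/-- `u` and `v` are the endpoints of some open edge. -/
def openAdj {E : Type} (L : LatticeOn E) (ω : Config E) (u v : Pt) : Prop :=
  ∃ e, ω e = true ∧ (L.ends e = (u, v) ∨ L.ends e = (v, u))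

/-- `u` and `v` are joined by a path of open edges. -/
def openConn {E : Type} (L : LatticeOn E) (ω : Config E) : Pt → Pt → Prop :=
  Relation.ReflTransGen (openAdj L ω)

/-- The open cluster at `v`. -/
def cluster {E : Type} (L : LatticeOn E) (ω : Config E) (v : Pt) : Set Pt :=
  {u | openConn L ω v u}

/-- The vertex set of the lattice. -/
def vertexSet {E : Type} (L : LatticeOn E) : Set Pt :=
  ⋃ e : E, {(L.ends e).1, (L.ends e).2}

/-- `v` is the endpoint of an infinite open self-avoiding path. -/
def ConnToInfinity {E : Type} (L : LatticeOn E) (ω : Config E) (v : Pt) : Prop :=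
  ∃ γ : ℕ → Pt, γ 0 = v ∧ Function.Injective γ ∧ ∀ n, openAdj L ω (γ n) (γ (n + 1))

/-- Euclidean distance on the plane. -/
noncomputable def edist2 (u v : Pt) : ℝ := Real.sqrt ((u.1 - v.1) ^ 2 + (u.2 - v.2) ^ 2)

/-- `rad (C_v) ≥ r`, where `rad (C_v)` is the supremum of all `x` such that `C_v`
meets the complement of the open Euclidean ball `v + S_x`. -/
def RadiusGE {E : Type} (L : LatticeOn E) (ω : Config E) (v : Pt) (r : ℝ) : Prop :=
  ∀ x : ℝ, x < r → ∃ u ∈ cluster L ω v, x ≤ edist2 v u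

/-- `κ_□`. -/
def kappaS (a b : ℝ) : ℝ := a + b - 1
/-- `κ_△`. -/
def kappaT (a b c : ℝ) : ℝ := a + b + c - a * b * c - 1
/-- `κ_⬡`. -/
def kappaH (a b c : ℝ) : ℝ := -kappaT (1 - a) (1 - b) (1 - c)

/-- Edges of a square-type lattice: `(a, b, true)` is the `horizontal`-class edge
at `(a,b)` and `(a, b, false)` the `vertical`-class edge at `(a,b)`. -/
abbrev SqE := ℤ × ℤ × Bool
/-- Edges of the triangular lattice (also indexing the dual hexagonal edges):
`(a, b, i)` with `i = 0` horizontal, `i = 1` the right edge of an upwards pointing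
triangle, `i = 2` the left edge of an upwards pointing triangle, in row `b`. -/
abbrev TriE := ℤ × ℤ × Fin 3

/-- The unit square lattice, with vertex set `ℤ²`. -/
noncomputable def sqLattice : LatticeOn SqE :=
  ⟨fun e =>
    if e.2.2 then (((e.1 : ℝ), (e.2.1 : ℝ)), ((e.1 : ℝ) + 1, (e.2.1 : ℝ)))
    else (((e.1 : ℝ), (e.2.1 : ℝ)), ((e.1 : ℝ), (e.2.1 : ℝ) + 1))⟩

/-- The dual of the unit square lattice (shifted by `(1/2, 1/2)`), with each dual edge
indexed by the primal edge it crosses. -/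
noncomputable def sqDualLattice : LatticeOn SqE :=
  ⟨fun e =>
    if e.2.2 then
      (((e.1 : ℝ) + 1 / 2, (e.2.1 : ℝ) - 1 / 2), ((e.1 : ℝ) + 1 / 2, (e.2.1 : ℝ) + 1 / 2))
    else
      (((e.1 : ℝ) - 1 / 2, (e.2.1 : ℝ) + 1 / 2), ((e.1 : ℝ) + 1 / 2, (e.2.1 : ℝ) + 1 / 2))⟩

/-- Vertices of the triangular lattice (equilateral triangles of side `√3`,
one family of edges horizontal). -/
noncomputable def tv (a b : ℤ) : Pt :=
  (Real.sqrt 3 * ((a : ℝ) + (b : ℝ) / 2), 3 / 2 * (b : ℝ))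

/-- The triangular lattice. -/
noncomputable def triLattice : LatticeOn TriE :=
  ⟨fun e =>
    if e.2.2 = 0 then (tv e.1 e.2.1, tv (e.1 + 1) e.2.1)
    else if e.2.2 = 1 then (tv (e.1 + 1) e.2.1, tv e.1 (e.2.1 + 1))
    else (tv e.1 e.2.1, tv e.1 (e.2.1 + 1))⟩

/-- Circumcentre of the upwards pointing triangle with base vertex `tv a b`. -/
noncomputable def hup (a b : ℤ) : Pt :=
  (Real.sqrt 3 * ((a : ℝ) + ((b : ℝ) + 1) / 2), 3 / 2 * (b : ℝ) + 1 / 2)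

/-- Circumcentre of the downwards pointing triangle below the edge `tv a b – tv (a+1) b`. -/
noncomputable def hdown (a b : ℤ) : Pt :=
  (Real.sqrt 3 * ((a : ℝ) + ((b : ℝ) + 1) / 2), 3 / 2 * (b : ℝ) - 1 / 2)

/-- The hexagonal lattice, the planar dual of `triLattice`, with vertices at the
circumcentres of the triangles; each hexagonal edge is indexed by the triangular
edge it crosses. -/
noncomputable def hexLattice : LatticeOn TriE :=
  ⟨fun e =>
    if e.2.2 = 0 then (hdown e.1 e.2.1, hup e.1 e.2.1)
    else if e.2.2 = 1 then (hup e.1 e.2.1, hdown e.1 (e.2.1 + 1))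
    else (hup e.1 e.2.1, hdown (e.1 - 1) (e.2.1 + 1))⟩

/-- The square lattice with horizontal edges of length `√3` and vertical edges of
length `1` (as in the mixed lattices). -/
noncomputable def sqStretch : LatticeOn SqE :=
  ⟨fun e =>
    if e.2.2 then
      ((Real.sqrt 3 * (e.1 : ℝ), (e.2.1 : ℝ)), (Real.sqrt 3 * ((e.1 : ℝ) + 1), (e.2.1 : ℝ)))
    else ((Real.sqrt 3 * (e.1 : ℝ), (e.2.1 : ℝ)), (Real.sqrt 3 * (e.1 : ℝ), (e.2.1 : ℝ) + 1))⟩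

/-- Vertices of the square lattice rotated by `π/4`. -/
noncomputable def rv (a b : ℤ) : Pt :=
  (((a : ℝ) - (b : ℝ)) / Real.sqrt 2, ((a : ℝ) + (b : ℝ)) / Real.sqrt 2)

/-- The square lattice rotated by `π/4`: edges `(a,b,true)` are inclined at angle `π/4`
and edges `(a,b,false)` at angle `3π/4`; the row (height) of such an edge is `a + b`. -/
noncomputable def rsqLattice : LatticeOn SqE :=
  ⟨fun e =>
    if e.2.2 then (rv e.1 e.2.1, rv (e.1 + 1) e.2.1)
    else (rv e.1 e.2.1, rv e.1 (e.2.1 + 1))⟩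

/-- Inhomogeneous intensities on the square lattice: `ph` on horizontal edges,
`pv` on vertical ones. -/
def sqInt (ph pv : ℝ) : SqE → ℝ := fun e => if e.2.2 then ph else pv

/-- Inhomogeneous intensities on the triangular (or hexagonal) lattice:
`p0` on class-0 edges, `p1` on class-1, `p2` on class-2. -/
def triInt (p0 p1 p2 : ℝ) : TriE → ℝ := fun e => ![p0, p1, p2] e.2.2

/-- Highly inhomogeneous intensities on the triangular (or hexagonal) lattice:
`p` on horizontal-class edges, `q n` on right edges of upwards pointing triangles at
height `n`, `q' n` on left edges of upwards pointing triangles at height `n`. -/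
def triHI (p : ℝ) (q q' : ℤ → ℝ) : TriE → ℝ := fun e =>
  if e.2.2 = 0 then p else if e.2.2 = 1 then q e.2.1 else q' e.2.1

/-- Highly inhomogeneous intensities on the rotated square lattice: `q n` on edges
inclined at `π/4` at height `n`, `q' n` on edges inclined at `3π/4` at height `n`. -/
def rsqHI (q q' : ℤ → ℝ) : SqE → ℝ := fun e =>
  if e.2.2 then q (e.1 + e.2.1) else q' (e.1 + e.2.1)

section Tools

variable {E : Type}

theorem measurableSet_cyl (s : Finset E) (f : E → Bool) :
    MeasurableSet {ω : Config E | ∀ e ∈ s, ω e = f e} := by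
  have key : {ω : Config E | ∀ e ∈ s, ω e = f e} = Set.pi s fun e => {f e} := by
    ext ω; simp [Set.mem_pi]
  rw [key]
  exact MeasurableSet.pi s.countable_toSet fun _ _ => measurableSet_singleton _

theorem IsBernoulliProduct.unique {p : E → ℝ} {P Q : Measure (Config E)}
    (hP : IsBernoulliProduct p P) (hQ : IsBernoulliProduct p Q) : P = Q := by
  classical
  have := hP.1
  have := hQ.1
  refine IsProjectiveLimit.unique (P := fun I : Finset E => P.map I.restrict)
    (fun I => rfl) (fun I => ?_)
  refine Measure.ext_of_singleton fun g => ?_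
  rw [Measure.map_apply (by fun_prop) (measurableSet_singleton _),
    Measure.map_apply (by fun_prop) (measurableSet_singleton _)]
  have key : (fun ω : Config E => I.restrict ω) ⁻¹' ({g} : Set (I → Bool)) =
      {ω : Config E | ∀ e ∈ I, ω e = if h : e ∈ I then g ⟨e, h⟩ else true} := by
    ext ω
    simp only [mem_preimage, mem_singleton_iff, mem_ofPred_eq, funext_iff]
    constructor
    · intro h e he
      simpa [he] using h ⟨e, he⟩
    · rintro h ⟨e, he⟩
      simpa [he] using h e he
  change Q ((fun ω : Config E => I.restrict ω) ⁻¹' {g}) =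
    P ((fun ω : Config E => I.restrict ω) ⁻¹' {g})
  rw [key, hQ.2, hP.2]

/-- The law of a single edge that is open with probability `r`. -/
noncomputable def edgeLaw (r : ℝ) : Measure Bool :=
  ENNReal.ofReal r • Measure.dirac true + ENNReal.ofReal (1 - r) • Measure.dirac false

theorem edgeLaw_isProbabilityMeasure {r : ℝ} (hr : r ∈ Icc (0 : ℝ) 1) :
    IsProbabilityMeasure (edgeLaw r) := by
  constructor
  simp only [edgeLaw, Measure.coe_add, Measure.coe_smul, Pi.add_apply, Pi.smul_apply,
    measure_univ, smul_eq_mul, mul_one]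
  rw [← ENNReal.ofReal_add hr.1 (by linarith [hr.2])]
  simp

theorem exists_isBernoulliProduct {p : E → ℝ} (hp : ∀ e, p e ∈ Icc (0 : ℝ) 1) :
    ∃ P : Measure (Config E), IsBernoulliProduct p P := by
  have := fun e => edgeLaw_isProbabilityMeasure (hp e)
  refine ⟨Measure.infinitePi fun e => edgeLaw (p e), inferInstance, fun s f => ?_⟩
  have key : {ω : Config E | ∀ e ∈ s, ω e = f e} = Set.pi s fun e => {f e} := by
    ext ω; simp [Set.mem_pi]
  rw [key, Measure.infinitePi_pi _ (fun e _ => measurableSet_singleton _)]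
  refine Finset.prod_congr rfl fun e _ => ?_
  cases h : f e <;> simp [edgeLaw]

theorem measurable_update [DecidableEq E] (e : E) (b : Bool) :
    Measurable fun ω : Config E => Function.update ω e b := by
  refine measurable_pi_lambda _ fun a => ?_
  by_cases h : a = e
  · subst h; simp
  · simpa [h] using measurable_pi_apply a

theorem IsBernoulliProduct.resample [DecidableEq E] {p : E → ℝ} {P : Measure (Config E)}
    (hP : IsBernoulliProduct p P) (e : E) (hp : p e ∈ Icc (0 : ℝ) 1) :
    P = ENNReal.ofReal (p e) • P.map (fun ω => Function.update ω e true) +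
      ENNReal.ofReal (1 - p e) • P.map (fun ω => Function.update ω e false) := by
  have := hP.1
  have h1 : ENNReal.ofReal (p e) + ENNReal.ofReal (1 - p e) = 1 := by
    rw [← ENNReal.ofReal_add hp.1 (by linarith [hp.2])]; simp
  refine hP.unique ⟨⟨?_⟩, fun s f => ?_⟩
  · simp only [Measure.coe_add, Measure.coe_smul, Pi.add_apply, Pi.smul_apply, smul_eq_mul]
    rw [Measure.map_apply (measurable_update e _) MeasurableSet.univ,
      Measure.map_apply (measurable_update e _) MeasurableSet.univ]
    simp [h1]
  have hm : MeasurableSet {ω : Config E | ∀ e ∈ s, ω e = f e} :=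
    measurableSet_cyl s f
  simp only [Measure.coe_add, Measure.coe_smul, Pi.add_apply, Pi.smul_apply, smul_eq_mul]
  rw [Measure.map_apply (measurable_update e _) hm, Measure.map_apply (measurable_update e _) hm]
  by_cases he : e ∈ s
  · have key : ∀ b, (fun ω : Config E => Function.update ω e b) ⁻¹'
        {ω : Config E | ∀ e ∈ s, ω e = f e} =
        if b = f e then {ω | ∀ a ∈ s.erase e, ω a = f a} else ∅ := by
      intro b
      ext ω
      split_ifs with hb
      · simp only [mem_preimage, mem_ofPred_eq, Finset.mem_erase]
        constructor
        · rintro h a ⟨hae, ha⟩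
          simpa [hae] using h a ha
        · intro h a ha
          by_cases hae : a = e
          · subst hae; simpa using hb
          · simpa [hae] using h a ⟨hae, ha⟩
      · simp only [mem_preimage, mem_ofPred_eq, mem_empty_iff_false, iff_false]
        intro h
        exact hb (by simpa using h e he)
    rw [key, key, ← Finset.mul_prod_erase s _ he]
    cases hf : f e <;> simp [hP.2, -Finset.mem_erase]
  · have key : ∀ b, (fun ω : Config E => Function.update ω e b) ⁻¹'
        {ω : Config E | ∀ e ∈ s, ω e = f e} = {ω | ∀ e ∈ s, ω e = f e} := by
      intro b
      ext ω
      simp only [mem_preimage, mem_ofPred_eq]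
      refine forall₂_congr fun a ha => ?_
      rw [Function.update_of_ne (by rintro rfl; exact he ha)]
    rw [key, key, hP.2, ← add_mul, h1, one_mul]

theorem IsBernoulliProduct.map_equiv {E' : Type} {p : E → ℝ} {P : Measure (Config E)}
    (hP : IsBernoulliProduct p P) (σ : E' → E) (hσ : Function.Injective σ) :
    IsBernoulliProduct (fun e => p (σ e)) (P.map fun ω e => ω (σ e)) := by
  classical
  have := hP.1
  have hm : Measurable fun (ω : Config E) (e : E') => ω (σ e) :=
    measurable_pi_lambda _ fun a => measurable_pi_apply _
  refine ⟨Measure.isProbabilityMeasure_map hm.aemeasurable, fun s f => ?_⟩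
  have hms : MeasurableSet {ω : Config E' | ∀ e ∈ s, ω e = f e} :=
    measurableSet_cyl s f
  rw [Measure.map_apply hm hms]
  have key : (fun (ω : Config E) (e : E') => ω (σ e)) ⁻¹' {ω : Config E' | ∀ e ∈ s, ω e = f e} =
      {ω | ∀ e ∈ s.map ⟨σ, hσ⟩, ω e = Function.extend σ f (fun _ => true) e} := by
    ext ω
    simp [hσ.extend_apply]
  rw [key, hP.2]
  simp [hσ.extend_apply]

theorem IsBernoulliProduct.map_not {p : E → ℝ} {P : Measure (Config E)}
    (hP : IsBernoulliProduct p P) :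
    IsBernoulliProduct (fun e => 1 - p e) (P.map fun ω e => !ω e) := by
  have := hP.1
  have hm : Measurable fun (ω : Config E) (e : E) => !ω e :=
    measurable_pi_lambda _ fun a =>
      (measurable_of_finite (fun b : Bool => !b)).comp (measurable_pi_apply a)
  refine ⟨Measure.isProbabilityMeasure_map hm.aemeasurable, fun s f => ?_⟩
  have hms : MeasurableSet {ω : Config E | ∀ e ∈ s, ω e = f e} :=
    measurableSet_cyl s f
  rw [Measure.map_apply hm hms]
  have key : (fun (ω : Config E) (e : E) => !ω e) ⁻¹' {ω : Config E | ∀ e ∈ s, ω e = f e} =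
      {ω | ∀ e ∈ s, ω e = !f e} := by
    ext ω
    simp [Bool.not_eq_eq_eq_not]
  rw [key, hP.2]
  refine Finset.prod_congr rfl fun e _ => ?_
  cases f e <;> simp

end Tools

section Local

variable {E : Type} [DecidableEq E]

/-- The configuration `ω` with all edges outside `S` closed. -/
def mask (S : Finset E) (ω : Config E) : Config E := fun e => decide (e ∈ S) && ω e

/-- The configuration `ω` with all edges of `S` put in state `b`. -/
def setOn (S : Finset E) (b : Bool) (ω : Config E) : Config E := fun e => if e ∈ S then b else ω e

theorem mask_le (S : Finset E) (ω : Config E) : mask S ω ≤ ω := by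
  intro e
  by_cases h : e ∈ S <;> simp [mask, h]

theorem mask_mono_set {S T : Finset E} (h : S ⊆ T) (ω : Config E) : mask S ω ≤ mask T ω := by
  intro e
  by_cases h1 : e ∈ S
  · simp [mask, h1, h h1]
  · simp [mask, h1]

theorem mask_mono (S : Finset E) : Monotone (mask S) := by
  intro ω ω' h e
  by_cases h1 : e ∈ S
  · simpa [mask, h1] using h e
  · simp [mask, h1]

theorem dependsOn_mask {β : Type*} (f : Config E → β) (S : Finset E) :
    DependsOn (fun ω => f (mask S ω)) S := by
  intro ω ω' h
  have : mask S ω = mask S ω' := by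
    funext e
    by_cases h1 : e ∈ S
    · simp [mask, h1, h e h1]
    · simp [mask, h1]
  simp only [this]

theorem measurableSet_of_dependsOn {F : Type} {A : Set (Config F)} {S : Finset F}
    (hA : DependsOn (fun ω => ω ∈ A) (S : Set F)) : MeasurableSet A := by
  have key : A = (fun ω : Config F => S.restrict ω) ⁻¹'
      ((fun ω : Config F => (S.restrict ω : S → Bool)) '' A) := by
    ext ω
    constructor
    · exact fun h => ⟨ω, h, rfl⟩
    · rintro ⟨ω', h, h'⟩
      have : (ω' ∈ A) = (ω ∈ A) := hA fun e he => congrFun h' ⟨e, he⟩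
      exact this ▸ h
  rw [key]
  exact (by fun_prop : Measurable fun ω : Config F => S.restrict ω) (Set.toFinite _).measurableSet

theorem measurable_of_dependsOn {F : Type} {f : Config F → ℝ} {S : Finset F}
    (hf : DependsOn f (S : Set F)) : Measurable f := by
  intro B _
  refine measurableSet_of_dependsOn (S := S) fun ω ω' h => ?_
  simp only [mem_preimage, hf h]

theorem bounded_of_dependsOn {F : Type} {f : Config F → ℝ} {S : Finset F}
    (hf : DependsOn f (S : Set F)) : ∃ C, ∀ ω, ‖f ω‖ ≤ C := by
  obtain ⟨g, rfl⟩ := dependsOn_iff_exists_comp.1 hf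
  obtain ⟨C, hC⟩ := (Set.finite_range g).isBounded.exists_norm_le
  exact ⟨C, fun ω => hC _ (mem_range_self _)⟩

theorem integrable_of_dependsOn {F : Type} {P : Measure (Config F)} [IsFiniteMeasure P]
    {f : Config F → ℝ} {S : Finset F} (hf : DependsOn f (S : Set F)) : Integrable f P := by
  obtain ⟨C, hC⟩ := bounded_of_dependsOn hf
  exact Integrable.of_bound (measurable_of_dependsOn hf).aestronglyMeasurable C
    (Filter.Eventually.of_forall hC)

theorem dependsOn_update {β : Type*} {f : Config E → β} {S : Finset E} {e : E}
    (hf : DependsOn f (insert e S : Finset E)) (b : Bool) :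
    DependsOn (fun ω => f (Function.update ω e b)) (S : Set E) := by
  intro ω ω' h
  refine hf fun a ha => ?_
  by_cases hae : a = e
  · subst hae; simp
  · have : a ∈ S := by simpa [hae] using ha
    simp [hae, h a this]

theorem update_mono (e : E) (b : Bool) : Monotone fun ω : Config E => Function.update ω e b := by
  intro ω ω' h
  exact update_le_update_iff.2 ⟨le_rfl, fun a _ => h a⟩

theorem update_false_le_true (e : E) (ω : Config E) :
    Function.update ω e false ≤ Function.update ω e true :=
  update_le_update_iff.2 ⟨by simp, fun _ _ => le_rfl⟩

variable {p : E → ℝ} {P : Measure (Config E)}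

theorem IsBernoulliProduct.integral_resample (hP : IsBernoulliProduct p P) (e : E)
    (hp : p e ∈ Icc (0 : ℝ) 1) {f : Config E → ℝ} {S : Finset E} (hf : DependsOn f (S : Set E)) :
    ∫ ω, f ω ∂P = p e * ∫ ω, f (Function.update ω e true) ∂P +
      (1 - p e) * ∫ ω, f (Function.update ω e false) ∂P := by
  have := hP.1
  have hm := fun b => (measurable_update (E := E) e b).aemeasurable (μ := P)
  have hfm := measurable_of_dependsOn hf
  have hpm := fun b => Measure.isProbabilityMeasure_map (hm b)
  conv_lhs => rw [hP.resample e hp]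
  rw [integral_add_measure, integral_smul_measure, integral_smul_measure,
    integral_map (hm _) hfm.aestronglyMeasurable, integral_map (hm _) hfm.aestronglyMeasurable,
    ENNReal.toReal_ofReal hp.1, ENNReal.toReal_ofReal (by linarith [hp.2])]
  · simp
  · have := hpm true
    exact (integrable_of_dependsOn hf).smul_measure ENNReal.ofReal_ne_top
  · have := hpm false
    exact (integrable_of_dependsOn hf).smul_measure ENNReal.ofReal_ne_top

theorem IsBernoulliProduct.real_resample (hP : IsBernoulliProduct p P) (e : E)
    (hp : p e ∈ Icc (0 : ℝ) 1) {A : Set (Config E)} (hA : MeasurableSet A) :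
    P.real A = p e * P.real ((fun ω => Function.update ω e true) ⁻¹' A) +
      (1 - p e) * P.real ((fun ω => Function.update ω e false) ⁻¹' A) := by
  have := hP.1
  have hm := fun b => (measurable_update (E := E) e b)
  conv_lhs => rw [hP.resample e hp]
  simp only [Measure.real, Measure.coe_add, Measure.coe_smul, Pi.add_apply, Pi.smul_apply,
    smul_eq_mul]
  rw [Measure.map_apply (hm _) hA, Measure.map_apply (hm _) hA, ENNReal.toReal_add
    (ENNReal.mul_ne_top ENNReal.ofReal_ne_top (measure_ne_top _ _))
    (ENNReal.mul_ne_top ENNReal.ofReal_ne_top (measure_ne_top _ _)), ENNReal.toReal_mul,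
    ENNReal.toReal_mul,
    ENNReal.toReal_ofReal hp.1, ENNReal.toReal_ofReal (by linarith [hp.2])]

theorem measurableSet_edge {F : Type} (e : F) (b : Bool) :
    MeasurableSet {ω : Config F | ω e = b} := by
  simpa using measurableSet_cyl {e} fun _ => b

theorem measurable_setOn (S : Finset E) (b : Bool) : Measurable (setOn S b) := by
  refine measurable_pi_lambda _ fun a => ?_
  by_cases h : a ∈ S
  · simp [setOn, h]
  · simpa [setOn, h] using measurable_pi_apply a

theorem IsBernoulliProduct.finite_energy (hP : IsBernoulliProduct p P)
    (hp : ∀ e, p e ∈ Icc (0 : ℝ) 1) (b : Bool) (S : Finset E) :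
    ∀ {A : Set (Config E)}, MeasurableSet A →
    P.real (A ∩ {ω | ∀ e ∈ S, ω e = b}) =
      (∏ e ∈ S, if b then p e else 1 - p e) * P.real (setOn S b ⁻¹' A) := by
  have := hP.1
  induction S using Finset.induction_on with
  | empty =>
    intro A _
    have : setOn (∅ : Finset E) b = id := by funext ω e; simp [setOn]
    simp [this]
  | insert e S he ih =>
    intro A hA
    have hm := measurable_update (E := E) e
    have h1 : A ∩ {ω | ∀ a ∈ insert e S, ω a = b} =
        (A ∩ {ω | ∀ a ∈ S, ω a = b}) ∩ {ω | ω e = b} := by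
      ext ω
      simp only [mem_inter_iff, mem_ofPred_eq, Finset.forall_mem_insert]
      tauto
    have h2 : setOn (insert e S) b ⁻¹' A =
        setOn S b ⁻¹' ((fun ω => Function.update ω e b) ⁻¹' A) := by
      ext ω
      have : setOn (insert e S) b ω = Function.update (setOn S b ω) e b := by
        funext a
        by_cases hae : a = e
        · subst hae; simp [setOn]
        · simp [setOn, hae]
      simp [this]
    have h3 : ∀ c, (fun ω => Function.update ω e c) ⁻¹'
        ((A ∩ {ω | ∀ a ∈ S, ω a = b}) ∩ {ω | ω e = b}) =
        if c = b then ((fun ω => Function.update ω e b) ⁻¹' A) ∩ {ω | ∀ a ∈ S, ω a = b} else ∅ := by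
      intro c
      have h4 : ∀ ω : Config E, (∀ a ∈ S, Function.update ω e c a = b) ↔ ∀ a ∈ S, ω a = b :=
        fun ω => forall₂_congr fun a ha => by
          rw [Function.update_of_ne (by rintro rfl; exact he ha)]
      ext ω
      split_ifs with hc
      · subst hc; simp [h4]
      · simp [hc]
    have hms : MeasurableSet (A ∩ {ω | ∀ a ∈ S, ω a = b}) :=
      hA.inter (measurableSet_cyl S fun _ => b)
    rw [h1, hP.real_resample e (hp e) (hms.inter (measurableSet_edge e b)), h3, h3, h2,
      Finset.prod_insert he, mul_assoc, ← ih (hm b hA)]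
    cases b <;> simp

theorem IsBernoulliProduct.finite_energy_le (hP : IsBernoulliProduct p P)
    {ε : ℝ} (hε : 0 ≤ ε) (hp : ∀ e, p e ∈ Icc ε (1 - ε)) (b : Bool) (S : Finset E)
    {A : Set (Config E)} (hA : MeasurableSet A) :
    ε ^ S.card * P.real (setOn S b ⁻¹' A) ≤ P.real (A ∩ {ω | ∀ e ∈ S, ω e = b}) := by
  rw [hP.finite_energy (fun e => ⟨hε.trans (hp e).1, by linarith [(hp e).2]⟩) b S hA,
    ← Finset.prod_const]
  refine mul_le_mul_of_nonneg_right (Finset.prod_le_prod (fun _ _ => hε) fun e _ => ?_)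
    measureReal_nonneg
  cases b
  · simpa using by linarith [(hp e).2]
  · simpa using (hp e).1

theorem IsBernoulliProduct.integral_mul_eq (hP : IsBernoulliProduct p P)
    (hp : ∀ e, p e ∈ Icc (0 : ℝ) 1) {S T : Finset E} (hST : Disjoint S T) {g : Config E → ℝ}
    (hg : DependsOn g (T : Set E)) :
    ∀ {f : Config E → ℝ}, DependsOn f (S : Set E) →
    ∫ ω, f ω * g ω ∂P = (∫ ω, f ω ∂P) * ∫ ω, g ω ∂P := by
  have := hP.1
  induction S using Finset.induction_on with
  | empty =>
    intro f hf
    have : f = fun _ => f fun _ => true := funext fun ω => hf (by simp)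
    rw [this]
    simp [integral_const_mul]
  | insert e S he ih =>
    intro f hf
    have hST' : Disjoint S T := hST.mono_left (Finset.subset_insert _ _)
    have heT : e ∉ T := Finset.disjoint_left.1 hST (Finset.mem_insert_self _ _)
    have hgu : ∀ b ω, g (Function.update ω e b) = g ω := fun b ω => hg fun a ha => by
      rw [Function.update_of_ne (by rintro rfl; exact heT ha)]
    have hfg : DependsOn (fun ω => f ω * g ω) ((insert e S ∪ T : Finset E) : Set E) := by
      intro ω ω' h
      simp only
      rw [hf fun a ha => h a (by simp at ha ⊢; tauto), hg fun a ha => h a (by simp at ha ⊢; tauto)]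
    rw [hP.integral_resample e (hp e) hfg, hP.integral_resample e (hp e) hf]
    simp only [hgu]
    rw [ih hST' (dependsOn_update hf true), ih hST' (dependsOn_update hf false)]
    ring

/-- Harris' inequality for local functions. -/
theorem IsBernoulliProduct.harris (hP : IsBernoulliProduct p P)
    (hp : ∀ e, p e ∈ Icc (0 : ℝ) 1) (S : Finset E) :
    ∀ {f g : Config E → ℝ}, DependsOn f (S : Set E) → DependsOn g (S : Set E) →
    Monotone f → Monotone g →
    (∫ ω, f ω ∂P) * ∫ ω, g ω ∂P ≤ ∫ ω, f ω * g ω ∂P := by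
  have := hP.1
  induction S using Finset.induction_on with
  | empty =>
    intro f g hf hg _ _
    have : f = fun _ => f fun _ => true := funext fun ω => hf (by simp)
    rw [this]
    simp [integral_const_mul]
  | insert e S he ih =>
    intro f g hf hg hfm hgm
    have hfg : DependsOn (fun ω => f ω * g ω) ((insert e S : Finset E) : Set E) := by
      intro ω ω' h
      simp only
      rw [hf h, hg h]
    rw [hP.integral_resample e (hp e) hfg, hP.integral_resample e (hp e) hf,
      hP.integral_resample e (hp e) hg]
    have h1 := ih (dependsOn_update hf true) (dependsOn_update hg true)
      (hfm.comp (update_mono e true)) (hgm.comp (update_mono e true))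
    have h0 := ih (dependsOn_update hf false) (dependsOn_update hg false)
      (hfm.comp (update_mono e false)) (hgm.comp (update_mono e false))
    have hF : ∫ ω, f (Function.update ω e false) ∂P ≤ ∫ ω, f (Function.update ω e true) ∂P :=
      integral_mono (integrable_of_dependsOn (dependsOn_update hf false))
        (integrable_of_dependsOn (dependsOn_update hf true))
        fun ω => hfm (update_false_le_true e ω)
    have hG : ∫ ω, g (Function.update ω e false) ∂P ≤ ∫ ω, g (Function.update ω e true) ∂P :=
      integral_mono (integrable_of_dependsOn (dependsOn_update hg false))
        (integrable_of_dependsOn (dependsOn_update hg true))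
        fun ω => hgm (update_false_le_true e ω)
    obtain ⟨ha, hb⟩ := hp e
    have hc : 0 ≤ p e * (1 - p e) := mul_nonneg ha (by linarith)
    have h3 := mul_nonneg hc (mul_nonneg (sub_nonneg.2 hF) (sub_nonneg.2 hG))
    have h4 := mul_le_mul_of_nonneg_left h1 ha
    have h5 := mul_le_mul_of_nonneg_left h0 (sub_nonneg.2 hb)
    nlinarith

theorem IsBernoulliProduct.harris_antitone (hP : IsBernoulliProduct p P)
    (hp : ∀ e, p e ∈ Icc (0 : ℝ) 1) (S : Finset E) {f g : Config E → ℝ}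
    (hf : DependsOn f (S : Set E)) (hg : DependsOn g (S : Set E))
    (hfm : Antitone f) (hgm : Antitone g) :
    (∫ ω, f ω ∂P) * ∫ ω, g ω ∂P ≤ ∫ ω, f ω * g ω ∂P := by
  have := hP.harris hp S (f := fun ω => - f ω) (g := fun ω => - g ω)
    (fun ω ω' h => by simp only [hf h]) (fun ω ω' h => by simp only [hg h])
    (fun ω ω' h => neg_le_neg (hfm h)) (fun ω ω' h => neg_le_neg (hgm h))
  simpa [integral_neg] using this

theorem IsBernoulliProduct.integral_le_of_le {p' : E → ℝ} {P' : Measure (Config E)}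
    (hP : IsBernoulliProduct p P) (hP' : IsBernoulliProduct p' P')
    (hp : ∀ e, p e ∈ Icc (0 : ℝ) 1) (hp' : ∀ e, p' e ∈ Icc (0 : ℝ) 1) (hpp : ∀ e, p e ≤ p' e)
    (S : Finset E) :
    ∀ {f : Config E → ℝ}, DependsOn f (S : Set E) → Monotone f →
    ∫ ω, f ω ∂P ≤ ∫ ω, f ω ∂P' := by
  have := hP.1
  have := hP'.1
  induction S using Finset.induction_on with
  | empty =>
    intro f hf _
    have : f = fun _ => f fun _ => true := funext fun ω => hf (by simp)
    rw [this]
    simp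
  | insert e S he ih =>
    intro f hf hfm
    rw [hP.integral_resample e (hp e) hf, hP'.integral_resample e (hp' e) hf]
    have h1 := ih (dependsOn_update hf true) (hfm.comp (update_mono e true))
    have h0 := ih (dependsOn_update hf false) (hfm.comp (update_mono e false))
    have hF : ∫ ω, f (Function.update ω e false) ∂P ≤ ∫ ω, f (Function.update ω e true) ∂P :=
      integral_mono (integrable_of_dependsOn (dependsOn_update hf false))
        (integrable_of_dependsOn (dependsOn_update hf true))
        fun ω => hfm (update_false_le_true e ω)
    have h4 := mul_le_mul_of_nonneg_left h1 (hp' e).1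
    have h5 := mul_le_mul_of_nonneg_left h0 (sub_nonneg.2 (hp' e).2)
    have h6 := mul_nonneg (sub_nonneg.2 (hpp e)) (sub_nonneg.2 hF)
    nlinarith

end Local

section IncFin

variable {E : Type} [DecidableEq E]

/-- Increasing events each of whose elements has a finite witness. -/
def IncFin (A : Set (Config E)) : Prop :=
  IsUpperSet A ∧ ∀ ω ∈ A, ∃ S : Finset E, mask S ω ∈ A

theorem IncFin.inter {A B : Set (Config E)} (hA : IncFin A) (hB : IncFin B) : IncFin (A ∩ B) := by
  refine ⟨hA.1.inter hB.1, fun ω h => ?_⟩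
  obtain ⟨S, hS⟩ := hA.2 ω h.1
  obtain ⟨T, hT⟩ := hB.2 ω h.2
  exact ⟨S ∪ T, hA.1 (mask_mono_set Finset.subset_union_left ω) hS,
    hB.1 (mask_mono_set Finset.subset_union_right ω) hT⟩

theorem IncFin.iUnion {ι : Sort*} {A : ι → Set (Config E)} (hA : ∀ i, IncFin (A i)) :
    IncFin (⋃ i, A i) := by
  refine ⟨isUpperSet_iUnion fun i => (hA i).1, fun ω h => ?_⟩
  obtain ⟨i, hi⟩ := mem_iUnion.1 h
  obtain ⟨S, hS⟩ := (hA i).2 ω hi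
  exact ⟨S, mem_iUnion.2 ⟨i, hS⟩⟩

theorem incFin_univ : IncFin (univ : Set (Config E)) := ⟨isUpperSet_univ, fun _ _ => ⟨∅, trivial⟩⟩

theorem exists_exhaustion {F : Type} [Countable F] :
    ∃ S : ℕ → Finset F, Monotone S ∧ ∀ T : Finset F, ∃ n, T ⊆ S n := by
  obtain ⟨f, hf⟩ := exists_injective_nat F
  have hfin : ∀ n, {e | f e ≤ n}.Finite := fun n => (finite_Iic n).preimage hf.injOn
  refine ⟨fun n => (hfin n).toFinset, fun m n h => ?_, fun T => ⟨T.sup f, fun e he => ?_⟩⟩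
  · simpa using fun e he => he.trans h
  · simpa using Finset.le_sup he

theorem IncFin.eq_iUnion {A : Set (Config E)} (hA : IncFin A) {S : ℕ → Finset E}
    (hS : ∀ T : Finset E, ∃ n, T ⊆ S n) : A = ⋃ n, mask (S n) ⁻¹' A := by
  ext ω
  rw [mem_iUnion]
  constructor
  · intro h
    obtain ⟨T, hT⟩ := hA.2 ω h
    obtain ⟨n, hn⟩ := hS T
    exact ⟨n, hA.1 (mask_mono_set hn ω) hT⟩
  · rintro ⟨n, hn⟩
    exact hA.1 (mask_le _ _) hn

theorem measurableSet_mask_preimage (A : Set (Config E)) (S : Finset E) :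
    MeasurableSet (mask S ⁻¹' A) :=
  measurableSet_of_dependsOn (S := S) (dependsOn_mask (fun ω => ω ∈ A) S)

theorem IncFin.measurableSet [Countable E] {A : Set (Config E)} (hA : IncFin A) :
    MeasurableSet A := by
  obtain ⟨S, -, hS⟩ := exists_exhaustion (F := E)
  rw [hA.eq_iUnion hS]
  exact MeasurableSet.iUnion fun n => measurableSet_mask_preimage A _

theorem IncFin.tendsto {A : Set (Config E)} (hA : IncFin A) {S : ℕ → Finset E}
    (hSm : Monotone S) (hS : ∀ T : Finset E, ∃ n, T ⊆ S n) (P : Measure (Config E))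
    [IsFiniteMeasure P] :
    Filter.Tendsto (fun n => P.real (mask (S n) ⁻¹' A)) Filter.atTop (nhds (P.real A)) := by
  have h := tendsto_measure_iUnion_atTop (μ := P) (s := fun n => mask (S n) ⁻¹' A)
    fun m n hmn ω hω => hA.1 (mask_mono_set (hSm hmn) ω) hω
  rw [← hA.eq_iUnion hS] at h
  exact (ENNReal.tendsto_toReal (measure_ne_top P A)).comp h



theorem integral_indicator_mask {P : Measure (Config E)} (A : Set (Config E)) (S : Finset E) :
    ∫ ω, A.indicator (1 : Config E → ℝ) (mask S ω) ∂P = P.real (mask S ⁻¹' A) := by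
  rw [← integral_indicator_one (measurableSet_mask_preimage A S)]
  rfl

theorem monotone_indicator {F : Type} {A : Set (Config F)} (hA : IsUpperSet A) :
    Monotone (A.indicator (1 : Config F → ℝ)) := by
  intro ω ω' h
  by_cases h1 : ω ∈ A
  · simp [h1, hA h h1]
  · simp only [h1, not_false_eq_true, indicator_of_notMem]
    exact indicator_nonneg (fun _ _ => zero_le_one) _

variable [Countable E] {p : E → ℝ} {P : Measure (Config E)}

/-- Harris' inequality for increasing events. -/
theorem IncFin.harris {A B : Set (Config E)} (hA : IncFin A) (hB : IncFin B)
    (hP : IsBernoulliProduct p P) (hp : ∀ e, p e ∈ Icc (0 : ℝ) 1) :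
    P.real A * P.real B ≤ P.real (A ∩ B) := by
  have := hP.1
  obtain ⟨S, hSm, hS⟩ := exists_exhaustion (F := E)
  refine le_of_tendsto_of_tendsto' ((hA.tendsto hSm hS P).mul (hB.tendsto hSm hS P))
    ((hA.inter hB).tendsto hSm hS P) fun n => ?_
  have := hP.harris hp (S n) (dependsOn_mask (A.indicator (1 : Config E → ℝ)) (S n))
    (dependsOn_mask (B.indicator (1 : Config E → ℝ)) (S n))
    ((monotone_indicator hA.1).comp (mask_mono _)) ((monotone_indicator hB.1).comp (mask_mono _))
  rw [integral_indicator_mask, integral_indicator_mask] at this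
  refine this.trans (le_of_eq ?_)
  rw [← integral_indicator_mask]
  refine integral_congr_ae (Filter.Eventually.of_forall fun ω => ?_)
  simp only [inter_indicator_one, Pi.mul_apply]

theorem IncFin.harris_compl {A B : Set (Config E)} (hA : IncFin A) (hB : IncFin B)
    (hP : IsBernoulliProduct p P) (hp : ∀ e, p e ∈ Icc (0 : ℝ) 1) :
    P.real Aᶜ * P.real Bᶜ ≤ P.real (Aᶜ ∩ Bᶜ) := by
  have := hP.1
  have h := hA.harris hB hP hp
  have h1 := measureReal_union_add_inter (μ := P) (s := A) (t := B) hB.measurableSet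
  rw [← compl_union, probReal_compl_eq_one_sub hA.measurableSet,
    probReal_compl_eq_one_sub hB.measurableSet,
    probReal_compl_eq_one_sub (hA.measurableSet.union hB.measurableSet)]
  nlinarith

theorem IncFin.le_of_le {A : Set (Config E)} (hA : IncFin A) {p' : E → ℝ}
    {P' : Measure (Config E)}
    (hP : IsBernoulliProduct p P) (hP' : IsBernoulliProduct p' P')
    (hp : ∀ e, p e ∈ Icc (0 : ℝ) 1) (hp' : ∀ e, p' e ∈ Icc (0 : ℝ) 1) (hpp : ∀ e, p e ≤ p' e) :
    P.real A ≤ P'.real A := by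
  have := hP.1
  have := hP'.1
  obtain ⟨S, hSm, hS⟩ := exists_exhaustion (F := E)
  refine le_of_tendsto_of_tendsto' (hA.tendsto hSm hS P) (hA.tendsto hSm hS P') fun n => ?_
  have := hP.integral_le_of_le hP' hp hp' hpp (S n)
    (dependsOn_mask (A.indicator (1 : Config E → ℝ)) (S n))
    ((monotone_indicator hA.1).comp (mask_mono _))
  rwa [integral_indicator_mask, integral_indicator_mask] at this

end IncFin

/-- Lower endpoint of an edge, in integer coordinates. -/
def src (e : SqE) : ℤ × ℤ := (e.1, e.2.1)

/-- Upper endpoint of an edge, in integer coordinates. -/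
def tgt (e : SqE) : ℤ × ℤ := if e.2.2 then (e.1 + 1, e.2.1) else (e.1, e.2.1 + 1)

/-- Adjacency by an open edge, in integer coordinates. -/
def zadj (ω : Config SqE) (u v : ℤ × ℤ) : Prop :=
  ∃ e, ω e = true ∧ ((src e = u ∧ tgt e = v) ∨ (src e = v ∧ tgt e = u))

/-- Open connection by a path all of whose steps stay in `R`. -/
def conn (ω : Config SqE) (R : Set (ℤ × ℤ)) : ℤ × ℤ → ℤ × ℤ → Prop :=
  Relation.ReflTransGen fun u v => zadj ω u v ∧ u ∈ R ∧ v ∈ R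

theorem zadj.symm {ω : Config SqE} {u v : ℤ × ℤ} (h : zadj ω u v) : zadj ω v u := by
  obtain ⟨e, he, h⟩ := h
  exact ⟨e, he, h.symm⟩

theorem zadj.mono {ω ω' : Config SqE} (hω : ω ≤ ω') {u v : ℤ × ℤ} (h : zadj ω u v) :
    zadj ω' u v := by
  obtain ⟨e, he, h⟩ := h
  refine ⟨e, ?_, h⟩
  have := hω e
  rw [he] at this
  exact top_le_iff.1 this

theorem conn.mono {ω ω' : Config SqE} (hω : ω ≤ ω') {R R' : Set (ℤ × ℤ)} (hR : R ⊆ R')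
    {u v : ℤ × ℤ} (h : conn ω R u v) : conn ω' R' u v :=
  Relation.ReflTransGen.mono (fun _ _ h => ⟨h.1.mono hω, hR h.2.1, hR h.2.2⟩) _ _ h

theorem conn.mono_set {ω : Config SqE} {R R' : Set (ℤ × ℤ)} (hR : R ⊆ R')
    {u v : ℤ × ℤ} (h : conn ω R u v) : conn ω R' u v := h.mono le_rfl hR

theorem conn.symm {ω : Config SqE} {R : Set (ℤ × ℤ)} {u v : ℤ × ℤ} (h : conn ω R u v) :
    conn ω R v u := by
  induction h with
  | refl => exact Relation.ReflTransGen.refl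
  | tail _ h ih => exact Relation.ReflTransGen.head ⟨h.1.symm, h.2.2, h.2.1⟩ ih

theorem conn.trans {ω : Config SqE} {R : Set (ℤ × ℤ)} {u v w : ℤ × ℤ} (h : conn ω R u v)
    (h' : conn ω R v w) : conn ω R u w := Relation.ReflTransGen.trans h h'

theorem conn.refl (ω : Config SqE) (R : Set (ℤ × ℤ)) (u : ℤ × ℤ) : conn ω R u u :=
  Relation.ReflTransGen.refl

theorem conn.single {ω : Config SqE} {R : Set (ℤ × ℤ)} {u v : ℤ × ℤ} (h : zadj ω u v)
    (hu : u ∈ R) (hv : v ∈ R) : conn ω R u v := Relation.ReflTransGen.single ⟨h, hu, hv⟩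

theorem conn.mem_of_mem {ω : Config SqE} {R : Set (ℤ × ℤ)} {u v : ℤ × ℤ} (h : conn ω R u v)
    (hu : u ∈ R) : v ∈ R := by
  cases h with
  | refl => exact hu
  | tail _ h => exact h.2.2

theorem incFin_zadj (u v : ℤ × ℤ) : IncFin {ω | zadj ω u v} := by
  refine ⟨fun ω ω' h hω => zadj.mono h hω, fun ω ⟨e, he, h⟩ => ⟨{e}, e, ?_, h⟩⟩
  simpa [mask] using he

theorem incFin_conn (R : Set (ℤ × ℤ)) (u v : ℤ × ℤ) : IncFin {ω | conn ω R u v} := by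
  refine ⟨fun ω ω' h hω => conn.mono h Subset.rfl hω, fun ω h => ?_⟩
  induction h with
  | refl => exact ⟨∅, conn.refl _ _ _⟩
  | @tail v w _ hvw ih =>
    obtain ⟨S, hS⟩ := ih
    obtain ⟨T, hT⟩ := (incFin_zadj v w).2 ω hvw.1
    refine ⟨S ∪ T, (conn.mono (mask_mono_set Finset.subset_union_left ω) Subset.rfl hS).trans
      (conn.single (zadj.mono (mask_mono_set Finset.subset_union_right ω) hT) hvw.2.1 hvw.2.2)⟩

theorem incFin_biInter {E ι : Type} [DecidableEq E] (T : Finset ι) {A : ι → Set (Config E)}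
    (hA : ∀ i, IncFin (A i)) : IncFin (⋂ i ∈ T, A i) := by
  classical
  induction T using Finset.induction_on with
  | empty => simpa using incFin_univ
  | insert i T hi ih =>
    rw [Finset.set_biInter_insert]
    exact (hA i).inter ih

/-- The union of the open clusters meeting `A`. -/
def clus (A : Set (ℤ × ℤ)) (ω : Config SqE) : Set (ℤ × ℤ) := {u | ∃ a ∈ A, conn ω univ a u}

theorem clus_mono {A B : Set (ℤ × ℤ)} (h : A ⊆ B) {ω ω' : Config SqE} (hω : ω ≤ ω') :
    clus A ω ⊆ clus B ω' := fun _ ⟨a, ha, hu⟩ => ⟨a, h ha, hu.mono hω Subset.rfl⟩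

theorem incFin_card_le (v : ℤ × ℤ) (k : ℕ) :
    IncFin {ω | (k : ℕ∞) ≤ (clus {v} ω).encard} := by
  have : {ω | (k : ℕ∞) ≤ (clus {v} ω).encard} =
      ⋃ T : {T : Finset (ℤ × ℤ) // T.card = k}, ⋂ u ∈ T.1, {ω | conn ω univ v u} := by
    ext ω
    simp only [mem_ofPred_eq, mem_iUnion, mem_iInter]
    constructor
    · intro h
      obtain ⟨t, ht, htk⟩ := exists_subset_encard_eq h
      have hf : t.Finite := finite_of_encard_eq_coe htk
      refine ⟨⟨hf.toFinset, ?_⟩, fun u hu => ?_⟩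
      · rw [← Set.ncard_eq_toFinset_card t hf, Set.ncard, htk]; simp
      · obtain ⟨a, ha, hau⟩ := ht (hf.mem_toFinset.1 hu)
        rw [mem_singleton_iff] at ha
        exact ha ▸ hau
    · rintro ⟨⟨T, rfl⟩, h⟩
      rw [← encard_coe_eq_coe_finsetCard]
      exact encard_le_encard fun u hu => ⟨v, rfl, h u hu⟩
  rw [this]
  exact IncFin.iUnion fun T => incFin_biInter _ fun u => incFin_conn _ _ _

theorem clus_update_true {A : Set (ℤ × ℤ)} {e : SqE} {a x : ℤ × ℤ} (ha : a ∈ A)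
    (he : (src e = a ∧ tgt e = x) ∨ (src e = x ∧ tgt e = a)) (ω : Config SqE) :
    clus A (Function.update ω e true) = clus (insert x A) (Function.update ω e false) := by
  have hax : conn (Function.update ω e true) univ a x :=
    conn.single ⟨e, by simp, he⟩ trivial trivial
  refine Subset.antisymm ?_ ?_
  · rintro u ⟨b, hb, hu⟩
    induction hu with
    | refl => exact ⟨b, mem_insert_of_mem _ hb, conn.refl _ _ _⟩
    | @tail u w _ huw ih =>
      obtain ⟨⟨e', he', h⟩, -⟩ := huw
      by_cases hee : e' = e
      · subst hee
        refine ⟨w, ?_, conn.refl _ _ _⟩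
        rcases he with ⟨h1, h2⟩ | ⟨h1, h2⟩ <;> rcases h with ⟨h3, h4⟩ | ⟨h3, h4⟩
        · rw [← h4, h2]; exact mem_insert _ _
        · rw [← h3, h1]; exact mem_insert_of_mem _ ha
        · rw [← h4, h2]; exact mem_insert_of_mem _ ha
        · rw [← h3, h1]; exact mem_insert _ _
      · obtain ⟨c, hc, hcu⟩ := ih
        refine ⟨c, hc, hcu.trans (conn.single ⟨e', ?_, h⟩ trivial trivial)⟩
        simpa [hee] using he'
  · rintro u ⟨b, hb, hu⟩
    have hu' := hu.mono (update_false_le_true e ω) Subset.rfl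
    rcases hb with rfl | hb
    · exact ⟨a, ha, hax.trans hu'⟩
    · exact ⟨b, hb, hu'⟩

theorem clus_union (A B : Set (ℤ × ℤ)) (ω : Config SqE) :
    clus (A ∪ B) ω = clus A ω ∪ clus B ω := by
  ext u
  simp only [clus, mem_ofPred_eq, mem_union]
  constructor
  · rintro ⟨a, ha | ha, h⟩
    · exact Or.inl ⟨a, ha, h⟩
    · exact Or.inr ⟨a, ha, h⟩
  · rintro (⟨a, ha, h⟩ | ⟨a, ha, h⟩)
    · exact ⟨a, Or.inl ha, h⟩
    · exact ⟨a, Or.inr ha, h⟩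

/-- The comparison inequality: a cluster biased by `w` under the larger parameters dominates
the cluster under the smaller parameters. -/
theorem integral_clus_mul_ge {p q : SqE → ℝ} {P Q : Measure (Config SqE)}
    (hP : IsBernoulliProduct p P) (hQ : IsBernoulliProduct q Q)
    (hp : ∀ e, p e ∈ Icc (0 : ℝ) 1) (hq : ∀ e, q e ∈ Icc (0 : ℝ) 1) {ψ : ℝ}
    (hqp : ∀ e, q e ≤ p e * (1 - ψ)) {w F : Set (ℤ × ℤ) → ℝ} (hw : Antitone w)
    (hw0 : ∀ C, 0 ≤ w C) (hwu : ∀ C D, w C * w D ≤ w (C ∪ D)) (hF : Monotone F)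
    (hψ : ∀ x S, 1 - ψ ≤ ∫ ω, w (clus {x} (mask S ω)) ∂P) (n : ℕ) :
    ∀ (S : Finset SqE), S.card = n → ∀ (A : Set (ℤ × ℤ)),
    (∫ ω, w (clus A (mask S ω)) ∂P) * ∫ ω, F (clus A (mask S ω)) ∂Q ≤
      ∫ ω, F (clus A (mask S ω)) * w (clus A (mask S ω)) ∂P := by
  have := hP.1
  have := hQ.1
  induction n with
  | zero =>
    intro S hS A
    have : ∀ ω, mask S ω = fun _ => false := fun ω => by
      funext e; simp [mask, Finset.card_eq_zero.1 hS]
    simp [this, mul_comm]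
  | succ n ih =>
    intro S hS A
    by_cases hex : ∃ e ∈ S, ∃ a ∈ A, ∃ x ∉ A, (src e = a ∧ tgt e = x) ∨ (src e = x ∧ tgt e = a)
    · obtain ⟨e, heS, a, ha, x, hx, he⟩ := hex
      have hcard : (S.erase e).card = n := by rw [Finset.card_erase_of_mem heS, hS]; rfl
      have h1 := ih _ hcard (insert x A)
      have h0 := ih _ hcard A
      have hm0 : ∀ ω, mask S (Function.update ω e false) = mask (S.erase e) ω := fun ω => by
        funext b
        by_cases hb : b = e
        · subst hb; simp [mask]
        · simp [mask, hb]
      have hm1 : ∀ ω, clus A (mask S (Function.update ω e true)) =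
          clus (insert x A) (mask (S.erase e) ω) := fun ω => by
        have : mask S (Function.update ω e true) = Function.update (mask S ω) e true := by
          funext b
          by_cases hb : b = e
          · subst hb; simp [mask, heS]
          · simp [mask, hb]
        have h' : mask (S.erase e) ω = Function.update (mask S ω) e false := by
          funext b
          by_cases hb : b = e
          · subst hb; simp [mask]
          · simp [mask, hb]
        rw [this, clus_update_true ha he, h']
      rw [hP.integral_resample e (hp e) (dependsOn_mask (fun η => w (clus A η)) S),
        hQ.integral_resample e (hq e) (dependsOn_mask (fun η => F (clus A η)) S),
        hP.integral_resample e (hp e) (dependsOn_mask (fun η => F (clus A η) * w (clus A η)) S)]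
      simp only [hm0, hm1]
      set S' := S.erase e
      have hZ : (∫ ω, w (clus (insert x A) (mask S' ω)) ∂P) ≤ ∫ ω, w (clus A (mask S' ω)) ∂P :=
        integral_mono (integrable_of_dependsOn (dependsOn_mask (fun η => w (clus _ η)) S'))
          (integrable_of_dependsOn (dependsOn_mask (fun η => w (clus _ η)) S'))
          fun ω => hw (clus_mono (subset_insert _ _) le_rfl)
      have hQ' : (∫ ω, F (clus A (mask S' ω)) ∂Q) ≤ ∫ ω, F (clus (insert x A) (mask S' ω)) ∂Q :=
        integral_mono (integrable_of_dependsOn (dependsOn_mask (fun η => F (clus _ η)) S'))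
          (integrable_of_dependsOn (dependsOn_mask (fun η => F (clus _ η)) S'))
          fun ω => hF (clus_mono (subset_insert _ _) le_rfl)
      have hfkg : (∫ ω, w (clus A (mask S' ω)) ∂P) * (1 - ψ) ≤
          ∫ ω, w (clus (insert x A) (mask S' ω)) ∂P := by
        have hd := fun B : Set (ℤ × ℤ) => dependsOn_mask (fun η => w (clus B η)) S'
        have ha : ∀ B, Antitone fun ω => w (clus B (mask S' ω)) := fun B ω ω' h =>
          hw (clus_mono Subset.rfl (mask_mono S' h))
        have hh := hP.harris_antitone hp S' (hd A) (hd {x}) (ha A) (ha {x})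
        refine (mul_le_mul_of_nonneg_left (hψ x S') (integral_nonneg fun ω => hw0 _)).trans
          (hh.trans (integral_mono ?_ (integrable_of_dependsOn (hd _)) fun ω => ?_))
        · exact integrable_of_dependsOn (dependsOn_mask (fun η => w (clus A η) * w (clus {x} η)) S')
        · refine (hwu _ _).trans (le_of_eq ?_)
          rw [← clus_union, union_singleton]
      have hZ0 : 0 ≤ ∫ ω, w (clus A (mask S' ω)) ∂P := integral_nonneg fun ω => hw0 _
      set Z1 := ∫ ω, w (clus (insert x A) (mask S' ω)) ∂P
      set Z0 := ∫ ω, w (clus A (mask S' ω)) ∂P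
      set Q1 := ∫ ω, F (clus (insert x A) (mask S' ω)) ∂Q
      set Q0 := ∫ ω, F (clus A (mask S' ω)) ∂Q
      obtain ⟨hpa, hpb⟩ := hp e
      have hmain : q e * (p e * Z1 + (1 - p e) * Z0) ≤ p e * Z1 := by
        have e1 : p e * Z1 + (1 - p e) * Z0 ≤ Z0 := by nlinarith
        have e2 := mul_le_mul_of_nonneg_left e1 (hq e).1
        have e3 := mul_le_mul_of_nonneg_right (hqp e) hZ0
        have e4 := mul_le_mul_of_nonneg_left hfkg hpa
        linarith
      have h4 := mul_le_mul_of_nonneg_left h1 hpa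
      have h5 := mul_le_mul_of_nonneg_left h0 (sub_nonneg.2 hpb)
      have h6 := mul_le_mul_of_nonneg_right hmain (sub_nonneg.2 hQ')
      linarith
    · have : ∀ ω, clus A (mask S ω) = A := fun ω => by
        refine Subset.antisymm ?_ fun a ha => ⟨a, ha, conn.refl _ _ _⟩
        rintro u ⟨a, ha, h⟩
        induction h with
        | refl => exact ha
        | @tail u v _ huv ih =>
          by_contra hv
          obtain ⟨⟨e, he, h⟩, -⟩ := huv
          have heS : e ∈ S := by
            by_contra h'
            simp [mask, h'] at he
          exact hex ⟨e, heS, u, ih, v, hv, h⟩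
      simp [this, mul_comm]

/-- Geometric weight of a set, zero for infinite sets. -/
noncomputable def geomWeight (r : ℝ) (C : Set (ℤ × ℤ)) : ℝ :=
  open Classical in if C.Finite then r ^ C.ncard else 0

theorem geomWeight_nonneg {r : ℝ} (hr : 0 ≤ r) (C : Set (ℤ × ℤ)) : 0 ≤ geomWeight r C := by
  unfold geomWeight; split_ifs <;> positivity

theorem geomWeight_antitone {r : ℝ} (hr : 0 ≤ r) (hr1 : r ≤ 1) : Antitone (geomWeight r) := by
  intro C D h
  by_cases hD : D.Finite
  · simp only [geomWeight, hD, hD.subset h, if_true]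
    exact pow_le_pow_of_le_one hr hr1 (ncard_le_ncard h hD)
  · simpa [geomWeight, hD] using geomWeight_nonneg hr C

theorem geomWeight_union {r : ℝ} (hr : 0 ≤ r) (hr1 : r ≤ 1) (C D : Set (ℤ × ℤ)) :
    geomWeight r C * geomWeight r D ≤ geomWeight r (C ∪ D) := by
  by_cases hC : C.Finite
  · by_cases hD : D.Finite
    · simp only [geomWeight, hC, hD, hC.union hD, if_true, ← pow_add]
      exact pow_le_pow_of_le_one hr hr1 (ncard_union_le C D)
    · simp [geomWeight, hD]
  · simp [geomWeight, hC]

theorem exp_decay_of_uniform {p q : SqE → ℝ} {P Q : Measure (Config SqE)}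
    (hP : IsBernoulliProduct p P) (hQ : IsBernoulliProduct q Q)
    (hp : ∀ e, p e ∈ Icc (0 : ℝ) 1) (hq : ∀ e, q e ∈ Icc (0 : ℝ) 1) {ψ : ℝ} (hψ0 : 0 < ψ)
    (hψ1 : ψ < 1) (hqp : ∀ e, q e ≤ p e * (1 - ψ)) {M : ℕ}
    (hM : ∀ v, P.real {ω | ((M + 1 : ℕ) : ℕ∞) ≤ (clus {v} ω).encard} ≤ ψ / 2) :
    ∀ v (k : ℕ), Q.real {ω | (k : ℕ∞) ≤ (clus {v} ω).encard} ≤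
      (1 - ψ / (2 * (M + 1))) ^ k / (1 - ψ) := by
  have := hP.1
  have := hQ.1
  intro v k
  set h := ψ / (2 * (M + 1)) with hh
  have hM0 : (0 : ℝ) ≤ M := Nat.cast_nonneg M
  have hh0 : 0 < h := by positivity
  have hhM : (M + 1) * h = ψ / 2 := by rw [hh]; field_simp
  have hhψ : h ≤ ψ / 2 := by nlinarith
  have hr0 : 0 ≤ 1 - h := by linarith
  have hr1 : 1 - h ≤ 1 := by linarith
  have hψw : ∀ x S, 1 - ψ ≤ ∫ ω, geomWeight (1 - h) (clus {x} (mask S ω)) ∂P := by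
    intro x S
    set A : Set (Config SqE) := {ω | ((M + 1 : ℕ) : ℕ∞) ≤ (clus {x} ω).encard} with hA
    have hAm : P.real (mask S ⁻¹' A) ≤ ψ / 2 :=
      (measureReal_mono fun ω hω => (incFin_card_le x (M + 1)).1 (mask_le S ω) hω).trans (hM x)
    have hpow : 1 - ψ / 2 ≤ (1 - h) ^ M := by
      have := one_add_mul_le_pow (a := -h) (by linarith) M
      have h2 : (1 : ℝ) + M * -h ≤ (1 - h) ^ M := by simpa [sub_eq_add_neg] using this
      nlinarith
    have hbound : ∫ ω, (1 - h) ^ M * (mask S ⁻¹' A)ᶜ.indicator 1 ω ∂P ≤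
        ∫ ω, geomWeight (1 - h) (clus {x} (mask S ω)) ∂P := by
      refine integral_mono ?_ (integrable_of_dependsOn
        (dependsOn_mask (fun η => geomWeight (1 - h) (clus {x} η)) S)) fun ω => ?_
      · exact ((integrable_const (1 : ℝ)).indicator
          (measurableSet_mask_preimage A S).compl).const_mul _
      · by_cases hω : mask S ω ∈ A
        · simpa [hω] using geomWeight_nonneg hr0 _
        · have hω' : (clus {x} (mask S ω)).encard < ((M + 1 : ℕ) : ℕ∞) := not_le.1 hω
          have hfin : (clus {x} (mask S ω)).Finite :=
            finite_of_encard_le_coe (k := M + 1) hω'.le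
          have hcard : (clus {x} (mask S ω)).ncard ≤ M := by
            rw [← hfin.cast_ncard_eq] at hω'
            have := Nat.cast_lt.1 hω'
            omega
          simp only [geomWeight, hfin, if_true]
          simpa [hω] using pow_le_pow_of_le_one hr0 hr1 hcard
    rw [integral_const_mul, integral_indicator_one (measurableSet_mask_preimage A S).compl,
      probReal_compl_eq_one_sub (measurableSet_mask_preimage A S)] at hbound
    refine le_trans ?_ hbound
    nlinarith [mul_le_mul hpow (by linarith : 1 - ψ / 2 ≤ 1 - P.real (mask S ⁻¹' A))
      (by linarith) (by positivity)]
  obtain ⟨S, hSm, hS⟩ := exists_exhaustion (F := SqE)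
  refine le_of_tendsto' ((incFin_card_le v k).tendsto hSm hS Q) fun n => ?_
  set A : Set (Config SqE) := {ω | (k : ℕ∞) ≤ (clus {v} ω).encard} with hA
  set F : Set (ℤ × ℤ) → ℝ := {C | (k : ℕ∞) ≤ C.encard}.indicator 1 with hFdef
  have hF : Monotone F := by
    intro C D hCD
    by_cases h1 : (k : ℕ∞) ≤ C.encard
    · have h2 := h1.trans (encard_le_encard hCD)
      simp [F, h1, h2]
    · simp only [F, indicator, mem_ofPred_eq, h1, if_false, Pi.one_apply]
      split_ifs <;> simp
  have key := integral_clus_mul_ge hP hQ hp hq hqp (geomWeight_antitone hr0 hr1)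
    (geomWeight_nonneg hr0) (geomWeight_union hr0 hr1) hF hψw _ (S n) rfl {v}
  have hFA : ∫ ω, F (clus {v} (mask (S n) ω)) ∂Q = Q.real (mask (S n) ⁻¹' A) := by
    rw [← integral_indicator_mask]
    rfl
  have hup : ∫ ω, F (clus {v} (mask (S n) ω)) *
      geomWeight (1 - h) (clus {v} (mask (S n) ω)) ∂P ≤ ∫ ω, (1 - h) ^ k ∂P := by
    refine integral_mono (integrable_of_dependsOn
        (dependsOn_mask (fun η => F (clus {v} η) * geomWeight (1 - h) (clus {v} η)) (S n)))
        (integrable_const _) fun ω => ?_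
    simp only [F, indicator, mem_ofPred_eq]
    split_ifs with h1
    · by_cases hfin : (clus {v} (mask (S n) ω)).Finite
      · simp only [geomWeight, hfin, if_true, Pi.one_apply, one_mul]
        rw [← hfin.cast_ncard_eq] at h1
        exact pow_le_pow_of_le_one hr0 hr1 (Nat.cast_le.1 h1)
      · simp only [geomWeight, hfin, if_false, mul_zero]
        positivity
    · simp only [zero_mul]; positivity
  rw [hFA] at key
  rw [integral_const, probReal_univ, one_smul] at hup
  rw [le_div_iff₀ (by linarith), mul_comm]
  exact (mul_le_mul_of_nonneg_right (hψw v (S n)) measureReal_nonneg).trans (key.trans hup)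

theorem conn_equiv {ω ω' : Config SqE} (τ : ℤ × ℤ ≃ ℤ × ℤ)
    (h : ∀ u v, zadj ω' u v ↔ zadj ω (τ u) (τ v)) {R R' : Set (ℤ × ℤ)}
    (hR : ∀ u, u ∈ R' ↔ τ u ∈ R) (u v : ℤ × ℤ) : conn ω' R' u v ↔ conn ω R (τ u) (τ v) := by
  constructor
  · intro h'
    induction h' with
    | refl => exact conn.refl _ _ _
    | tail _ h1 ih =>
      exact ih.trans (conn.single ((h _ _).1 h1.1) ((hR _).1 h1.2.1) ((hR _).1 h1.2.2))
  · intro h'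
    have key : ∀ w, conn ω R (τ u) w → conn ω' R' u (τ.symm w) := by
      intro w hw
      induction hw with
      | refl => simpa using conn.refl _ _ _
      | tail _ h1 ih =>
        refine ih.trans (conn.single ((h _ _).2 ?_) ((hR _).2 ?_) ((hR _).2 ?_))
        · simpa using h1.1
        · simpa using h1.2.1
        · simpa using h1.2.2
    simpa using key _ h'

theorem clus_equiv {ω ω' : Config SqE} (τ : ℤ × ℤ ≃ ℤ × ℤ)
    (h : ∀ u v, zadj ω' u v ↔ zadj ω (τ u) (τ v)) (v : ℤ × ℤ) :
    clus {τ v} ω = τ '' clus {v} ω' := by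
  ext u
  simp only [clus, mem_singleton_iff, exists_eq_left, mem_ofPred_eq, mem_image]
  constructor
  · intro hu
    exact ⟨τ.symm u, (conn_equiv τ h (R := univ) (fun _ => by simp) _ _).2 (by simpa using hu),
      by simp⟩
  · rintro ⟨w, hw, rfl⟩
    exact (conn_equiv τ h (R := univ) (fun _ => by simp) _ _).1 hw

/-- Translation of a configuration. -/
def shift (s t : ℤ) (ω : Config SqE) : Config SqE := fun e => ω (e.1 + s, e.2.1 + t, e.2.2)

/-- Translation of vertices. -/
def vshift (s t : ℤ) : ℤ × ℤ ≃ ℤ × ℤ := (Equiv.addRight s).prodCongr (Equiv.addRight t)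

@[simp] theorem vshift_apply (s t : ℤ) (v : ℤ × ℤ) : vshift s t v = (v.1 + s, v.2 + t) := rfl

theorem zadj_shift (s t : ℤ) (ω : Config SqE) (u v : ℤ × ℤ) :
    zadj (shift s t ω) u v ↔ zadj ω (vshift s t u) (vshift s t v) := by
  have key : ∀ (e : SqE) (w : ℤ × ℤ), (src e = w ↔ src (e.1 + s, e.2.1 + t, e.2.2) = vshift s t w) ∧
      (tgt e = w ↔ tgt (e.1 + s, e.2.1 + t, e.2.2) = vshift s t w) := by
    rintro ⟨a, b, x⟩ ⟨c, d⟩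
    cases x <;> simp [src, tgt, add_right_comm _ s 1, add_right_comm _ t 1]
  constructor
  · rintro ⟨e, he, h⟩
    exact ⟨_, he, by rwa [← (key e u).1, ← (key e v).2, ← (key e v).1, ← (key e u).2]⟩
  · rintro ⟨⟨a, b, x⟩, he, h⟩
    refine ⟨(a - s, b - t, x), by simpa [shift] using he, ?_⟩
    rw [(key _ u).1, (key _ v).2, (key _ v).1, (key _ u).2]
    simpa using h

theorem shift_law {q q' : ℤ → ℝ} {P : Measure (Config SqE)}
    (hP : IsBernoulliProduct (rsqHI q q') P) (s t : ℤ) :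
    IsBernoulliProduct (rsqHI (fun n => q (n + (s + t))) fun n => q' (n + (s + t)))
      (P.map (shift s t)) := by
  have := hP.map_equiv (fun e : SqE => ((e.1 + s, e.2.1 + t, e.2.2) : SqE)) (by
    rintro ⟨a, b, x⟩ ⟨c, d, y⟩ h
    simpa using h)
  convert this using 1
  · funext e
    simp only [rsqHI]
    rw [show e.1 + s + (e.2.1 + t) = e.1 + e.2.1 + (s + t) by ring]
  · rfl

theorem measurable_shift (s t : ℤ) : Measurable (shift s t) :=
  measurable_pi_lambda _ fun a => measurable_pi_apply _

/-- The primal edge crossed by a dual edge; the dual vertex `(a, b)` sits at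
`(a + 1/2, b - 1/2)`. -/
def dualE (e : SqE) : SqE := if e.2.2 then (e.1 + 1, e.2.1 - 1, false) else (e.1, e.2.1, true)

/-- The dual configuration. -/
def dual (ω : Config SqE) : Config SqE := fun e => !ω (dualE e)

theorem dualE_injective : Function.Injective dualE := by
  rintro ⟨a, b, x⟩ ⟨c, d, y⟩ h
  cases x <;> cases y <;> simp_all [dualE]

theorem dual_law {q q' : ℤ → ℝ} {P : Measure (Config SqE)}
    (hP : IsBernoulliProduct (rsqHI q q') P) :
    IsBernoulliProduct (rsqHI (fun n => 1 - q' n) fun n => 1 - q n) (P.map dual) := by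
  have := (hP.map_equiv dualE dualE_injective).map_not
  have h1 : Measurable fun (ω : Config SqE) (e : SqE) => !ω e :=
    measurable_pi_lambda _ fun a =>
      (measurable_of_finite (fun b : Bool => !b)).comp (measurable_pi_apply a)
  have h2 : Measurable fun (ω : Config SqE) (e : SqE) => ω (dualE e) :=
    measurable_pi_lambda _ fun a => measurable_pi_apply _
  rw [Measure.map_map h1 h2] at this
  convert this using 1
  · funext ⟨a, b, x⟩
    cases x <;> simp [rsqHI, dualE]
  · rfl

theorem measurable_dual : Measurable dual := measurable_pi_lambda _ fun a =>
  (measurable_of_finite (fun b : Bool => !b)).comp (measurable_pi_apply _)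

/-- Reflection of edges through the origin. -/
def reflE (e : SqE) : SqE := if e.2.2 then (-e.1 - 1, -e.2.1, true) else (-e.1, -e.2.1 - 1, false)

/-- Reflection of configurations through the origin. -/
def refl (ω : Config SqE) : Config SqE := fun e => ω (reflE e)

theorem reflE_reflE (e : SqE) : reflE (reflE e) = e := by
  obtain ⟨a, b, x⟩ := e
  cases x <;> simp [reflE]

theorem zadj_refl (ω : Config SqE) (u v : ℤ × ℤ) :
    zadj (refl ω) u v ↔ zadj ω (Equiv.neg _ u) (Equiv.neg _ v) := by
  have key : ∀ (e : SqE) (w : ℤ × ℤ), (src e = w ↔ tgt (reflE e) = -w) ∧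
      (tgt e = w ↔ src (reflE e) = -w) := by
    rintro ⟨a, b, x⟩ ⟨c, d⟩
    cases x <;> simp [src, tgt, reflE, Prod.ext_iff] <;> omega
  simp only [Equiv.neg_apply]
  constructor
  · rintro ⟨e, he, h⟩
    refine ⟨_, he, ?_⟩
    rw [← (key e u).1, ← (key e v).2, ← (key e v).1, ← (key e u).2]
    tauto
  · rintro ⟨e, he, h⟩
    refine ⟨reflE e, by simpa [refl, reflE_reflE] using he, ?_⟩
    rw [(key _ u).1, (key _ v).2, (key _ v).1, (key _ u).2, reflE_reflE]
    tauto

theorem refl_law {q q' : ℤ → ℝ} {P : Measure (Config SqE)}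
    (hP : IsBernoulliProduct (rsqHI q q') P) :
    IsBernoulliProduct (rsqHI (fun n => q (-n - 1)) fun n => q' (-n - 1)) (P.map refl) := by
  have := hP.map_equiv reflE (Function.LeftInverse.injective reflE_reflE)
  convert this using 1
  · funext ⟨a, b, x⟩
    cases x <;> simp only [rsqHI, reflE, Bool.false_eq_true, if_false, if_true] <;> congr 1 <;> ring
  · rfl

theorem measurable_refl : Measurable refl :=
  measurable_pi_lambda _ fun a => measurable_pi_apply _

theorem rsqHI_mem {q q' : ℤ → ℝ} {I : Set ℝ} (hq : ∀ n, q n ∈ I) (hq' : ∀ n, q' n ∈ I) (e : SqE) :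
    rsqHI q q' e ∈ I := by
  unfold rsqHI
  split_ifs
  · exact hq _
  · exact hq' _

/-- The cluster of `v` leaves the box of radius `N` about `0`. -/
def exits (N : ℕ) (ω : Config SqE) : Prop :=
  ∃ u, conn ω univ 0 u ∧ u ∉ (Icc (-N : ℤ) N ×ˢ Icc (-N : ℤ) N : Set (ℤ × ℤ))

/-- The edges near the box of radius `N`. -/
noncomputable def boxE (N : ℕ) : Finset SqE :=
  Finset.Icc (-N - 1 : ℤ) (N + 1) ×ˢ Finset.Icc (-N - 1 : ℤ) (N + 1) ×ˢ Finset.univ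

theorem exits_mask (N : ℕ) (ω : Config SqE) : exits N (mask (boxE N) ω) ↔ exits N ω := by
  constructor
  · rintro ⟨u, hu, h⟩
    exact ⟨u, hu.mono (mask_le _ _) Subset.rfl, h⟩
  · rintro ⟨u, hu, h⟩
    have key : conn (mask (boxE N) ω) univ 0 u ∨ exits N (mask (boxE N) ω) := by
      clear h
      induction hu with
      | refl => exact Or.inl (conn.refl _ _ _)
      | @tail v w _ hvw ih =>
        rcases ih with ih | ih
        · by_cases hv : v ∈ (Icc (-N : ℤ) N ×ˢ Icc (-N : ℤ) N : Set (ℤ × ℤ))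
          · left
            refine ih.trans (conn.single ?_ trivial trivial)
            obtain ⟨⟨⟨a, b, x⟩, he, h⟩, -⟩ := hvw
            refine ⟨(a, b, x), ?_, h⟩
            have : (a, b, x) ∈ boxE N := by
              obtain ⟨v1, v2⟩ := v
              obtain ⟨⟨h1, h2⟩, h3, h4⟩ := hv
              simp only [boxE, Finset.mem_product, Finset.mem_Icc, Finset.mem_univ, and_true]
              cases x <;> simp [src, tgt] at h h1 h2 h3 h4 ⊢ <;> omega
            simpa [mask, this] using he
          · exact Or.inr ⟨v, ih, hv⟩
        · exact Or.inr ih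
    rcases key with key | key
    · exact ⟨u, key, h⟩
    · exact key

theorem exits_dependsOn (N : ℕ) : DependsOn (fun ω => exits N ω) (boxE N : Set SqE) := by
  have : (fun ω => exits N ω) = fun ω => exits N (mask (boxE N) ω) :=
    funext fun ω => propext (exits_mask N ω).symm
  rw [this]
  exact dependsOn_mask _ _

theorem incFin_exits (N : ℕ) : IncFin {ω | exits N ω} := by
  refine ⟨fun ω ω' h ⟨u, hu, h'⟩ => ⟨u, hu.mono h Subset.rfl, h'⟩, fun ω h => ?_⟩
  exact ⟨_, (exits_mask N ω).2 h⟩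

theorem exits_of_infinite {ω : Config SqE} (h : (clus {0} ω).Infinite) (N : ℕ) : exits N ω := by
  by_contra h'
  refine h ((((finite_Icc (-N : ℤ) N).prod (finite_Icc (-N : ℤ) N))).subset ?_)
  rintro u ⟨a, rfl, hu⟩
  by_contra hu'
  exact h' ⟨u, hu, hu'⟩

theorem infinite_of_exits {ω : Config SqE} (h : ∀ N, exits N ω) : (clus {0} ω).Infinite := by
  intro hfin
  obtain ⟨N, hN⟩ : ∃ N : ℕ, ∀ u ∈ clus {0} ω, |u.1| ≤ N ∧ |u.2| ≤ N := by
    obtain ⟨N, hN⟩ := (hfin.image fun u => max u.1.natAbs u.2.natAbs).bddAbove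
    refine ⟨N, fun u hu => ?_⟩
    have := hN ⟨u, hu, rfl⟩
    simp only [max_le_iff] at this
    rw [Int.abs_eq_natAbs, Int.abs_eq_natAbs]
    exact ⟨by exact_mod_cast this.1, by exact_mod_cast this.2⟩
  obtain ⟨u, hu, hu'⟩ := h N
  have := hN u ⟨0, rfl, hu⟩
  exact hu' ⟨abs_le.1 this.1, abs_le.1 this.2⟩

theorem exits_antitone : Antitone fun N => {ω | exits N ω} := by
  rintro M N h ω ⟨u, hu, h'⟩
  refine ⟨u, hu, fun hu' => h' ?_⟩
  have : (M : ℤ) ≤ N := by exact_mod_cast h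
  simp only [mem_prod, mem_Icc] at hu' ⊢
  omega

theorem setOf_infinite_eq : {ω | (clus {0} ω).Infinite} = ⋂ N, {ω | exits N ω} := by
  ext ω
  simp only [mem_ofPred_eq, mem_iInter]
  exact ⟨exits_of_infinite, infinite_of_exits⟩

theorem tendsto_exits (P : Measure (Config SqE)) [IsFiniteMeasure P] :
    Filter.Tendsto (fun N => P.real {ω | exits N ω}) Filter.atTop
      (nhds (P.real {ω | (clus {0} ω).Infinite})) := by
  rw [setOf_infinite_eq]
  exact (ENNReal.tendsto_toReal (measure_ne_top P _)).comp
    (tendsto_measure_iInter_atTop (fun N => (incFin_exits N).measurableSet.nullMeasurableSet)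
      exits_antitone ⟨0, measure_ne_top _ _⟩)

theorem clus_shift (s t : ℤ) (ω : Config SqE) :
    clus {(s, t)} ω = vshift s t '' clus {0} (shift s t ω) := by
  have := clus_equiv (vshift s t) (zadj_shift s t ω) 0
  simpa using this

theorem exists_continuous_integral {E : Type} [DecidableEq E] (S : Finset E) :
    ∀ {f : Config E → ℝ}, DependsOn f (S : Set E) →
    ∃ G : (E → ℝ) → ℝ, Continuous G ∧ ∀ (p : E → ℝ) (P : Measure (Config E)),
      (∀ e, p e ∈ Icc (0 : ℝ) 1) → IsBernoulliProduct p P → ∫ ω, f ω ∂P = G p := by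
  induction S using Finset.induction_on with
  | empty =>
    intro f hf
    refine ⟨fun _ => f fun _ => true, continuous_const, fun p P _ hP => ?_⟩
    have := hP.1
    have : f = fun _ => f fun _ => true := funext fun ω => hf (by simp)
    rw [this]
    simp
  | insert e S he ih =>
    intro f hf
    obtain ⟨G1, hc1, h1⟩ := ih (dependsOn_update hf true)
    obtain ⟨G0, hc0, h0⟩ := ih (dependsOn_update hf false)
    refine ⟨fun p => p e * G1 p + (1 - p e) * G0 p, by fun_prop, fun p P hp hP => ?_⟩
    rw [hP.integral_resample e (hp e) hf, h1 p P hp hP, h0 p P hp hP]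

/-- The height of a vertex. -/
def ht (v : ℤ × ℤ) : ℤ := v.1 + v.2

/-- Indicator with values in `ZMod 2`. -/
noncomputable def ind2 (p : Prop) : ZMod 2 := open Classical in if p then 1 else 0

@[simp] theorem ind2_true {p : Prop} (h : p) : ind2 p = 1 := by simp [ind2, h]
@[simp] theorem ind2_false {p : Prop} (h : ¬p) : ind2 p = 0 := by simp [ind2, h]

theorem zmod2_add_self (x : ZMod 2) : x + x = 0 := CharTwo.add_self_eq_zero x

/-- Crossing parity of a dual step from `u` to `w`, which changes the potential `f`. -/
theorem exists_potential_step {ω : Config SqE} {K : ℤ} {u v w : ℤ × ℤ} {f : ℤ × ℤ → ZMod 2}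
    (h0 : ∀ x, K ≤ ht x → f x = 0)
    (h1 : ∀ a b, ω (a, b, false) = true → f (a, b) = f (a, b + 1))
    (h2 : ∀ a b, ω (a, b, true) = true →
      f (a, b) + f (a + 1, b) = ind2 (a = u.1 ∧ b < u.2) + ind2 (a = v.1 ∧ b < v.2))
    {e : SqE} (he : dual ω e = true) (hv : ht v ≤ K) (hw : ht w ≤ K)
    (hvw : (src e = v ∧ tgt e = w) ∨ (src e = w ∧ tgt e = v)) :
    ∃ f' : ℤ × ℤ → ZMod 2, (∀ x, K ≤ ht x → f' x = 0) ∧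
      (∀ a b, ω (a, b, false) = true → f' (a, b) = f' (a, b + 1)) ∧
      ∀ a b, ω (a, b, true) = true →
        f' (a, b) + f' (a + 1, b) = ind2 (a = u.1 ∧ b < u.2) + ind2 (a = w.1 ∧ b < w.2) := by
  obtain ⟨c, d, t⟩ := e
  cases t
  · have hcl : ω (c, d, true) = false := by simpa [dual, dualE] using he
    refine ⟨f, h0, h1, fun a b hab => ?_⟩
    rw [h2 a b hab]
    congr 2
    have hne : ¬(a = c ∧ b = d) := by rintro ⟨rfl, rfl⟩; simp [hcl] at hab
    rcases hvw with ⟨rfl, rfl⟩ | ⟨rfl, rfl⟩ <;> simp only [src, tgt, Bool.false_eq_true, if_false,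
      eq_iff_iff] <;> omega
  · have hcl : ω (c + 1, d - 1, false) = false := by simpa [dual, dualE] using he
    refine ⟨fun x => f x + ind2 (x.1 = c + 1 ∧ x.2 < d), fun x hx => ?_, fun a b hab => ?_,
      fun a b hab => ?_⟩
    · have : ¬(x.1 = c + 1 ∧ x.2 < d) := by
        rcases hvw with ⟨rfl, rfl⟩ | ⟨rfl, rfl⟩ <;> simp [src, tgt, ht] at hv hw hx ⊢ <;> omega
      simp [h0 x hx, this]
    · have hne : ¬(a = c + 1 ∧ b = d - 1) := by rintro ⟨rfl, rfl⟩; simp [hcl] at hab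
      simp only [h1 a b hab]
      congr 2
      simp only [eq_iff_iff]
      omega
    · have key : ind2 (a = c + 1 ∧ b < d) + ind2 (a + 1 = c + 1 ∧ b < d) =
          ind2 (a = v.1 ∧ b < v.2) + ind2 (a = w.1 ∧ b < w.2) := by
        rw [show (a + 1 = c + 1) = (a = c) by simp]
        rcases hvw with ⟨rfl, rfl⟩ | ⟨rfl, rfl⟩ <;> simp only [src, tgt, if_true]
        rw [add_comm]
      calc _ = (f (a, b) + f (a + 1, b)) +
            (ind2 (a = c + 1 ∧ b < d) + ind2 (a + 1 = c + 1 ∧ b < d)) := by ring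
        _ = ind2 (a = u.1 ∧ b < u.2) + ind2 (a = w.1 ∧ b < w.2) +
            (ind2 (a = v.1 ∧ b < v.2) + ind2 (a = v.1 ∧ b < v.2)) := by
          rw [h2 a b hab, key]; ring
        _ = _ := by rw [zmod2_add_self, add_zero]

theorem exists_potential {ω : Config SqE} {K : ℤ} {u w : ℤ × ℤ}
    (h : conn (dual ω) {x | ht x ≤ K} u w) :
    ∃ f : ℤ × ℤ → ZMod 2, (∀ x, K ≤ ht x → f x = 0) ∧
      (∀ a b, ω (a, b, false) = true → f (a, b) = f (a, b + 1)) ∧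
      ∀ a b, ω (a, b, true) = true →
        f (a, b) + f (a + 1, b) = ind2 (a = u.1 ∧ b < u.2) + ind2 (a = w.1 ∧ b < w.2) := by
  induction h with
  | refl => exact ⟨fun _ => 0, by simp, by simp, fun a b _ => by simp only [zmod2_add_self]⟩
  | @tail v w _ hvw ih =>
    obtain ⟨f, h0, h1, h2⟩ := ih
    obtain ⟨⟨e, he, h⟩, hv, hw⟩ := hvw
    exact exists_potential_step h0 h1 h2 he hv hw h

/-- A function that is constant along open edges inside `R` is constant along paths in `R`. -/
theorem conn.eq_of_invariant {ω : Config SqE} {R : Set (ℤ × ℤ)} {α : Type*} {g : ℤ × ℤ → α}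
    (h1 : ∀ a b, ω (a, b, false) = true → (a, b) ∈ R → (a, b + 1) ∈ R → g (a, b) = g (a, b + 1))
    (h2 : ∀ a b, ω (a, b, true) = true → (a, b) ∈ R → (a + 1, b) ∈ R → g (a, b) = g (a + 1, b))
    {x y : ℤ × ℤ} (h : conn ω R x y) : g x = g y := by
  induction h with
  | refl => rfl
  | tail _ hvw ih =>
    rw [ih]
    obtain ⟨⟨⟨a, b, t⟩, he, h⟩, hv, hw⟩ := hvw
    cases t <;> rcases h with ⟨rfl, rfl⟩ | ⟨rfl, rfl⟩
    · exact h1 a b he hv hw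
    · exact (h1 a b he hw hv).symm
    · exact h2 a b he hv hw
    · exact (h2 a b he hw hv).symm

theorem ind2_le_succ (a c : ℤ) : ind2 (a ≤ c) + ind2 (a + 1 ≤ c) = ind2 (a = c) := by
  by_cases h1 : a + 1 ≤ c
  · rw [ind2_true h1, ind2_true (by omega), ind2_false (by omega)]; rfl
  · by_cases h2 : a ≤ c
    · rw [ind2_false h1, ind2_true h2, ind2_true (by omega)]; rfl
    · rw [ind2_false h1, ind2_false h2, ind2_false (by omega)]; rfl

theorem zmod2_eq_of_add {x y : ZMod 2} (h : x + y = 0) : x = y := by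
  revert x y; decide

/-- Two disjointly coloured arcs cannot interlace at the top of a half-plane. -/
theorem top_parity {ω : Config SqE} {K : ℤ} {u w x y : ℤ × ℤ}
    (hd : conn (dual ω) {x | ht x ≤ K} u w) (hu : ht u = K) (hw : ht w = K)
    (hc : conn ω {x | ht x ≤ K} x y) (hx : ht x = K) (hy : ht y = K) :
    ind2 (x.1 ≤ u.1) + ind2 (x.1 ≤ w.1) = ind2 (y.1 ≤ u.1) + ind2 (y.1 ≤ w.1) := by
  obtain ⟨f, h0, h1, h2⟩ := exists_potential hd
  have := conn.eq_of_invariant (g := fun x => f x + ind2 (x.1 ≤ u.1) + ind2 (x.1 ≤ w.1))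
    (fun a b he _ _ => by simp only [h1 a b he]) (fun a b he hab hab' => by
      have h3 := h2 a b he
      refine zmod2_eq_of_add ?_
      simp only
      calc _ = (f (a, b) + f (a + 1, b)) + (ind2 (a ≤ u.1) + ind2 (a + 1 ≤ u.1)) +
            (ind2 (a ≤ w.1) + ind2 (a + 1 ≤ w.1)) := by ring
        _ = 0 := by
          have e1 : (a = u.1 ∧ b < u.2) = (a = u.1) := by
            simp only [ht, mem_ofPred_eq] at hab' hu; simp only [eq_iff_iff]; omega
          have e2 : (a = w.1 ∧ b < w.2) = (a = w.1) := by
            simp only [ht, mem_ofPred_eq] at hab' hw; simp only [eq_iff_iff]; omega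
          rw [h3, ind2_le_succ, ind2_le_succ, e1, e2, add_assoc, zmod2_add_self]) hc
  simpa [h0 x hx.ge, h0 y hy.ge] using this

theorem not_interlace_left {ω : Config SqE} {K : ℤ} {u w x y : ℤ × ℤ}
    (hd : conn (dual ω) {x | ht x ≤ K} u w) (hu : ht u = K) (hw : ht w = K)
    (hc : conn ω {x | ht x ≤ K} x y) (hx : ht x = K) (hy : ht y = K)
    (h1 : x.1 ≤ u.1) (h2 : u.1 < y.1) (h3 : y.1 ≤ w.1) : False := by
  have := top_parity hd hu hw hc hx hy
  rw [ind2_true h1, ind2_true (by omega), ind2_false (by omega), ind2_true h3] at this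
  revert this; decide

/-- A dual crossing of a strip separates the tops on its two sides. -/
theorem strip_separation {ω : Config SqE} {K : ℤ} {u w x y : ℤ × ℤ}
    (hd : conn (dual ω) {x | ht x ≤ K} u w) (hu : ht u = K) (hw : ht w = 0)
    (hc : conn ω {x | 0 ≤ ht x ∧ ht x ≤ K} x y) (hx : ht x = K) (hy : ht y = K) :
    x.1 ≤ u.1 ↔ y.1 ≤ u.1 := by
  obtain ⟨f, h0, h1, h2⟩ := exists_potential hd
  have := conn.eq_of_invariant (g := fun x => f x + ind2 (x.1 ≤ u.1))
    (fun a b he _ _ => by simp only [h1 a b he]) (fun a b he hab hab' => by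
      have h3 := h2 a b he
      refine zmod2_eq_of_add ?_
      simp only
      calc _ = (f (a, b) + f (a + 1, b)) + (ind2 (a ≤ u.1) + ind2 (a + 1 ≤ u.1)) := by ring
        _ = 0 := by
          have e1 : (a = u.1 ∧ b < u.2) = (a = u.1) := by
            simp only [ht, mem_ofPred_eq] at hab' hu; simp only [eq_iff_iff]; omega
          have e2 : ¬(a = w.1 ∧ b < w.2) := by
            simp only [ht, mem_ofPred_eq] at hab hw; omega
          rw [h3, ind2_le_succ, e1, ind2_false e2, add_zero, zmod2_add_self]) hc
  simp only [h0 x hx.ge, h0 y hy.ge, zero_add] at this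
  by_cases ha : x.1 ≤ u.1 <;> by_cases hb : y.1 ≤ u.1 <;> simp [ha, hb] at this ⊢

section Indep

variable {E : Type} [DecidableEq E] {p : E → ℝ} {P : Measure (Config E)}

theorem indicator_dependsOn {F : Type} {A : Set (Config F)} {S : Set F}
    (hA : DependsOn (fun ω => ω ∈ A) S) : DependsOn (A.indicator (1 : Config F → ℝ)) S := by
  intro ω ω' h
  have h' : (ω ∈ A) = (ω' ∈ A) := hA h
  by_cases h1 : ω ∈ A
  · have h2 : ω' ∈ A := h' ▸ h1
    simp [h1, h2]
  · have h2 : ω' ∉ A := h' ▸ h1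
    simp [h1, h2]

theorem IsBernoulliProduct.real_inter_eq (hP : IsBernoulliProduct p P)
    (hp : ∀ e, p e ∈ Icc (0 : ℝ) 1) {S T : Finset E} (hST : Disjoint S T) {A B : Set (Config E)}
    (hA : DependsOn (fun ω => ω ∈ A) (S : Set E)) (hB : DependsOn (fun ω => ω ∈ B) (T : Set E)) :
    P.real (A ∩ B) = P.real A * P.real B := by
  have := hP.1
  have hAm := measurableSet_of_dependsOn hA
  have hBm := measurableSet_of_dependsOn hB
  have := hP.integral_mul_eq hp hST (indicator_dependsOn hB) (indicator_dependsOn hA)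
  rw [integral_indicator_one hAm, integral_indicator_one hBm] at this
  rw [← this, ← integral_indicator_one (hAm.inter hBm)]
  refine integral_congr_ae (Filter.Eventually.of_forall fun ω => ?_)
  simp only [inter_indicator_one, Pi.mul_apply]

theorem IsBernoulliProduct.ae_exists_all_eq (hP : IsBernoulliProduct p P)
    {ε : ℝ} (hε : 0 < ε) (hp : ∀ e, p e ∈ Icc ε (1 - ε)) (b : Bool) {m : ℕ} {S : ℕ → Finset E}
    (hS : Pairwise fun i j => Disjoint (S i) (S j)) (hm : ∀ i, (S i).card = m) :
    ∀ᵐ ω ∂P, ∃ i, ∀ e ∈ S i, ω e = b := by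
  have := hP.1
  have hp' : ∀ e, p e ∈ Icc (0 : ℝ) 1 :=
    fun e => ⟨hε.le.trans (hp e).1, by linarith [(hp e).2]⟩
  have hdep : ∀ i, DependsOn (fun ω : Config E => ω ∈ {ω : Config E | ¬∀ e ∈ S i, ω e = b})
      (S i : Set E) := by
    intro i ω ω' h
    simp only [mem_ofPred_eq, eq_iff_iff]
    exact not_congr (forall₂_congr fun e he => by rw [h e he])
  have hone : ∀ i, P.real {ω : Config E | ¬∀ e ∈ S i, ω e = b} ≤ 1 - ε ^ m := by
    intro i
    have h1 := hP.finite_energy_le hε.le hp b (S i) MeasurableSet.univ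
    simp only [preimage_univ, probReal_univ, mul_one, univ_inter, hm] at h1
    have h2 : {ω : Config E | ¬∀ e ∈ S i, ω e = b} = {ω | ∀ e ∈ S i, ω e = b}ᶜ := rfl
    rw [h2, probReal_compl_eq_one_sub (measurableSet_cyl _ _)]
    linarith
  have hnn : 0 ≤ 1 - ε ^ m := measureReal_nonneg.trans (hone 0)
  have hbound : ∀ n, P.real {ω : Config E | ∀ i < n, ¬∀ e ∈ S i, ω e = b} ≤ (1 - ε ^ m) ^ n := by
    intro n
    induction n with
    | zero => simp
    | succ n ih =>
      have heq : {ω : Config E | ∀ i < n + 1, ¬∀ e ∈ S i, ω e = b} =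
          {ω | ∀ i < n, ¬∀ e ∈ S i, ω e = b} ∩ {ω | ¬∀ e ∈ S n, ω e = b} := by
        ext ω
        simp only [mem_ofPred_eq, mem_inter_iff, Nat.forall_lt_succ_right]
      have hd : DependsOn (fun ω : Config E => ω ∈ {ω : Config E | ∀ i < n, ¬∀ e ∈ S i, ω e = b})
          ((Finset.range n).biUnion S : Set E) := by
        intro ω ω' h
        simp only [mem_ofPred_eq, eq_iff_iff]
        exact forall₂_congr fun i hi => not_congr (forall₂_congr fun e he => by
          rw [h e (by simpa using ⟨i, hi, he⟩)])
      rw [heq, hP.real_inter_eq hp' ((Finset.disjoint_biUnion_left _ _ _).2 fun i hi =>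
        hS (Finset.mem_range.1 hi).ne) (by exact_mod_cast hd) (hdep n), pow_succ]
      exact mul_le_mul ih (hone n) measureReal_nonneg (pow_nonneg hnn n)
  have hz : P.real {ω : Config E | ¬∃ i, ∀ e ∈ S i, ω e = b} ≤ 0 := by
    refine ge_of_tendsto' (tendsto_pow_atTop_nhds_zero_of_lt_one hnn
      (by linarith [pow_pos hε m])) fun n => le_trans (measureReal_mono ?_) (hbound n)
    intro ω hω i _ h
    exact hω ⟨i, h⟩
  rw [ae_iff]
  exact (measureReal_eq_zero_iff).1 (le_antisymm hz measureReal_nonneg)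

end Indep

/-- The edges crossing from column `a` to column `a + 1` at heights in `[-K, K]`. -/
noncomputable def colE (K : ℕ) (a : ℤ) : Finset SqE :=
  (Finset.Icc (-K : ℤ) K).image fun j => (a, j - a, true)

theorem card_colE (K : ℕ) (a : ℤ) : (colE K a).card = 2 * K + 1 := by
  rw [colE, Finset.card_image_of_injective _ (fun i j h => by simpa using h)]
  simp; omega

theorem disjoint_colE (K : ℕ) {a a' : ℤ} (h : a ≠ a') : Disjoint (colE K a) (colE K a') := by
  rw [Finset.disjoint_left]
  rintro ⟨c, d, t⟩ h1 h2
  simp only [colE, Finset.mem_image, Prod.mk.injEq] at h1 h2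
  obtain ⟨_, _, h1, _⟩ := h1
  obtain ⟨_, _, h2, _⟩ := h2
  exact h (h1.trans h2.symm)

/-- Every strip is blocked arbitrarily far away on either side. -/
def Blocked (ω : Config SqE) : Prop :=
  ∀ (K : ℕ) (A : ℕ), (∃ i : ℕ, ∀ e ∈ colE K (A + i), ω e = false) ∧
    ∃ i : ℕ, ∀ e ∈ colE K (-A - i), ω e = false

theorem ae_blocked {p : SqE → ℝ} {P : Measure (Config SqE)} (hP : IsBernoulliProduct p P)
    {ε : ℝ} (hε : 0 < ε) (hp : ∀ e, p e ∈ Icc ε (1 - ε)) : ∀ᵐ ω ∂P, Blocked ω := by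
  simp only [Blocked, ae_all_iff, Filter.eventually_and]
  refine fun K A => ⟨?_, ?_⟩
  · exact hP.ae_exists_all_eq hε hp false
      (fun i j h => disjoint_colE K (by simpa using h)) fun i => card_colE _ _
  · exact hP.ae_exists_all_eq hε hp false
      (fun i j h => disjoint_colE K (by simpa using h)) fun i => card_colE _ _

theorem Blocked.finite {ω : Config SqE} (hω : Blocked ω) {K : ℕ}
    (hK : ∀ u, conn ω univ 0 u → |ht u| ≤ K) : (clus {0} ω).Finite := by
  obtain ⟨⟨i, hi⟩, -⟩ := hω K 0
  obtain ⟨-, j, hj⟩ := hω K 1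
  have key : ∀ u, conn ω univ 0 u → -1 - (j : ℤ) < u.1 ∧ u.1 ≤ i := by
    intro u hu
    have hu0 := hu
    induction hu with
    | refl => simp; omega
    | @tail v w hv hvw ih =>
      have hvK := hK v hv
      have hwK := hK w hu0
      have ih := ih hv
      have hno : ∀ a, (∀ e ∈ colE K a, ω e = false) → ∀ b, |a + b| ≤ K →
          ω (a, b, true) ≠ true := by
        intro a ha b hb
        rw [abs_le] at hb
        rw [ha (a, b, true) (by
          simp only [colE, Finset.mem_image, Finset.mem_Icc]
          exact ⟨a + b, hb, by ring_nf⟩)]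
        simp
      obtain ⟨⟨⟨a, b, t⟩, he, h⟩, -⟩ := hvw
      cases t
      · rcases h with ⟨rfl, rfl⟩ | ⟨rfl, rfl⟩ <;> simpa [src, tgt] using ih
      · have hb : |a + b| ≤ K := by
          rcases h with ⟨rfl, rfl⟩ | ⟨rfl, rfl⟩
          · exact hvK
          · exact hwK
        have h1 : a ≠ i := by
          rintro rfl
          exact hno i (by simpa using hi) b hb he
        have h2 : a ≠ -1 - (j : ℤ) := by
          rintro rfl
          exact hno _ (by simpa using hj) b hb he
        rcases h with ⟨rfl, rfl⟩ | ⟨rfl, rfl⟩ <;> simp [src, tgt] at ih ⊢ <;> omega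
  refine (((finite_Icc (-1 - (j : ℤ)) i).prod
    (finite_Icc (-(K : ℤ) - i) (K + 1 + j)))).subset ?_
  rintro u ⟨a, rfl, hu⟩
  have h1 := key u hu
  have h2 := abs_le.1 (hK u hu)
  simp only [ht] at h2
  simp only [mem_prod, mem_Icc]
  omega

/-- The cluster of `v` is unbounded above. -/
def upw (ω : Config SqE) (v : ℤ × ℤ) : Prop := ∀ K : ℕ, ∃ u, conn ω univ v u ∧ (K : ℤ) ≤ ht u

theorem upw_or_upw_refl {ω : Config SqE} (hω : Blocked ω) (h : (clus {0} ω).Infinite) :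
    upw ω 0 ∨ upw (refl ω) 0 := by
  by_contra hno
  rw [not_or] at hno
  obtain ⟨h1, h2⟩ := hno
  simp only [upw, not_forall, not_exists, not_and, not_le] at h1 h2
  obtain ⟨K1, h1⟩ := h1
  obtain ⟨K2, h2⟩ := h2
  refine h (hω.finite (K := max K1 K2) fun u hu => abs_le.2 ?_)
  have h3 := h1 u hu
  have h4 := h2 (-u) ((conn_equiv (Equiv.neg _) (zadj_refl ω) (R := univ) (fun _ => by simp)
    _ _).2 (by simpa using hu))
  simp only [ht, Prod.fst_neg, Prod.snd_neg] at *
  push_cast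
  omega

theorem measurableSet_upw (v : ℤ × ℤ) : MeasurableSet {ω | upw ω v} := by
  have : {ω | upw ω v} = ⋂ K : ℕ, ⋃ u : {u : ℤ × ℤ // (K : ℤ) ≤ ht u}, {ω | conn ω univ v u} := by
    ext ω
    simp only [upw, mem_ofPred_eq, mem_iInter, mem_iUnion, Subtype.exists, exists_prop]
    exact forall_congr' fun K => exists_congr fun u => and_comm
  rw [this]
  exact MeasurableSet.iInter fun K => MeasurableSet.iUnion fun u =>
    (incFin_conn _ _ _).measurableSet

section approx
variable {E : Type} [DecidableEq E]

/-- Events depending on finitely many edges. -/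
def localEvents (E : Type) : Set (Set (Config E)) :=
  {A | ∃ S : Finset E, DependsOn (fun ω => ω ∈ A) (S : Set E)}

theorem isSetRing_localEvents : IsSetRing (localEvents E) := by
  refine ⟨⟨∅, fun _ _ _ => rfl⟩, ?_, ?_⟩
  · rintro A B ⟨S, hS⟩ ⟨T, hT⟩
    refine ⟨S ∪ T, fun x y h => ?_⟩
    have h1 := hS fun i hi => h i (by simp at hi ⊢; exact Or.inl hi)
    have h2 := hT fun i hi => h i (by simp at hi ⊢; exact Or.inr hi)
    simp only [mem_union] at *
    rw [h1, h2]
  · rintro A B ⟨S, hS⟩ ⟨T, hT⟩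
    refine ⟨S ∪ T, fun x y h => ?_⟩
    have h1 := hS fun i hi => h i (by simp at hi ⊢; exact Or.inl hi)
    have h2 := hT fun i hi => h i (by simp at hi ⊢; exact Or.inr hi)
    simp only [mem_sdiff] at *
    rw [h1, h2]

theorem generateFrom_localEvents {F : Type} :
    (inferInstance : MeasurableSpace (Config F)) = MeasurableSpace.generateFrom (localEvents F) := by
  apply le_antisymm
  · refine iSup_le fun e => ?_
    rintro _ ⟨B, -, rfl⟩
    refine MeasurableSpace.measurableSet_generateFrom ⟨{e}, fun x y h => ?_⟩
    simp [h e (by simp)]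
  · refine MeasurableSpace.generateFrom_le ?_
    rintro A ⟨S, hS⟩
    exact measurableSet_of_dependsOn hS

theorem exists_local_approx (P : Measure (Config E)) [IsFiniteMeasure P] {A : Set (Config E)}
    (hA : MeasurableSet A) {η : ℝ} (hη : 0 < η) :
    ∃ (S : Finset E) (G : Set (Config E)), DependsOn (fun ω => ω ∈ G) (S : Set E) ∧
      P.real (symmDiff G A) < η := by
  obtain ⟨G, ⟨S, hS⟩, hG⟩ := exists_measure_symmDiff_lt_of_generateFrom_isSetRing (μ := P)
    isSetRing_localEvents ⟨{univ}, countable_singleton _, by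
      rintro _ rfl; exact ⟨∅, fun _ _ _ => rfl⟩, by simp⟩ generateFrom_localEvents hA
      (ENNReal.ofReal_pos.2 hη)
  refine ⟨S, G, hS, ?_⟩
  rw [Measure.real]
  exact (ENNReal.toReal_lt_toReal (by finiteness) (by finiteness)).2 hG |>.trans_eq
    (ENNReal.toReal_ofReal hη.le)

end approx

theorem shift_dependsOn {A : Set (Config SqE)} {S : Finset SqE}
    (hA : DependsOn (fun ω => ω ∈ A) (S : Set SqE)) (s t : ℤ) :
    DependsOn (fun ω => ω ∈ shift s t ⁻¹' A)
      ((S.image fun e => ((e.1 + s, e.2.1 + t, e.2.2) : SqE) : Finset SqE) : Set SqE) := by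
  intro x y h
  refine hA fun i hi => ?_
  exact h _ (Finset.mem_coe.2 (Finset.mem_image_of_mem
    (fun e : SqE => ((e.1 + s, e.2.1 + t, e.2.2) : SqE)) hi))

theorem exists_disjoint_shift (S : Finset SqE) :
    ∃ s : ℤ, Disjoint S (S.image fun e => ((e.1 + s, e.2.1 + -s, e.2.2) : SqE)) := by
  obtain ⟨M, hM⟩ : ∃ M : ℤ, ∀ e ∈ S, |e.1| ≤ M := by
    obtain ⟨M, hM⟩ := (S.image fun e : SqE => |e.1|).bddAbove
    exact ⟨M, fun e he => hM (Finset.mem_coe.2 (Finset.mem_image_of_mem (fun e : SqE => |e.1|) he))⟩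
  refine ⟨2 * M + 1, Finset.disjoint_left.2 fun e he he' => ?_⟩
  obtain ⟨f, hf, rfl⟩ := Finset.mem_image.1 he'
  have h1 := abs_le.1 (hM _ he)
  have h2 := abs_le.1 (hM _ hf)
  simp only at h1
  omega

theorem abs_real_sub_le {α : Type*} [MeasurableSpace α] (P : Measure α) [IsFiniteMeasure P]
    {A B : Set α} : |P.real A - P.real B| ≤ P.real (symmDiff A B) := by
  have h1 : P.real A ≤ P.real B + P.real (symmDiff A B) :=
    (measureReal_mono (fun x hx => by
      by_cases h : x ∈ B
      · exact Or.inl h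
      · exact Or.inr (Or.inl ⟨hx, h⟩))).trans (measureReal_union_le _ _)
  have h2 : P.real B ≤ P.real A + P.real (symmDiff A B) :=
    (measureReal_mono (fun x hx => by
      by_cases h : x ∈ A
      · exact Or.inl h
      · exact Or.inr (Or.inr ⟨hx, h⟩))).trans (measureReal_union_le _ _)
  rw [abs_le]
  constructor <;> linarith

theorem measurePreserving_shift {q q' : ℤ → ℝ} {P : Measure (Config SqE)}
    (hP : IsBernoulliProduct (rsqHI q q') P) (s : ℤ) :
    MeasurePreserving (shift s (-s)) P P := by
  refine ⟨measurable_shift _ _, ?_⟩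
  refine IsBernoulliProduct.unique ?_ hP
  simpa using shift_law hP s (-s)

theorem real_shift_invariant {q q' : ℤ → ℝ} {P : Measure (Config SqE)}
    (hP : IsBernoulliProduct (rsqHI q q') P) (hp : ∀ e, rsqHI q q' e ∈ Icc (0 : ℝ) 1)
    {A : Set (Config SqE)} (hA : MeasurableSet A) (hinv : ∀ s, shift s (-s) ⁻¹' A = A) :
    P.real A = P.real A * P.real A := by
  have := hP.1
  have key : ∀ η : ℝ, 0 < η → |P.real A - P.real A * P.real A| ≤ 0 + 4 * η := by
    intro η hη
    obtain ⟨S, G, hG, hGA⟩ := exists_local_approx P hA hη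
    obtain ⟨s, hs⟩ := exists_disjoint_shift S
    have hGm : MeasurableSet G := measurableSet_of_dependsOn hG
    have hind := hP.real_inter_eq hp hs hG (shift_dependsOn hG s (-s))
    have hpres := measurePreserving_shift hP s
    have hGs : P.real (shift s (-s) ⁻¹' G) = P.real G :=
      hpres.measureReal_preimage hGm.nullMeasurableSet
    have hsd : P.real (symmDiff (shift s (-s) ⁻¹' G) A) = P.real (symmDiff G A) := by
      rw [← hpres.measureReal_preimage (hGm.symmDiff hA).nullMeasurableSet, preimage_symmDiff, hinv]
    have h1 : |P.real (G ∩ shift s (-s) ⁻¹' G) - P.real A| ≤ 2 * η := by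
      refine (abs_real_sub_le P).trans ?_
      refine (measureReal_mono (s₂ := symmDiff G A ∪ symmDiff (shift s (-s) ⁻¹' G) A) ?_).trans
        ((measureReal_union_le _ _).trans (by rw [hsd]; linarith))
      intro x hx
      simp only [mem_symmDiff, mem_union, mem_inter_iff] at hx ⊢
      tauto
    have h2 := (abs_real_sub_le P (A := G) (B := A)).trans hGA.le
    rw [hind, hGs] at h1
    have g0 : P.real G ≤ 1 := measureReal_le_one
    have g1 : 0 ≤ P.real G := measureReal_nonneg
    have a0 : P.real A ≤ 1 := measureReal_le_one
    have a1 : 0 ≤ P.real A := measureReal_nonneg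
    have h3 : |P.real G * P.real G - P.real A * P.real A| ≤ 2 * η := by
      rw [show P.real G * P.real G - P.real A * P.real A =
        (P.real G + P.real A) * (P.real G - P.real A) by ring, abs_mul,
        abs_of_nonneg (by linarith)]
      nlinarith [abs_nonneg (P.real G - P.real A)]
    rw [abs_le] at *
    constructor <;> linarith
  have h0 : |P.real A - P.real A * P.real A| ≤ 0 := by
    refine le_of_forall_pos_le_add fun η hη => ?_
    have := key (η / 4) (by positivity)
    linarith
  have := abs_nonpos_iff.1 h0
  linarith

theorem conn_shift (s t : ℤ) (ω : Config SqE) {R R' : Set (ℤ × ℤ)}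
    (hR : ∀ u, u ∈ R' ↔ vshift s t u ∈ R) (u v : ℤ × ℤ) :
    conn (shift s t ω) R' u v ↔ conn ω R (vshift s t u) (vshift s t v) :=
  conn_equiv _ (zadj_shift s t ω) hR u v

theorem upw_shift (s : ℤ) (ω : Config SqE) (v : ℤ × ℤ) :
    upw (shift s (-s) ω) v ↔ upw ω (vshift s (-s) v) := by
  refine forall_congr' fun K => ?_
  rw [← (vshift s (-s)).exists_congr_right (q := fun u => conn ω univ _ u ∧ (K : ℤ) ≤ ht u)]
  refine exists_congr fun u => ?_
  rw [conn_shift s (-s) ω (R := univ) (by simp)]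
  simp only [ht, vshift_apply]
  rw [show u.1 + s + (u.2 + -s) = u.1 + u.2 by ring]

/-- If some vertex has positive probability of an upward unbounded cluster, then a long enough
segment of row `0` meets such a cluster with probability close to `1`. -/
theorem exists_segment {q q' : ℤ → ℝ} {P : Measure (Config SqE)}
    (hP : IsBernoulliProduct (rsqHI q q') P) (hp : ∀ e, rsqHI q q' e ∈ Icc (0 : ℝ) 1)
    (hpos : P.real {ω | upw ω 0} ≠ 0) {η : ℝ} (hη : 0 < η) :
    ∃ m : ℕ, 1 - η < P.real {ω | ∃ i : ℤ, 0 ≤ i ∧ i ≤ m ∧ upw ω (i, -i)} := by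
  have := hP.1
  set A : ℕ → Set (Config SqE) := fun m => {ω | ∃ i : ℤ, |i| ≤ m ∧ upw ω (i, -i)} with hAdef
  have hAm : ∀ m, MeasurableSet (A m) := by
    intro m
    have : A m = ⋃ i : {i : ℤ // |i| ≤ m}, {ω | upw ω (i, -i)} := by ext; simp [A]
    rw [this]
    exact MeasurableSet.iUnion fun i => measurableSet_upw _
  have hmono : Monotone A := by
    rintro m n hmn ω ⟨i, hi, h⟩
    exact ⟨i, hi.trans (by exact_mod_cast hmn), h⟩
  have hinv : ∀ s, shift s (-s) ⁻¹' (⋃ m, A m) = ⋃ m, A m := by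
    intro s
    have hU : ∀ ω, ω ∈ (⋃ m, A m) ↔ ∃ i : ℤ, upw ω (i, -i) := by
      intro ω
      simp only [A, mem_iUnion, mem_ofPred_eq]
      constructor
      · rintro ⟨m, i, -, h⟩; exact ⟨i, h⟩
      · rintro ⟨i, h⟩; exact ⟨i.natAbs, i, by simp, h⟩
    ext ω
    rw [mem_preimage, hU, hU, ← (Equiv.addRight s).exists_congr_right
      (q := fun i : ℤ => upw ω (i, -i))]
    refine exists_congr fun i => ?_
    rw [upw_shift]
    simp [add_comm]
  have h1 := real_shift_invariant hP hp (MeasurableSet.iUnion hAm) hinv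
  have h2 : P.real (⋃ m, A m) ≠ 0 := by
    intro h0
    refine hpos (le_antisymm (h0 ▸ measureReal_mono ?_) measureReal_nonneg)
    intro ω hω
    exact mem_iUnion.2 ⟨0, 0, by simp, by simpa using! hω⟩
  have h3 : P.real (⋃ m, A m) = 1 := by
    have := mul_left_cancel₀ h2 (h1.symm.trans (mul_one _).symm)
    exact this
  have h4 : Filter.Tendsto (fun m => P.real (A m)) Filter.atTop (nhds 1) := by
    rw [← h3]
    exact (ENNReal.tendsto_toReal (by finiteness)).comp (tendsto_measure_iUnion_atTop hmono)
  obtain ⟨m, hm⟩ := (h4.eventually_const_lt (show 1 - η < 1 by linarith)).exists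
  refine ⟨2 * m, hm.trans_le ?_⟩
  rw [← (measurePreserving_shift hP m).measureReal_preimage (hAm m).nullMeasurableSet]
  refine measureReal_mono ?_
  rintro ω ⟨i, hi, h⟩
  rw [upw_shift] at h
  have := abs_le.1 hi
  refine ⟨i + m, by omega, by push_cast; omega, ?_⟩
  simpa [add_comm] using h

/-- A set function on intervals with a quantitative square-root trick can be split into many
intervals on which it is small. -/
theorem exists_partition {ε : ℝ} (hε : 0 < ε) (N : ℕ) :
    ∀ {δ : ℝ}, 0 < δ → ∃ η : ℝ, 0 < η ∧ ∀ f : ℤ → ℤ → ℝ, (∀ s, f s s = 1) →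
      (∀ s u t, s ≤ u → u ≤ t → f s u * f u t ≤ f s t) →
      (∀ s t, s ≤ t → ε * f s t ≤ f s (t + 1)) → (∀ s t, 0 ≤ f s t) →
      ∀ s t, s ≤ t → f s t ≤ η →
      ∃ u : ℕ → ℤ, u 0 = s ∧ ∀ i < N, u i ≤ u (i + 1) ∧ f (u i) (u (i + 1)) ≤ δ := by
  induction N with
  | zero =>
    intro δ hδ
    exact ⟨1, one_pos, fun f _ _ _ _ s t _ _ => ⟨fun _ => s, rfl, by simp⟩⟩
  | succ N ih =>
    intro δ hδ
    obtain ⟨η, hη, H⟩ := ih hδ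
    obtain ⟨r, hr0, hr⟩ : ∃ r : ℝ, 0 < r ∧ r < 1 ∧ r ≤ δ ∧ r ≤ ε * η := by
      refine ⟨min (1 / 2) (min δ (ε * η)), by positivity, ?_, ?_, ?_⟩
      · exact (min_le_left _ _).trans_lt (by norm_num)
      · exact (min_le_right _ _).trans (min_le_left _ _)
      · exact (min_le_right _ _).trans (min_le_right _ _)
    obtain ⟨hr1, hrδ, hrη⟩ := hr
    refine ⟨r ^ 2, by positivity, ?_⟩
    intro f h1 hmul hstep h0 s t hst hft
    have hex : ∃ n : ℕ, f s (s + n) ≤ r := by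
      refine ⟨(t - s).toNat, ?_⟩
      rw [Int.toNat_of_nonneg (by omega), add_sub_cancel]
      nlinarith
    classical
    set n := Nat.find hex with hn
    have hn1 : f s (s + n) ≤ r := Nat.find_spec hex
    have hnt : s + n ≤ t := by
      have : n ≤ (t - s).toNat := Nat.find_min' hex (by
        rw [Int.toNat_of_nonneg (by omega), add_sub_cancel]
        nlinarith)
      omega
    have hn0 : n ≠ 0 := by
      intro h
      rw [h] at hn1
      simp [h1] at hn1
      linarith
    obtain ⟨k, hk⟩ := Nat.exists_eq_succ_of_ne_zero hn0
    have hk1 : r < f s (s + k) := by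
      by_contra hcon
      exact Nat.find_min hex (m := k) (by omega) (not_lt.1 hcon)
    have hk2 := hstep s (s + k) (by omega)
    have e1 : s + (k : ℤ) + 1 = s + (n : ℕ) := by rw [hk]; push_cast; ring
    rw [e1] at hk2
    have hm := hmul s (s + n) t (by omega) hnt
    have h2 : f (s + n) t ≤ η := by
      have ha : ε * r ≤ f s (s + n) := by nlinarith
      have hb : ε * r * f (s + n) t ≤ r ^ 2 := by nlinarith [h0 (s + n) t]
      have hc : ε * f (s + n) t ≤ r := by
        by_contra hcon
        nlinarith
      by_contra hcon
      nlinarith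
    obtain ⟨u, hu0, hu⟩ := H f h1 hmul hstep h0 _ _ hnt h2
    refine ⟨fun i => if i = 0 then s else u (i - 1), rfl, ?_⟩
    rintro (_ | i) hi
    · simp only [if_true, zero_add, one_ne_zero, if_false, Nat.sub_self, hu0]
      exact ⟨by omega, hn1.trans hrδ⟩
    · simpa using hu i (by omega)

/-- The half plane below height `K`. -/
def below (K : ℤ) : Set (ℤ × ℤ) := {v | ht v ≤ K}

/-- Some vertex of row `0` with index in `I` is joined, below height `K`, to some vertex at height
`K` with index in `S`. -/
def hit (I : Set ℤ) (K : ℤ) (S : Set ℤ) (ω : Config SqE) : Prop :=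
  ∃ a ∈ I, ∃ j ∈ S, conn ω (below K) (a, -a) (j, K - j)

theorem incFin_hit (I : Set ℤ) (K : ℤ) (S : Set ℤ) : IncFin {ω | hit I K S ω} := by
  have : {ω | hit I K S ω} = ⋃ a : I, ⋃ j : S, {ω | conn ω (below K) (a, -a) (j, K - j)} := by
    ext; simp [hit]
  rw [this]
  exact IncFin.iUnion fun a => IncFin.iUnion fun j => incFin_conn _ _ _

theorem hit_union (I : Set ℤ) (K : ℤ) (S T : Set ℤ) (ω : Config SqE) :
    hit I K (S ∪ T) ω ↔ hit I K S ω ∨ hit I K T ω := by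
  simp only [hit, mem_union, or_and_right, exists_or, and_or_left]

theorem hit_mono {I : Set ℤ} {K : ℤ} {S T : Set ℤ} (h : S ⊆ T) {ω ω' : Config SqE} (hω : ω ≤ ω')
    (hh : hit I K S ω) : hit I K T ω' := by
  obtain ⟨a, ha, j, hj, hc⟩ := hh
  exact ⟨a, ha, j, h hj, hc.mono hω le_rfl⟩

/-- The two edges below the vertex of index `j` at height `K`. -/
def downE (K j : ℤ) : Finset SqE := {(j - 1, K - j, true), (j, K - j - 1, false)}

theorem setOn_false_le {E : Type} [DecidableEq E] (S : Finset E) (ω : Config E) :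
    setOn S false ω ≤ ω := by
  intro e
  simp only [setOn]
  split_ifs <;> simp

theorem le_setOn_true {E : Type} [DecidableEq E] (S : Finset E) (ω : Config E) :
    ω ≤ setOn S true ω := by
  intro e
  simp only [setOn]
  split_ifs <;> simp [Bool.le_true]

theorem hit_insert_setOn {I : Set ℤ} {K : ℤ} (hK : 1 ≤ K) {S : Set ℤ} {j : ℤ} {ω : Config SqE}
    (h : hit I K (insert j S) (setOn (downE K j) false ω)) : hit I K S ω := by
  obtain ⟨a, ha, i, hi, hc⟩ := h
  rcases hi with rfl | hi
  · exfalso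
    rcases Relation.ReflTransGen.cases_tail hc with h | ⟨v, hv, ⟨⟨x, y, t⟩, he, h⟩, hv1, -⟩
    · simp only [Prod.mk.injEq] at h
      omega
    · have hv2 : ht v ≤ K := hv1
      simp only [setOn, downE, Finset.mem_insert, Finset.mem_singleton, Prod.mk.injEq] at he
      split_ifs at he with h'
      rcases h with ⟨rfl, h⟩ | ⟨h, rfl⟩ <;> cases t <;> simp [src, tgt, ht] at h hv2 h' <;> omega
  · exact ⟨a, ha, i, hi, hc.mono (setOn_false_le _ _) le_rfl⟩

/-- First passage at height `K`. -/
theorem conn.exists_first_passage {ω : Config SqE} {R : Set (ℤ × ℤ)} {v u : ℤ × ℤ} {K : ℤ}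
    (h : conn ω R v u) (hv : ht v ≤ K) (hu : K ≤ ht u) :
    ∃ w, conn ω (R ∩ below K) v w ∧ ht w = K := by
  have key : ∀ u, conn ω R v u → (conn ω (R ∩ below K) v u ∧ ht u ≤ K) ∨
      ∃ w, conn ω (R ∩ below K) v w ∧ ht w = K := by
    intro u h
    induction h with
    | refl => exact Or.inl ⟨conn.refl _ _ _, hv⟩
    | @tail x y hx hxy ih =>
      rcases ih with ⟨ih, hxK⟩ | ih
      · by_cases hxe : ht x = K
        · exact Or.inr ⟨x, ih, hxe⟩
        · have hy : ht y ≤ K := by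
            obtain ⟨⟨a, b, t⟩, -, h⟩ := hxy.1
            rcases h with ⟨rfl, rfl⟩ | ⟨rfl, rfl⟩ <;> cases t <;>
              simp [src, tgt, ht] at hxK hxe ⊢ <;> omega
          exact Or.inl ⟨ih.trans (conn.single hxy.1 ⟨hxy.2.1, hxK⟩ ⟨hxy.2.2, hy⟩), hy⟩
      · exact Or.inr ih
  rcases key u h with ⟨h', h2⟩ | h'
  · exact ⟨u, h', le_antisymm h2 hu⟩
  · exact h'

theorem upw.hit {ω : Config SqE} {I : Set ℤ} {a : ℤ} (ha : a ∈ I) (h : upw ω (a, -a)) {K : ℤ}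
    (hK : 0 ≤ K) : hit I K univ ω := by
  obtain ⟨u, hu, hKu⟩ := h K.toNat
  obtain ⟨w, hw, hwK⟩ := hu.exists_first_passage (K := K) (by simpa [ht] using hK) (by omega)
  rw [univ_inter] at hw
  refine ⟨a, ha, w.1, mem_univ _, ?_⟩
  rwa [show ((w.1, K - w.1) : ℤ × ℤ) = w by ext <;> simp [ht] at hwK ⊢; omega]

theorem exists_arcs {q q' : ℤ → ℝ} {P : Measure (Config SqE)}
    (hP : IsBernoulliProduct (rsqHI q q') P) {ε : ℝ} (hε : 0 < ε)
    (hp : ∀ e, rsqHI q q' e ∈ Icc ε (1 - ε)) (hpos : P.real {ω | upw ω 0} ≠ 0)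
    (N : ℕ) {δ : ℝ} (hδ : 0 < δ) :
    ∃ m : ℕ, ∀ K : ℤ, 1 ≤ K → ∃ u : ℕ → ℤ, ∀ i < N, u i ≤ u (i + 1) ∧
      P.real {ω | hit (Icc 0 (m : ℤ)) K (Ico (u i) (u (i + 1))) ω}ᶜ ≤ δ := by
  have hPm := hP.1
  have hp01 : ∀ e, rsqHI q q' e ∈ Icc (0 : ℝ) 1 := fun e =>
    ⟨hε.le.trans (hp e).1, (hp e).2.trans (by linarith)⟩
  obtain ⟨η, hη, H⟩ := exists_partition (ε := ε ^ 2) (by positivity) N hδ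
  obtain ⟨m, hm⟩ := exists_segment hP hp01 hpos hη
  refine ⟨m, fun K hK => ?_⟩
  set I : Set ℤ := Icc 0 (m : ℤ)
  set f : ℤ → ℤ → ℝ := fun s t => P.real {ω | hit I K (Ico s t) ω}ᶜ with hf
  have hUn : P.real {ω | hit I K univ ω}ᶜ < η := by
    have hle : 1 - η < P.real {ω | hit I K univ ω} := hm.trans_le (measureReal_mono (by
      rintro ω ⟨i, h0, h1, h⟩
      exact h.hit (I := I) ⟨h0, h1⟩ (by omega)))
    rw [probReal_compl_eq_one_sub (incFin_hit _ _ _).measurableSet]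
    linarith
  obtain ⟨M, hM⟩ : ∃ M : ℕ, f (-M) M ≤ η := by
    have hU : (⋂ M : ℕ, {ω | hit I K (Ico (-M : ℤ) M) ω}ᶜ) = {ω | hit I K univ ω}ᶜ := by
      rw [← compl_iUnion]
      congr 1
      ext ω
      simp only [mem_iUnion, mem_ofPred_eq]
      constructor
      · rintro ⟨M, h⟩
        exact hit_mono (subset_univ _) le_rfl h
      · rintro ⟨a, ha, j, -, h⟩
        exact ⟨j.natAbs + 1, a, ha, j, ⟨by omega, by omega⟩, h⟩
    have hanti : Antitone fun M : ℕ => {ω | hit I K (Ico (-M : ℤ) M) ω}ᶜ := by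
      intro M M' h
      refine compl_subset_compl.2 fun ω hω => hit_mono (Ico_subset_Ico ?_ ?_) le_rfl hω <;> omega
    have ht := (ENNReal.tendsto_toReal (by finiteness)).comp (tendsto_measure_iInter_atTop (μ := P)
      (fun M : ℕ => ((incFin_hit I K (Ico (-(M : ℤ)) M)).measurableSet.compl).nullMeasurableSet) hanti
      ⟨0, by finiteness⟩)
    rw [hU] at ht
    obtain ⟨M, hM⟩ := (ht.eventually_lt_const hUn).exists
    exact ⟨M, hM.le⟩
  have hone : ∀ s, f s s = 1 := by
    intro s
    have : {ω | hit I K (Ico s s) ω} = ∅ := by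
      ext ω
      simp only [hit, Ico_self, mem_empty_iff_false, false_and, exists_false, and_false,
        mem_ofPred_eq]
    simp only [f]
    rw [this, compl_empty, probReal_univ]
  have hmul : ∀ s v t, s ≤ v → v ≤ t → f s v * f v t ≤ f s t := by
    intro s v t h1 h2
    refine ((incFin_hit I K _).harris_compl (incFin_hit I K _) hP hp01).trans ?_
    refine measureReal_mono ?_
    rw [← Ico_union_Ico_eq_Ico h1 h2]
    rintro ω ⟨h1, h2⟩ h3
    rcases (hit_union _ _ _ _ _).1 h3 with h | h
    · exact h1 h
    · exact h2 h
  have hstep : ∀ s t, s ≤ t → ε ^ 2 * f s t ≤ f s (t + 1) := by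
    intro s t hst
    have hcard : (downE K t).card ≤ 2 := Finset.card_le_two
    have hε1 : ε ≤ 1 := (hp (0, 0, true)).1.trans (hp01 _).2
    calc ε ^ 2 * f s t ≤ ε ^ (downE K t).card * f s t :=
          mul_le_mul_of_nonneg_right (pow_le_pow_of_le_one hε.le hε1 hcard) measureReal_nonneg
      _ ≤ ε ^ (downE K t).card * P.real
            (setOn (downE K t) false ⁻¹' {ω | hit I K (Ico s (t + 1)) ω}ᶜ) := by
          gcongr
          refine measureReal_mono fun ω hω hω' => hω ?_
          refine hit_insert_setOn hK (hit_mono ?_ le_rfl hω')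
          intro x hx
          simp only [mem_Ico, mem_insert_iff] at hx ⊢
          omega
      _ ≤ _ := (hP.finite_energy_le hε.le hp false _
            (incFin_hit I K _).measurableSet.compl).trans (measureReal_mono inter_subset_left)
  obtain ⟨u, -, hu⟩ := H f hone hmul hstep (fun _ _ => measureReal_nonneg) _ _ (by omega) hM
  exact ⟨u, hu⟩

/-- The strip of heights between `0` and `K`. -/
def strip (K : ℤ) : Set (ℤ × ℤ) := {v | 0 ≤ ht v ∧ ht v ≤ K}

/-- The vertex of index `j` at height `K` is joined to row `0` within the strip. -/
def crosses (K : ℤ) (ω : Config SqE) (j : ℤ) : Prop :=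
  ∃ i : ℤ, conn ω (strip K) (j, K - j) (i, -i)

/-- Dual, primal and dual crossings of the strip, with tops in this order in `[x, x + W]`. -/
def alternates (K x W : ℤ) (ω : Config SqE) : Prop :=
  ∃ y z w, x ≤ y ∧ y < z ∧ z ≤ w ∧ w ≤ x + W ∧
    crosses K (dual ω) y ∧ crosses K ω z ∧ crosses K (dual ω) w

/-- The cluster in the strip of the vertex of index `x` at height `K` crosses, and has all its tops
in `[x, x + W]`. -/
def narrow (K W x : ℤ) (ω : Config SqE) : Prop :=
  crosses K ω x ∧ ∀ j, conn ω (strip K) (x, K - x) (j, K - j) → x ≤ j ∧ j ≤ x + W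

/-- As `narrow`, and the leftmost vertex of the cluster in row `0` has index `i`. -/
def narrowAt (K W i x : ℤ) (ω : Config SqE) : Prop :=
  narrow K W x ω ∧ conn ω (strip K) (x, K - x) (i, -i) ∧
    ∀ i' < i, ¬conn ω (strip K) (x, K - x) (i', -i')

/-- The origin is the leftmost vertex in row `0` of a cluster crossing the strip. -/
def leader (K : ℤ) (ω : Config SqE) : Prop :=
  (∃ j, conn ω (strip K) 0 (j, K - j)) ∧ ∀ i < 0, ¬conn ω (strip K) 0 (i, -i)

theorem measurable_conn (R : Set (ℤ × ℤ)) (u v : ℤ × ℤ) : Measurable fun ω => conn ω R u v :=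
  measurableSet_setOfPred.1 (incFin_conn R u v).measurableSet

theorem measurable_crosses (K j : ℤ) : Measurable fun ω => crosses K ω j :=
  Measurable.exists fun i => measurable_conn _ _ _

theorem measurable_narrow (K W x : ℤ) : Measurable fun ω => narrow K W x ω :=
  (measurable_crosses K x).and (Measurable.forall fun j =>
    (measurable_conn _ _ _).imp measurable_const)

theorem measurable_narrowAt (K W i x : ℤ) : Measurable fun ω => narrowAt K W i x ω :=
  (measurable_narrow K W x).and ((measurable_conn _ _ _).and (Measurable.forall fun i' =>
    Measurable.forall fun _ => (measurable_conn _ _ _).not))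

theorem measurable_leader (K : ℤ) : Measurable fun ω => leader K ω :=
  (Measurable.exists fun j => measurable_conn _ _ _).and (Measurable.forall fun i' =>
    Measurable.forall fun _ => (measurable_conn _ _ _).not)

theorem exists_narrow {K x W : ℤ} {ω : Config SqE} (h : alternates K x W ω) :
    ∃ x' ∈ Finset.Icc x (x + W), narrow K W x' ω := by
  obtain ⟨y, z, w, hxy, hyz, hzw, hwx, ⟨i, hy⟩, ⟨i', hz⟩, i'', hw⟩ := h
  have hsub : strip K ⊆ {v | ht v ≤ K} := fun v hv => hv.2
  have hbd : ∀ j, conn ω (strip K) (z, K - z) (j, K - j) → y < j ∧ j ≤ w := by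
    intro j hj
    have h1 := strip_separation (hy.mono_set hsub) (by simp [ht]) (by simp [ht]) hj
      (by simp [ht]) (by simp [ht])
    have h2 := strip_separation (hw.mono_set hsub) (by simp [ht]) (by simp [ht]) hj
      (by simp [ht]) (by simp [ht])
    simp only at h1 h2
    omega
  obtain ⟨x', hx', hmin⟩ := Int.exists_least_of_bdd
    (P := fun j => conn ω (strip K) (z, K - z) (j, K - j))
    ⟨y, fun j hj => (hbd j hj).1.le⟩ ⟨z, conn.refl _ _ _⟩
  have hb' := hbd x' hx'
  refine ⟨x', Finset.mem_Icc.2 (by omega), ⟨i', hx'.symm.trans hz⟩, fun j hj => ?_⟩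
  have := hmin j (hx'.trans hj)
  have := hbd j (hx'.trans hj)
  omega

theorem strip_shift (K s : ℤ) (u : ℤ × ℤ) : u ∈ strip K ↔ vshift s (-s) u ∈ strip K := by
  simp only [strip, ht, mem_ofPred_eq, vshift_apply]
  rw [show u.1 + s + (u.2 + -s) = u.1 + u.2 by ring]

theorem crosses_shift (K s j : ℤ) (ω : Config SqE) :
    crosses K (shift s (-s) ω) j ↔ crosses K ω (j + s) := by
  unfold crosses
  rw [← (Equiv.addRight s).exists_congr_right (q := fun i => conn ω (strip K) _ (i, -i))]
  refine exists_congr fun i => ?_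
  rw [conn_shift s (-s) ω (strip_shift K s)]
  simp only [vshift_apply, Equiv.coe_addRight]
  rw [show K - j + -s = K - (j + s) by ring, show -i + -s = -(i + s) by ring]

theorem narrow_shift (K W x s : ℤ) (ω : Config SqE) :
    narrow K W x (shift s (-s) ω) ↔ narrow K W (x + s) ω := by
  unfold narrow
  rw [crosses_shift, ← (Equiv.addRight s).forall_congr_right
    (q := fun j => conn ω (strip K) _ (j, K - j) → x + s ≤ j ∧ j ≤ x + s + W)]
  refine and_congr_right fun _ => forall_congr' fun j => ?_
  rw [conn_shift s (-s) ω (strip_shift K s)]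
  simp only [vshift_apply, Equiv.coe_addRight]
  rw [show K - j + -s = K - (j + s) by ring, show K - x + -s = K - (x + s) by ring]
  refine imp_congr_right fun _ => ?_
  omega

theorem narrowAt_shift (K W i x s : ℤ) (ω : Config SqE) :
    narrowAt K W i x (shift s (-s) ω) ↔ narrowAt K W (i + s) (x + s) ω := by
  unfold narrowAt
  rw [narrow_shift, ← (Equiv.addRight s).forall_congr_right
    (q := fun j => j < i + s → ¬conn ω (strip K) _ (j, -j))]
  simp only [conn_shift s (-s) ω (strip_shift K s), vshift_apply, Equiv.coe_addRight,
    add_lt_add_iff_right]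
  rw [show K - x + -s = K - (x + s) by ring, show -i + -s = -(i + s) by ring]
  refine and_congr_right fun _ => and_congr_right fun _ => forall_congr' fun j => ?_
  rw [show -j + -s = -(j + s) by ring]

theorem conn.lt_of_blocked {ω : Config SqE} {K : ℕ} {a : ℤ}
    (ha : ∀ e ∈ colE K a, ω e = false) {v u : ℤ × ℤ} (h : conn ω (strip K) v u) (hv : a < v.1) :
    a < u.1 := by
  induction h with
  | refl => exact hv
  | @tail x y hx hxy ih =>
    obtain ⟨⟨⟨c, d, t⟩, he, h⟩, h1, h2⟩ := hxy
    cases t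
    · rcases h with ⟨rfl, rfl⟩ | ⟨rfl, rfl⟩ <;> simpa [src, tgt] using ih
    · rcases h with ⟨rfl, rfl⟩ | ⟨rfl, rfl⟩
      · simp [src, tgt] at ih ⊢
        omega
      · have hne : c ≠ a := by
          rintro rfl
          rw [ha] at he
          · simp at he
          · simp only [colE, Finset.mem_image, Finset.mem_Icc]
            simp only [strip, ht, src, mem_ofPred_eq] at h2
            exact ⟨c + d, by omega, by ring_nf⟩
        simp [src, tgt] at ih ⊢
        omega

theorem narrow.exists_narrowAt {ω : Config SqE} (hω : Blocked ω) {K : ℕ} {W : ℤ}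
    (h : narrow K W 0 ω) : ∃ i, narrowAt K W i 0 ω := by
  obtain ⟨i₀, hi₀⟩ := h.1
  obtain ⟨-, n, hn⟩ := hω K 1
  obtain ⟨i, hi, hmin⟩ := Int.exists_least_of_bdd
    (P := fun i => conn ω (strip K) (0, K - 0) (i, -i))
    ⟨-1 - n, fun i hi => le_of_lt (hi.lt_of_blocked (K := K) (by simpa using hn)
      (show -1 - (n : ℤ) < 0 by omega))⟩ ⟨i₀, hi₀⟩
  exact ⟨i, h, hi, fun i' hi' hc => by have := hmin i' hc; omega⟩

theorem leader_antitone {K : ℤ} (hK : 0 ≤ K) {ω : Config SqE} (h : leader (K + 1) ω) :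
    leader K ω := by
  obtain ⟨⟨j, hj⟩, h2⟩ := h
  refine ⟨?_, fun i hi hc => h2 i hi (hc.mono_set (R' := strip (K + 1))
    fun v hv => ⟨hv.1, by have := hv.2; omega⟩)⟩
  obtain ⟨w, hw, hwK⟩ := hj.exists_first_passage (K := K) (by simpa [ht] using hK) (by simp [ht])
  refine ⟨w.1, ?_⟩
  rw [show ((w.1, K - w.1) : ℤ × ℤ) = w by ext <;> simp [ht] at hwK ⊢; omega]
  exact hw.mono_set (R' := strip K) fun v hv => ⟨hv.1.1, hv.2⟩

theorem narrowAt.leader {K W x : ℤ} {ω : Config SqE} (h : narrowAt K W 0 x ω) : leader K ω :=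
  ⟨⟨x, by simpa using! h.2.1.symm⟩, fun i hi hc => h.2.2 i hi (h.2.1.trans (by simpa using! hc))⟩

/-- The edges leading upwards from the vertices with index in `[x, x + W]` at height `K`. -/
noncomputable def upE (K W x : ℤ) : Finset SqE :=
  (Finset.Icc x (x + W) ×ˢ Finset.univ).image fun p : ℤ × Bool => (p.1, K - p.1, p.2)

theorem card_upE_le (K x : ℤ) (W : ℕ) : (upE K W x).card ≤ 2 * (W + 1) := by
  refine Finset.card_image_le.trans (le_of_eq ?_)
  simp only [Finset.card_product, Int.card_Icc, Finset.card_univ, Fintype.card_bool]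
  omega

theorem mem_upE {K W x j : ℤ} (h1 : x ≤ j) (h2 : j ≤ x + W) (b : Bool) :
    ((j, K - j, b) : SqE) ∈ upE K W x := by
  simp only [upE, Finset.mem_image, Finset.mem_product, Finset.mem_Icc]
  exact ⟨(j, b), ⟨⟨h1, h2⟩, Finset.mem_univ _⟩, rfl⟩

theorem narrowAt.not_leader {K W x : ℤ} {ω : Config SqE} (h : narrowAt K W 0 x ω)
    (hc : ∀ e ∈ upE K W x, ω e = false) : ¬Perc.leader (K + 1) ω := by
  have h0 : conn ω (strip K) (x, K - x) 0 := by simpa using! h.2.1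
  have h0K : (0 : ℤ × ℤ) ∈ strip K := by
    have : (x, K - x) = (0 : ℤ × ℤ) ∨ ∃ v, zadj ω v 0 ∧ v ∈ strip K ∧ (0 : ℤ × ℤ) ∈ strip K := by
      rcases Relation.ReflTransGen.cases_tail h0 with h | ⟨v, -, hv⟩
      · exact Or.inl h.symm
      · exact Or.inr ⟨v, hv⟩
    rcases this with h | ⟨_, _, _, h⟩
    · simp [Prod.ext_iff] at h
      simp [strip, ht]
      omega
    · exact h
  have key : ∀ u, conn ω (strip (K + 1)) 0 u → conn ω (strip K) 0 u := by
    intro u hu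
    induction hu with
    | refl => exact conn.refl _ _ _
    | @tail v w hv hvw ih =>
      have hvK : v ∈ strip K := ih.mem_of_mem h0K
      by_cases hwK : ht w ≤ K
      · exact ih.trans (conn.single hvw.1 hvK ⟨hvw.2.2.1, hwK⟩)
      · exfalso
        obtain ⟨e, he, hvwe⟩ := hvw.1
        have hv2 := hvK.2
        have hve : src e = v ∧ ht v = K := by
          obtain ⟨a, b, t⟩ := e
          rcases hvwe with ⟨rfl, rfl⟩ | ⟨rfl, rfl⟩ <;> cases t <;>
            simp [src, tgt, ht] at hv2 hwK ⊢ <;> omega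
        have hv3 : v = (v.1, K - v.1) := by
          ext
          · rfl
          · have := hve.2
            simp only [ht] at this ⊢
            omega
        have := h.1.2 v.1 (h0.trans (by rw [← hv3]; exact ih))
        rw [hc] at he
        · simp at he
        · have hm := mem_upE (K := K) this.1 this.2 e.2.2
          convert hm using 1
          rw [Prod.ext_iff, Prod.ext_iff]
          have h3 := hve.1
          rw [hv3] at h3
          simp only [src, Prod.mk.injEq] at h3
          exact ⟨h3.1, h3.2, rfl⟩
  rintro ⟨⟨j, hj⟩, -⟩
  have := ((key _ hj).mem_of_mem h0K).2
  simp [ht] at this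

theorem conn_congr {ω ω' : Config SqE} {R : Set (ℤ × ℤ)}
    (h : ∀ e, src e ∈ R → tgt e ∈ R → ω e = ω' e) (u v : ℤ × ℤ) : conn ω R u v ↔ conn ω' R u v := by
  have : ∀ x y, (zadj ω x y ∧ x ∈ R ∧ y ∈ R) ↔ (zadj ω' x y ∧ x ∈ R ∧ y ∈ R) := by
    intro x y
    refine and_congr_left fun ⟨hx, hy⟩ => exists_congr fun e => and_congr_left ?_
    rintro (⟨h1, h2⟩ | ⟨h1, h2⟩) <;> rw [h e (by simpa [h1] using! by assumption)
      (by simpa [h2] using! by assumption)]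
  unfold conn
  simp only [this]

theorem narrowAt_setOn {K W i x : ℤ} {b : Bool} {ω : Config SqE} :
    narrowAt K W i x (setOn (upE K W x) b ω) ↔ narrowAt K W i x ω := by
  have : ∀ u v, conn (setOn (upE K W x) b ω) (strip K) u v ↔ conn ω (strip K) u v := by
    refine conn_congr fun e h1 h2 => ?_
    simp only [setOn]
    rw [if_neg]
    intro he
    obtain ⟨⟨j, t⟩, -, rfl⟩ := Finset.mem_image.1 he
    have := h2.2
    cases t <;> simp [tgt, ht] at this <;> omega
  simp only [narrowAt, narrow, crosses, this]

theorem narrowAt.eq {K W i x x' : ℤ} {ω : Config SqE} (h : narrowAt K W i x ω)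
    (h' : narrowAt K W i x' ω) : x = x' := by
  have := h.2.1.trans h'.2.1.symm
  exact le_antisymm (h.1.2 _ this).1 (h'.1.2 _ this.symm).1

section
variable {q q' : ℤ → ℝ} {P : Measure (Config SqE)}

theorem measure_narrowAt (hP : IsBernoulliProduct (rsqHI q q') P) (K W i : ℤ) :
    P {ω | narrowAt K W i 0 ω} = P {ω | narrowAt K W 0 (-i) ω} := by
  rw [← (measurePreserving_shift hP (-i)).measure_preimage
    (measurableSet_setOfPred.2 (measurable_narrowAt K W i 0)).nullMeasurableSet]
  congr 1
  ext ω
  simp only [mem_preimage, mem_ofPred_eq, narrowAt_shift]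
  simp

theorem measure_narrow_le (hP : IsBernoulliProduct (rsqHI q q') P) {ε : ℝ} (hε : 0 < ε)
    (hp : ∀ e, rsqHI q q' e ∈ Icc ε (1 - ε)) (K : ℕ) (W x : ℤ) :
    P {ω | narrow K W x ω} ≤ ∑' y, P {ω | narrowAt K W 0 y ω} := by
  have h1 : P {ω | narrow K W x ω} = P {ω | narrow K W 0 ω} := by
    rw [← (measurePreserving_shift hP x).measure_preimage
      (measurableSet_setOfPred.2 (measurable_narrow K W 0)).nullMeasurableSet]
    congr 1
    ext ω
    simp only [mem_preimage, mem_ofPred_eq, narrow_shift]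
    simp
  calc P {ω | narrow K W x ω} = P {ω | narrow K W 0 ω} := h1
    _ ≤ P (⋃ i : ℤ, {ω | narrowAt K W i 0 ω}) := by
      refine measure_mono_ae ?_
      filter_upwards [ae_blocked hP hε hp] with ω hω h
      obtain ⟨i, hi⟩ := narrow.exists_narrowAt hω h
      exact mem_iUnion.2 ⟨i, hi⟩
    _ ≤ ∑' i : ℤ, P {ω | narrowAt K W i 0 ω} := measure_iUnion_le _
    _ = ∑' i : ℤ, P {ω | narrowAt K W 0 (-i) ω} := by simp only [measure_narrowAt hP]
    _ = _ := (Equiv.neg ℤ).tsum_eq fun y => P {ω | narrowAt K W 0 y ω}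

theorem narrow_le_leader_sub (hP : IsBernoulliProduct (rsqHI q q') P) {ε : ℝ} (hε : 0 < ε)
    (hp : ∀ e, rsqHI q q' e ∈ Icc ε (1 - ε)) (K W : ℕ) (x : ℤ) :
    ε ^ (2 * (W + 1)) * P.real {ω | narrow K W x ω} ≤
      P.real {ω | leader K ω} - P.real {ω | leader ((K + 1 : ℕ) : ℤ) ω} := by
  have := hP.1
  have hε1 : ε ≤ 1 := by
    have := hp (0, 0, true)
    linarith [this.1, this.2]
  set B : ℤ → Set (Config SqE) :=
    fun y => {ω | narrowAt K W 0 y ω} ∩ {ω | ∀ e ∈ upE K W y, ω e = false} with hB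
  have hBm : ∀ y, MeasurableSet (B y) := fun y =>
    (measurableSet_setOfPred.2 (measurable_narrowAt _ _ _ _)).inter
      (measurableSet_cyl (upE K W y) fun _ => false)
  have hBd : Pairwise fun y z => Disjoint (B y) (B z) := by
    intro y z hyz
    rw [Set.disjoint_left]
    intro ω h1 h2
    exact hyz (narrowAt.eq h1.1 h2.1)
  have h1 : ∀ y, ENNReal.ofReal (ε ^ (2 * (W + 1))) * P {ω | narrowAt K W 0 y ω} ≤ P (B y) := by
    intro y
    have := hP.finite_energy_le hε.le hp false (upE K W y)
      (measurableSet_setOfPred.2 (measurable_narrowAt K W 0 y))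
    have h2 : setOn (upE K W y) false ⁻¹' {ω | narrowAt K W 0 y ω} = {ω | narrowAt K W 0 y ω} := by
      ext ω
      exact narrowAt_setOn
    rw [h2] at this
    have h3 : ε ^ (2 * (W + 1)) * P.real {ω | narrowAt K W 0 y ω} ≤ P.real (B y) :=
      (mul_le_mul_of_nonneg_right (pow_le_pow_of_le_one hε.le hε1 (card_upE_le K y W))
        measureReal_nonneg).trans this
    rw [← ofReal_measureReal (μ := P) (s := B y), ← ofReal_measureReal (μ := P),
      ← ENNReal.ofReal_mul (by positivity)]
    exact ENNReal.ofReal_le_ofReal h3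
  have h2 : ENNReal.ofReal (ε ^ (2 * (W + 1))) * P {ω | narrow K W x ω} ≤
      P ({ω | leader K ω} \ {ω | leader ((K + 1 : ℕ) : ℤ) ω}) := by
    calc _ ≤ ENNReal.ofReal (ε ^ (2 * (W + 1))) * ∑' y, P {ω | narrowAt K W 0 y ω} := by
          gcongr
          exact measure_narrow_le hP hε hp K W x
      _ = ∑' y, ENNReal.ofReal (ε ^ (2 * (W + 1))) * P {ω | narrowAt K W 0 y ω} :=
          ENNReal.tsum_mul_left.symm
      _ ≤ ∑' y, P (B y) := ENNReal.tsum_le_tsum h1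
      _ = P (⋃ y, B y) := (measure_iUnion hBd hBm).symm
      _ ≤ _ := by
        refine measure_mono (iUnion_subset fun y ω hω => ⟨hω.1.leader, ?_⟩)
        have := hω.1.not_leader hω.2
        simpa using this
  have hmeas := fun K : ℤ => measurableSet_setOfPred.2 (measurable_leader K)
  have hsub : {ω | leader ((K + 1 : ℕ) : ℤ) ω} ⊆ {ω | leader K ω} :=
    fun ω hω => leader_antitone (Int.natCast_nonneg K) (by simpa using! hω)
  rw [← measureReal_sdiff hsub (hmeas _)]
  have h4 := ENNReal.toReal_mono (measure_ne_top _ _) h2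
  rwa [ENNReal.toReal_mul, ENNReal.toReal_ofReal (by positivity)] at h4

/-- Alternating crossings of a tall strip within a bounded window are unlikely. -/
theorem exists_height (hP : IsBernoulliProduct (rsqHI q q') P) {ε : ℝ} (hε : 0 < ε)
    (hp : ∀ e, rsqHI q q' e ∈ Icc ε (1 - ε)) (W : ℕ) :
    ∃ K₀ : ℕ, ∀ K : ℕ, K₀ ≤ K → ∀ x : ℤ, P.real {ω | alternates K x W ω} < 1 / 2 := by
  have := hP.1
  set m : ℕ → ℝ := fun K => P.real {ω | leader K ω} with hm
  have hanti : Antitone m := antitone_nat_of_succ_le fun K =>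
    measureReal_mono (fun ω hω => leader_antitone (Int.natCast_nonneg K) (by simpa using hω))
  have hlim := tendsto_atTop_ciInf hanti ⟨0, by rintro _ ⟨K, rfl⟩; exact measureReal_nonneg⟩
  have hlim' := hlim.sub (hlim.comp (Filter.tendsto_add_atTop_nat 1))
  rw [sub_self] at hlim'
  have hc : 0 < ε ^ (2 * (W + 1)) / (4 * (W + 1)) := by positivity
  obtain ⟨K₀, hK₀⟩ := Filter.eventually_atTop.1 (hlim'.eventually_lt_const hc)
  refine ⟨K₀, fun K hK x => ?_⟩
  have hn : ∀ y, P.real {ω | narrow K W y ω} ≤ 1 / (4 * (W + 1)) := by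
    intro y
    have h1 := narrow_le_leader_sub hP hε hp K W y
    have h2 : m K - m (K + 1) < _ := hK₀ K hK
    have h3 : ε ^ (2 * (W + 1)) * P.real {ω | narrow K W y ω} ≤
        ε ^ (2 * (W + 1)) * (1 / (4 * (W + 1))) := by
      rw [mul_one_div]
      exact h1.trans h2.le
    exact le_of_mul_le_mul_left h3 (by positivity)
  calc P.real {ω | alternates K x W ω}
      ≤ P.real (⋃ y ∈ Finset.Icc x (x + W), {ω | narrow K W y ω}) := by
        refine measureReal_mono (fun ω hω => ?_) (measure_ne_top _ _)
        obtain ⟨y, hy, h⟩ := exists_narrow hω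
        exact mem_biUnion (s := (Finset.Icc x (x + W) : Set ℤ)) hy h
    _ ≤ ∑ y ∈ Finset.Icc x (x + W), P.real {ω | narrow K W y ω} :=
        measureReal_biUnion_finset_le _ _
    _ ≤ ∑ y ∈ Finset.Icc x (x + W), (1 : ℝ) / (4 * (W + 1)) :=
        Finset.sum_le_sum fun y _ => hn y
    _ = 1 / 4 := by
        have : ((x + (W : ℤ) + 1 - x).toNat : ℝ) = W + 1 := by
          rw [show x + (W : ℤ) + 1 - x = ((W + 1 : ℕ) : ℤ) by push_cast; ring, Int.toNat_natCast]
          push_cast; ring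
        rw [Finset.sum_const, Int.card_Icc, nsmul_eq_mul, this]
        field_simp
    _ < 1 / 2 := by norm_num

end

theorem conn.exists_last_exit {ω : Config SqE} {K : ℤ} {v u : ℤ × ℤ} (hv : ht v = 0)
    (hu : 0 ≤ ht u) (h : conn ω (below K) v u) (hK : 0 ≤ K) :
    ∃ i : ℤ, conn ω (strip K) u (i, -i) := by
  have huK : u ∈ below K := h.mem_of_mem (by simp only [below, mem_ofPred_eq]; omega)
  have key : ∀ y, conn ω (below K) y u →
      conn ω (strip K) y u ∨ ∃ i : ℤ, conn ω (strip K) u (i, -i) := by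
    intro y hy
    induction hy using Relation.ReflTransGen.head_induction_on with
    | refl => exact .inl (conn.refl _ _ _)
    | @head y z hyz _ ih =>
      rcases ih with ih | ih
      · by_cases hz : z ∈ strip K
        · by_cases hy : y ∈ strip K
          · exact .inl ((conn.single hyz.1 hy hz).trans ih)
          · refine .inr ⟨z.1, ?_⟩
            have hz0 : ht z = 0 := by
              have h1 : ht y < 0 := by
                by_contra hc
                exact hy ⟨not_lt.1 hc, hyz.2.1⟩
              have h2 := hz.1
              obtain ⟨⟨a, b, c⟩, -, he⟩ := hyz.1
              cases c <;> rcases he with ⟨rfl, rfl⟩ | ⟨rfl, rfl⟩ <;>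
                simp [src, tgt, ht] at h1 h2 ⊢ <;> omega
            have : z = (z.1, -z.1) := by
              ext
              · rfl
              · simp only [ht] at hz0 ⊢
                omega
            rw [← this]
            exact ih.symm
        · have : u = z := by
            by_contra hne
            exact hz (ih.symm.mem_of_mem ⟨hu, huK⟩)
          subst this
          exact absurd ⟨hu, huK⟩ hz
      · exact .inr ih
  rcases key v h with h | h
  · refine ⟨v.1, ?_⟩
    have : v = (v.1, -v.1) := by
      ext
      · rfl
      · simp only [ht] at hv ⊢
        omega
    rw [← this]
    exact h.symm
  · exact h

theorem hit.crosses {I S : Set ℤ} {K : ℤ} (hK : 0 ≤ K) {ω : Config SqE} (h : hit I K S ω) :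
    ∃ j ∈ S, crosses K ω j := by
  obtain ⟨a, -, j, hj, h⟩ := h
  exact ⟨j, hj, h.exists_last_exit (by simp [ht]) (by simp [ht, hK]) hK⟩

/-- The edges rising from the vertices of row `0` with indices in `[s, s + m]`. -/
noncomputable def segE (s m : ℤ) : Finset SqE :=
  (Finset.Icc s (s + m) ×ˢ Finset.univ).image fun p : ℤ × Bool => (p.1, -p.1, p.2)

theorem card_segE_le (s : ℤ) (m : ℕ) : (segE s m).card ≤ 2 * (m + 1) := by
  refine Finset.card_image_le.trans ?_
  rw [Finset.card_product, Int.card_Icc, Finset.card_univ, Fintype.card_bool]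
  omega

theorem mem_segE {s m i : ℤ} (h : i ∈ Icc s (s + m)) (b : Bool) : ((i, -i, b) : SqE) ∈ segE s m :=
  Finset.mem_image.2 ⟨(i, b), by simpa using h, rfl⟩

/-- The part of `below K` avoiding the vertices of row `0` with indices in `[s, s + m]`. -/
def off (K s m : ℤ) : Set (ℤ × ℤ) := {v | ht v ≤ K ∧ ∀ i ∈ Icc s (s + m), v ≠ (i, -i)}

theorem segE_open_step {ω : Config SqE} {s m K : ℤ} (hK : 1 ≤ K)
    (hω : ∀ e ∈ segE s m, ω e = true) {s' : ℤ} (hd : Disjoint (Icc s (s + m)) (Icc s' (s' + m)))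
    {i : ℤ} (hi : i ∈ Icc s (s + m)) (hi' : i + 1 ∈ Icc s (s + m)) :
    conn ω (off K s' m) (i, -i) (i + 1, -(i + 1)) := by
  have h1 : ∀ j ∈ Icc s (s + m), (j, -j) ∈ off K s' m := fun j hj =>
    ⟨by simp [ht]; omega, fun k hk h => Set.disjoint_left.1 hd hj (by simp at h; simpa [h] using hk)⟩
  have h2 : (i + 1, -i) ∈ off K s' m :=
    ⟨by simp [ht]; omega, fun k hk h => by simp at h; omega⟩
  refine (conn.single ⟨(i, -i, true), hω _ (mem_segE hi _), .inl ⟨rfl, rfl⟩⟩ (h1 _ hi) h2).trans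
    (conn.single ⟨(i + 1, -(i + 1), false), hω _ (mem_segE hi' _), .inr ⟨rfl, ?_⟩⟩ h2 (h1 _ hi'))
  simp [tgt]

theorem segE_closed_step {ω : Config SqE} {s m K : ℤ} (hK : 1 ≤ K)
    (hω : ∀ e ∈ segE s m, ω e = false) {i : ℤ} (hi' : i + 1 ∈ Icc s (s + m)) :
    conn (dual ω) (below K) (i, -i) (i + 1, -(i + 1)) := by
  have h1 : ∀ j, (j, -j) ∈ below K := fun j => by simp [below, ht]; omega
  have h2 : (i + 1, -i) ∈ below K := by simp [below, ht]; omega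
  refine (conn.single ⟨(i, -i, true), ?_, .inl ⟨rfl, rfl⟩⟩ (h1 _) h2).trans
    (conn.single ⟨(i + 1, -(i + 1), false), ?_, .inr ⟨rfl, ?_⟩⟩ h2 (h1 _))
  · have := hω _ (mem_segE hi' false)
    simp only [dual, dualE]
    simpa [sub_eq_add_neg, add_comm] using this
  · have := hω _ (mem_segE hi' true)
    simp only [dual, dualE]
    simpa [sub_eq_add_neg, add_comm] using this
  · simp [tgt]

theorem conn_of_step {ω : Config SqE} {R : Set (ℤ × ℤ)} {s t : ℤ}
    (h : ∀ i, s ≤ i → i + 1 ≤ t → conn ω R (i, -i) (i + 1, -(i + 1))) {i j : ℤ}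
    (hi : i ∈ Icc s t) (hj : j ∈ Icc s t) : conn ω R (i, -i) (j, -j) := by
  have key : ∀ j, s ≤ j → j ≤ t → conn ω R (s, -s) (j, -j) := by
    intro j hj
    induction j, hj using Int.leInduction with
    | base => exact fun _ => conn.refl _ _ _
    | succ j hj ih => exact fun h' => (ih (by omega)).trans (h j hj h')
  exact (key i hi.1 hi.2).symm.trans (key j hj.1 hj.2)

theorem not_conn_off {ω : Config SqE} {K s m : ℤ} (hK : 1 ≤ K) {S S' : Set ℤ} {x y : ℤ}
    (hd : hit (Icc s (s + m)) K S (dual (setOn (segE s m) false ω)))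
    (hd' : hit (Icc s (s + m)) K S' (dual (setOn (segE s m) false ω)))
    (h1 : ∀ d ∈ S, x ≤ d) (h2 : ∀ d ∈ S, d < y) (h3 : ∀ d ∈ S', y ≤ d) :
    ¬conn ω (off K s m) (x, K - x) (y, K - y) := by
  intro h
  obtain ⟨i, hi, d, hd, hid⟩ := hd
  obtain ⟨i', hi', d', hd', hid'⟩ := hd'
  have hc : conn (dual (setOn (segE s m) false ω)) (below K) (i, -i) (i', -i') :=
    conn_of_step (s := s) (t := s + m) (fun k h1 h2 => segE_closed_step hK
      (fun e he => by simp [setOn, he]) ⟨by omega, h2⟩) hi hi'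
  have hp : conn (setOn (segE s m) false ω) (off K s m) (x, K - x) (y, K - y) := by
    refine (conn_congr (fun e he _ => ?_) _ _).1 h
    simp only [setOn]
    rw [if_neg]
    intro hmem
    obtain ⟨⟨k, b⟩, hk, rfl⟩ := Finset.mem_image.1 hmem
    exact he.2 k (by simpa using hk) rfl
  exact not_interlace_left ((hid.symm.trans hc).trans hid') (by simp [ht]) (by simp [ht])
    (hp.mono_set fun v hv => hv.1) (by simp [ht]) (by simp [ht]) (h1 d hd) (h2 d hd) (h3 d' hd')

theorem exists_first_hit {ω : Config SqE} {K s s' m : ℤ}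
    (hd : Disjoint (Icc s (s + m)) (Icc s' (s' + m))) {u : ℤ × ℤ} (hu : 0 < ht u) {a : ℤ}
    (ha : a ∈ Icc s (s + m)) (h : conn ω (below K) (a, -a) u) :
    (∃ j ∈ Icc s (s + m), conn ω (off K s' m) (j, -j) u) ∨
      ∃ j ∈ Icc s' (s' + m), conn ω (off K s m) (j, -j) u := by
  rcases h.cases_head with h0 | ⟨w, hw, -⟩
  · rw [← h0] at hu
    simp [ht] at hu
  have huK : u ∈ below K := h.mem_of_mem hw.2.1
  have huo : u ∈ off K s m ∩ off K s' m :=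
    ⟨⟨huK, fun i _ h => by simp [h, ht] at hu⟩, ⟨huK, fun i _ h => by simp [h, ht] at hu⟩⟩
  have key : ∀ y, conn ω (below K) y u → conn ω (off K s m ∩ off K s' m) y u ∨
      (∃ j ∈ Icc s (s + m), conn ω (off K s' m) (j, -j) u) ∨
        ∃ j ∈ Icc s' (s' + m), conn ω (off K s m) (j, -j) u := by
    intro y hy
    induction hy using Relation.ReflTransGen.head_induction_on with
    | refl => exact .inl (conn.refl _ _ _)
    | @head y z hyz _ ih =>
      rcases ih with ih | ih
      · have hz := ih.symm.mem_of_mem huo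
        by_cases hy : ∃ j ∈ Icc s (s + m), y = (j, -j)
        · obtain ⟨j, hj, rfl⟩ := hy
          refine .inr (.inl ⟨j, hj, (conn.single (R := off K s' m) hyz.1 ⟨hyz.2.1, fun i hi h => ?_⟩ hz.2).trans
            (ih.mono_set inter_subset_right)⟩)
          exact Set.disjoint_left.1 hd hj (by simp at h; simpa [h] using hi)
        · by_cases hy' : ∃ j ∈ Icc s' (s' + m), y = (j, -j)
          · obtain ⟨j, hj, rfl⟩ := hy'
            refine .inr (.inr ⟨j, hj, (conn.single (R := off K s m) hyz.1 ⟨hyz.2.1, fun i hi h => ?_⟩ hz.1).trans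
              (ih.mono_set inter_subset_left)⟩)
            exact Set.disjoint_left.1 hd (by simp at h; simpa [h] using hi) hj
          · push Not at hy hy'
            exact .inl ((conn.single (R := off K s m ∩ off K s' m) hyz.1 ⟨⟨hyz.2.1, hy⟩, hyz.2.1, hy'⟩ hz).trans ih)
      · exact .inr ih
  rcases key _ h with h | h
  · exact absurd rfl ((h.symm.mem_of_mem huo).1.2 a ha)
  · exact h

/-- From the segment `[s, s + m]` of row `0`, the tops in `A 0, A 8, A 16` are reached by open paths
and the tops in `A 4, A 12, A 20` by dual paths. -/
def good (K s m : ℤ) (A : ℕ → Set ℤ) (ω ω' : Config SqE) : Prop :=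
  (hit (Icc s (s + m)) K (A 0) ω ∧ hit (Icc s (s + m)) K (A 8) ω ∧
    hit (Icc s (s + m)) K (A 16) ω) ∧
  hit (Icc s (s + m)) K (A 4) ω' ∧ hit (Icc s (s + m)) K (A 12) ω' ∧
    hit (Icc s (s + m)) K (A 20) ω'

theorem good.mono {K s m : ℤ} {A : ℕ → Set ℤ} {ω₁ ω₂ ω₁' ω₂' : Config SqE}
    (h : good K s m A ω₁ ω₁') (h1 : ω₁ ≤ ω₂) (h2 : ω₁' ≤ ω₂') : good K s m A ω₂ ω₂' :=
  ⟨⟨hit_mono subset_rfl h1 h.1.1, hit_mono subset_rfl h1 h.1.2.1, hit_mono subset_rfl h1 h.1.2.2⟩,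
    hit_mono subset_rfl h2 h.2.1, hit_mono subset_rfl h2 h.2.2.1, hit_mono subset_rfl h2 h.2.2.2⟩

theorem not_conn_of_good {ω : Config SqE} {K s m : ℤ} (hK : 1 ≤ K) {A : ℕ → Set ℤ}
    (hA : ∀ i j, i + 4 ≤ j → j ≤ 20 → ∀ x ∈ A i, ∀ y ∈ A j, x < y)
    (h : good K s m A ω (dual (setOn (segE s m) false ω))) {x y z : ℤ}
    (hx : x ∈ A 0) (hy : y ∈ A 8) (hz : z ∈ A 16) :
    ¬conn ω (off K s m) (x, K - x) (y, K - y) ∧ ¬conn ω (off K s m) (y, K - y) (z, K - z) ∧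
      ¬conn ω (off K s m) (x, K - x) (z, K - z) := by
  obtain ⟨-, h4, h12, h20⟩ := h
  refine ⟨not_conn_off hK h4 h12 (fun d hd => ?_) (fun d hd => ?_) (fun d hd => ?_),
    not_conn_off hK h12 h20 (fun d hd => ?_) (fun d hd => ?_) (fun d hd => ?_),
    not_conn_off hK h4 h20 (fun d hd => ?_) (fun d hd => ?_) (fun d hd => ?_)⟩
  · exact (hA 0 4 (by omega) (by omega) _ hx _ hd).le
  · exact hA 4 8 (by omega) (by omega) _ hd _ hy
  · exact (hA 8 12 (by omega) (by omega) _ hy _ hd).le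
  · exact (hA 8 12 (by omega) (by omega) _ hy _ hd).le
  · exact hA 12 16 (by omega) (by omega) _ hd _ hz
  · exact (hA 16 20 (by omega) (by omega) _ hz _ hd).le
  · exact (hA 0 4 (by omega) (by omega) _ hx _ hd).le
  · exact hA 4 16 (by omega) (by omega) _ hd _ hz
  · exact (hA 16 20 (by omega) (by omega) _ hz _ hd).le

/-- Two disjoint segments cannot both be good, with all their upward edges open. -/
theorem not_two_good {ω : Config SqE} {K s s' m : ℤ} (hK : 1 ≤ K) {A : ℕ → Set ℤ}
    (hA : ∀ i j, i + 4 ≤ j → j ≤ 20 → ∀ x ∈ A i, ∀ y ∈ A j, x < y)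
    (hd : Disjoint (Icc s (s + m)) (Icc s' (s' + m)))
    (h : good K s m A ω (dual (setOn (segE s m) false ω)))
    (h' : good K s' m A ω (dual (setOn (segE s' m) false ω)))
    (hs : ∀ e ∈ segE s m, ω e = true) (hs' : ∀ e ∈ segE s' m, ω e = true) : False := by
  obtain ⟨a, ha, x, hx, hax⟩ := h.1.1
  obtain ⟨b, hb, y, hy, hby⟩ := h.1.2.1
  obtain ⟨c, hc, z, hz, hcz⟩ := h.1.2.2
  have n1 := not_conn_of_good hK hA h hx hy hz
  have n2 := not_conn_of_good hK hA h' hx hy hz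
  have g1 : ∀ u v, (∃ j ∈ Icc s (s + m), conn ω (off K s' m) (j, -j) u) →
      (∃ j ∈ Icc s (s + m), conn ω (off K s' m) (j, -j) v) → conn ω (off K s' m) u v := by
    rintro u v ⟨i, hi, hu⟩ ⟨j, hj, hv⟩
    exact (hu.symm.trans (conn_of_step (s := s) (t := s + m) (fun k h1 h2 =>
      segE_open_step hK hs hd ⟨h1, by omega⟩ ⟨by omega, h2⟩) hi hj)).trans hv
  have g2 : ∀ u v, (∃ j ∈ Icc s' (s' + m), conn ω (off K s m) (j, -j) u) →
      (∃ j ∈ Icc s' (s' + m), conn ω (off K s m) (j, -j) v) → conn ω (off K s m) u v := by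
    rintro u v ⟨i, hi, hu⟩ ⟨j, hj, hv⟩
    exact (hu.symm.trans (conn_of_step (s := s') (t := s' + m) (fun k h1 h2 =>
      segE_open_step hK hs' hd.symm ⟨h1, by omega⟩ ⟨by omega, h2⟩) hi hj)).trans hv
  have t1 := exists_first_hit hd (by simp [ht]; omega) ha hax
  have t2 := exists_first_hit hd (by simp [ht]; omega) hb hby
  have t3 := exists_first_hit hd (by simp [ht]; omega) hc hcz
  rcases t1 with t1 | t1 <;> rcases t2 with t2 | t2 <;> rcases t3 with t3 | t3
  · exact n2.1 (g1 _ _ t1 t2)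
  · exact n2.1 (g1 _ _ t1 t2)
  · exact n2.2.2 (g1 _ _ t1 t3)
  · exact n1.2.1 (g2 _ _ t2 t3)
  · exact n2.2.1 (g1 _ _ t2 t3)
  · exact n1.2.2 (g2 _ _ t1 t3)
  · exact n1.1 (g2 _ _ t1 t2)
  · exact n1.1 (g2 _ _ t1 t2)

theorem hit_shift (K m s : ℤ) (S : Set ℤ) (ω : Config SqE) (h : hit (Icc 0 m) K S (shift s (-s) ω)) :
    hit (Icc s (s + m)) K ((· + s) '' S) ω := by
  obtain ⟨a, ha, j, hj, h⟩ := h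
  refine ⟨a + s, ⟨by linarith [ha.1], by linarith [ha.2]⟩, j + s, ⟨j, hj, rfl⟩, ?_⟩
  rw [conn_shift s (-s) ω (R := below K) (R' := below K) (fun u => by
    simp [below, ht, show u.1 + s + (u.2 + -s) = u.1 + u.2 by ring])] at h
  convert h using 2 <;> simp <;> ring

section

theorem le_real_inter {α : Type*} [MeasurableSpace α] {P : Measure α} [IsProbabilityMeasure P]
    {A B : Set α} (hB : MeasurableSet B) {a b : ℝ} (h : 1 - a ≤ P.real A) (h' : 1 - b ≤ P.real B) :
    1 - (a + b) ≤ P.real (A ∩ B) := by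
  have h1 := measureReal_inter_add_sdiff (μ := P) (s := A) hB
  have h2 := measureReal_mono (μ := P) (s₁ := A \ B) (s₂ := Bᶜ) fun x hx => hx.2
  rw [probReal_compl_eq_one_sub hB] at h2
  linarith

variable {q : ℤ → ℝ} {P : Measure (Config SqE)}

theorem measurePreserving_dual (hP : IsBernoulliProduct (rsqHI q fun n => 1 - q n) P) :
    MeasurePreserving dual P P := by
  refine ⟨measurable_dual, ?_⟩
  have := dual_law hP
  simp only [sub_sub_cancel] at this
  exact this.unique hP

theorem exists_wide_arcs (hP : IsBernoulliProduct (rsqHI q fun n => 1 - q n) P) {ε : ℝ}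
    (hε : 0 < ε) (hp : ∀ e, rsqHI q (fun n => 1 - q n) e ∈ Icc ε (1 - ε))
    (hpos : P.real {ω | upw ω 0} ≠ 0) :
    ∃ m : ℕ, ∀ W : ℕ, ∃ K : ℤ, 1 ≤ K ∧ ∃ u : ℕ → ℤ, (∀ i < 21, u i ≤ u (i + 1)) ∧
      (∀ i < 19, u i + W < u (i + 3)) ∧
      ∀ i < 21, 1 - 1 / 12 ≤ P.real {ω | hit (Icc 0 (m : ℤ)) K (Ico (u i) (u (i + 1))) ω} := by
  have := hP.1
  obtain ⟨m, hm⟩ := exists_arcs hP hε hp hpos 21 (δ := 1 / 12) (by norm_num)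
  refine ⟨m, fun W => ?_⟩
  obtain ⟨K₀, hK₀⟩ := exists_height hP hε hp W
  obtain ⟨u, hu⟩ := hm ((max K₀ 1 : ℕ) : ℤ) (by exact_mod_cast le_max_right _ _)
  set K : ℤ := ((max K₀ 1 : ℕ) : ℤ) with hK
  have hmeas : ∀ i, MeasurableSet {ω | hit (Icc 0 (m : ℤ)) K (Ico (u i) (u (i + 1))) ω} := fun i =>
    (incFin_hit _ _ _).measurableSet
  have hhit : ∀ i < 21,
      1 - 1 / 12 ≤ P.real {ω | hit (Icc 0 (m : ℤ)) K (Ico (u i) (u (i + 1))) ω} := by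
    intro i hi
    have := (hu i hi).2
    rw [probReal_compl_eq_one_sub (hmeas i)] at this
    linarith
  have hK1 : 1 ≤ K := by
    rw [hK]
    exact_mod_cast le_max_right _ _
  refine ⟨K, hK1, u, fun i hi => (hu i hi).1, fun i hi => ?_, hhit⟩
  by_contra hlt
  have hd := measurePreserving_dual hP
  have hdual : ∀ i < 21, 1 - 1 / 12 ≤
      P.real (dual ⁻¹' {ω | hit (Icc 0 (m : ℤ)) K (Ico (u i) (u (i + 1))) ω}) := by
    intro i hi
    rw [hd.measureReal_preimage (hmeas i).nullMeasurableSet]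
    exact hhit i hi
  have h1 := le_real_inter (hd.measurable (hmeas _))
    (le_real_inter (hmeas _) (hdual i (by omega)) (hhit (i + 1) (by omega)))
    (hdual (i + 2) (by omega))
  have h2 := hK₀ (max K₀ 1) (le_max_left _ _) (u i)
  rw [← hK] at h2
  refine absurd (h1.trans (measureReal_mono fun ω hω => ?_)) (not_le.2 (h2.trans (by norm_num)))
  obtain ⟨⟨ha, hb⟩, hc⟩ := hω
  obtain ⟨y, hy, hy'⟩ := hit.crosses (by omega) ha
  obtain ⟨z, hz, hz'⟩ := hit.crosses (by omega) hb
  obtain ⟨w, hw, hw'⟩ := hit.crosses (by omega) hc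
  exact ⟨y, z, w, hy.1, hy.2.trans_le hz.1, hz.2.le.trans hw.1,
    (hw.2.le).trans (not_lt.1 hlt), hy', hz', hw'⟩

theorem measurableSet_good (K s m : ℤ) (A : ℕ → Set ℤ) {f : Config SqE → Config SqE}
    (hf : Measurable f) : MeasurableSet {ω | good K s m A ω (f ω)} := by
  have h := fun i => (incFin_hit (Icc s (s + m)) K (A i)).measurableSet
  exact ((h 0).inter ((h 8).inter (h 16))).inter
    ((hf (h 4)).inter ((hf (h 12)).inter (hf (h 20))))

theorem real_good_ge (hP : IsBernoulliProduct (rsqHI q fun n => 1 - q n) P) {K m s : ℤ}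
    {A B : ℕ → Set ℤ} (hAB : ∀ i, (· + s) '' A i ⊆ B i)
    (hA : ∀ i < 21, 1 - 1 / 12 ≤ P.real {ω | hit (Icc 0 m) K (A i) ω}) :
    1 / 2 ≤ P.real {ω | good K s m B ω (dual ω)} := by
  have := hP.1
  have hmeas : ∀ i, MeasurableSet {ω | hit (Icc s (s + m)) K (B i) ω} := fun i =>
    (incFin_hit _ _ _).measurableSet
  have hd := measurePreserving_dual hP
  have h1 : ∀ i < 21, 1 - 1 / 12 ≤ P.real {ω | hit (Icc s (s + m)) K (B i) ω} := by
    intro i hi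
    refine (hA i hi).trans ?_
    rw [← (measurePreserving_shift hP s).measureReal_preimage
      (incFin_hit _ _ _).measurableSet.nullMeasurableSet]
    exact measureReal_mono fun ω hω => hit_mono (hAB i) le_rfl (hit_shift K m s _ ω hω)
  have h2 : ∀ i < 21, 1 - 1 / 12 ≤ P.real (dual ⁻¹' {ω | hit (Icc s (s + m)) K (B i) ω}) := by
    intro i hi
    rw [hd.measureReal_preimage (hmeas i).nullMeasurableSet]
    exact h1 i hi
  have hm := fun i => hd.measurable (hmeas i)
  have h3 := le_real_inter ((hmeas 8).inter (hmeas 16)) (h1 0 (by omega))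
    (le_real_inter (hmeas 16) (h1 8 (by omega)) (h1 16 (by omega)))
  have h4 := le_real_inter ((hm 12).inter (hm 20)) (h2 4 (by omega))
    (le_real_inter (hm 20) (h2 12 (by omega)) (h2 20 (by omega)))
  have h5 := le_real_inter ((hm 4).inter ((hm 12).inter (hm 20))) h3 h4
  exact le_trans (by norm_num) h5

/-- In a critical environment, there is almost surely no cluster of unbounded height. -/
theorem real_upw_eq_zero (hP : IsBernoulliProduct (rsqHI q fun n => 1 - q n) P) {ε : ℝ}
    (hε : 0 < ε) (hp : ∀ e, rsqHI q (fun n => 1 - q n) e ∈ Icc ε (1 - ε)) :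
    P.real {ω | upw ω 0} = 0 := by
  have := hP.1
  have hε1 : ε ≤ 1 := by
    have := hp (0, 0, true)
    linarith [this.1, this.2]
  by_contra hpos
  obtain ⟨m, hm⟩ := exists_wide_arcs hP hε hp hpos
  obtain ⟨n, hn⟩ := exists_nat_gt (1 / (ε ^ (2 * (m + 1)) * (1 / 2)))
  obtain ⟨K, hK, u, hu, hW, hhit⟩ := hm (n * (m + 1))
  set W : ℤ := ((n * (m + 1) : ℕ) : ℤ) with hWdef
  have humono : ∀ i j, i ≤ j → j ≤ 21 → u i ≤ u j := by
    intro i j hij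
    induction j, hij using Nat.le_induction with
    | base => exact fun _ => le_rfl
    | succ j hj ih => exact fun h => (ih (by omega)).trans (hu j (by omega))
  set B : ℕ → Set ℤ := fun i => Ico (u i) (u (i + 1) + W) with hB
  have hBord : ∀ i j, i + 4 ≤ j → j ≤ 20 → ∀ x ∈ B i, ∀ y ∈ B j, x < y := by
    intro i j hij hj x hx y hy
    have h1 := hW (i + 1) (by omega)
    have h2 := humono (i + 1 + 3) j (by omega) (by omega)
    have h3 := hx.2
    have h4 := hy.1
    omega
  set s : ℕ → ℤ := fun k => ((k * (m + 1) : ℕ) : ℤ) with hs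
  set C : ℕ → Set (Config SqE) := fun k =>
    {ω | good K (s k) m B ω (dual (setOn (segE (s k) m) false ω))} ∩
      {ω | ∀ e ∈ segE (s k) m, ω e = true} with hC
  have hgm : ∀ k, MeasurableSet
      {ω | good K (s k) m B ω (dual (setOn (segE (s k) m) false ω))} := fun k =>
    measurableSet_good _ _ _ _ (measurable_dual.comp (measurable_setOn _ _))
  have hCm : ∀ k, MeasurableSet (C k) := fun k =>
    (hgm k).inter (measurableSet_cyl (segE (s k) m) fun _ => true)
  have hCP : ∀ k ∈ Finset.range n, ε ^ (2 * (m + 1)) * (1 / 2) ≤ P.real (C k) := by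
    intro k hk
    refine le_trans ?_ (hP.finite_energy_le hε.le hp true (segE (s k) m) (hgm k))
    have hkn : k * (m + 1) ≤ n * (m + 1) :=
      Nat.mul_le_mul_right _ (Finset.mem_range.1 hk).le
    have h1 : 1 / 2 ≤ P.real {ω | good K (s k) m B ω (dual ω)} := by
      refine real_good_ge hP (fun i => ?_) hhit
      rintro _ ⟨x, hx, rfl⟩
      have h1 := hx.1
      have h2 := hx.2
      refine ⟨?_, ?_⟩ <;> simp only [hs, hWdef] <;> omega
    refine mul_le_mul (pow_le_pow_of_le_one hε.le hε1 (card_segE_le _ _))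
      (h1.trans (measureReal_mono fun ω hω => ?_)) (by norm_num) (by positivity)
    refine hω.mono (le_setOn_true _ _) fun e => ?_
    simp only [dual, setOn]
    split_ifs <;> simp
  obtain ⟨k, hk, l, hl, hkl, ω, hω, hω'⟩ :=
    exists_nonempty_inter_of_measureReal_univ_lt_sum_measureReal (μ := P) (s := Finset.range n) (t := C)
      (fun k _ => hCm k) (by
        rw [probReal_univ]
        refine lt_of_lt_of_le ?_ (Finset.sum_le_sum hCP)
        rw [Finset.sum_const, Finset.card_range, nsmul_eq_mul]
        rwa [div_lt_iff₀ (by positivity)] at hn)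
  have hdisj : ∀ k l : ℕ, k < l → Disjoint (Icc (s k) (s k + m)) (Icc (s l) (s l + m)) := by
    intro k l hkl
    rw [Set.disjoint_left]
    intro x hx hx'
    have h1 := hx.2
    have h2 := hx'.1
    have h3 : (k + 1) * (m + 1) ≤ l * (m + 1) := Nat.mul_le_mul_right _ hkl
    simp only [hs] at h1 h2
    rw [Nat.add_mul, one_mul] at h3
    omega
  rcases hkl.lt_or_gt with h | h
  · exact not_two_good hK hBord (hdisj k l h) hω.1 hω'.1 hω.2 hω'.2
  · exact not_two_good hK hBord (hdisj l k h) hω'.1 hω.1 hω'.2 hω.2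

/-- In a critical environment, the cluster of the origin is almost surely finite. -/
theorem real_infinite_eq_zero (hP : IsBernoulliProduct (rsqHI q fun n => 1 - q n) P) {ε : ℝ}
    (hε : 0 < ε) (hq : ∀ n, q n ∈ Icc ε (1 - ε)) : P.real {ω | (clus {0} ω).Infinite} = 0 := by
  have hp : ∀ q : ℤ → ℝ, (∀ n, q n ∈ Icc ε (1 - ε)) →
      ∀ e, rsqHI q (fun n => 1 - q n) e ∈ Icc ε (1 - ε) := fun q hq =>
    rsqHI_mem hq fun n => ⟨by linarith [(hq n).2], by linarith [(hq n).1]⟩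
  have := hP.1
  have h1 := real_upw_eq_zero hP hε (hp q hq)
  have h2 := real_upw_eq_zero (q := fun n => q (-n - 1)) (refl_law hP) hε
    (hp _ fun n => hq (-n - 1))
  rw [map_measureReal_apply measurable_refl (measurableSet_upw 0)] at h2
  rw [measureReal_eq_zero_iff] at h1 h2 ⊢
  refine measure_mono_null_ae ?_ (measure_union_null h1 h2)
  filter_upwards [ae_blocked hP hε (hp q hq)] with ω hω h
  exact upw_or_upw_refl hω h

end

theorem continuous_rsqHI_critical :
    Continuous fun q : ℤ → ℝ => rsqHI q fun n => 1 - q n := by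
  refine continuous_pi fun e => ?_
  unfold rsqHI
  split_ifs
  · exact continuous_apply _
  · exact continuous_const.sub (continuous_apply _)

theorem rsqHI_critical_mem {ε : ℝ} {q : ℤ → ℝ} (hq : ∀ n, q n ∈ Icc ε (1 - ε)) (e : SqE) :
    rsqHI q (fun n => 1 - q n) e ∈ Icc ε (1 - ε) :=
  rsqHI_mem hq (fun n => ⟨by linarith [(hq n).2], by linarith [(hq n).1]⟩) e

/-- The probability of leaving a large box is small, uniformly over critical environments. -/
theorem exists_uniform_exits {ε : ℝ} (hε : 0 < ε) {η : ℝ} (hη : 0 < η) :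
    ∃ N, ∀ q : ℤ → ℝ, (∀ n, q n ∈ Icc ε (1 - ε)) → ∀ P : Measure (Config SqE),
      IsBernoulliProduct (rsqHI q fun n => 1 - q n) P → P.real {ω | exits N ω} < η := by
  have hI : Icc ε (1 - ε) ⊆ Icc (0 : ℝ) 1 := Icc_subset_Icc hε.le (by linarith)
  choose G hG hGP using fun N : ℕ => exists_continuous_integral (boxE N)
    (indicator_dependsOn (A := {ω | exits N ω}) (exits_dependsOn N))
  have hGP' : ∀ N (q : ℤ → ℝ), (∀ n, q n ∈ Icc ε (1 - ε)) → ∀ P : Measure (Config SqE),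
      IsBernoulliProduct (rsqHI q fun n => 1 - q n) P →
      P.real {ω | exits N ω} = G N (rsqHI q fun n => 1 - q n) := by
    intro N q hq P hP
    rw [← hGP N _ P (fun e => hI (rsqHI_critical_mem hq e)) hP,
      integral_indicator_one (incFin_exits N).measurableSet]
  by_contra hcon
  push Not at hcon
  set T : Set (ℤ → ℝ) := univ.pi fun _ => Icc ε (1 - ε) with hT
  have hTc : IsCompact T := isCompact_univ_pi fun _ => isCompact_Icc
  set F : ℕ → Set (ℤ → ℝ) := fun N => {q ∈ T | η ≤ G N (rsqHI q fun n => 1 - q n)} with hF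
  have hcl : ∀ N, IsClosed (F N) := fun N =>
    hTc.isClosed.inter (isClosed_le continuous_const ((hG N).comp continuous_rsqHI_critical))
  have hne : ∀ N, (F N).Nonempty := by
    intro N
    obtain ⟨q, hq, P, hP, h⟩ := hcon N
    exact ⟨q, fun n _ => hq n, by rwa [← hGP' N q hq P hP]⟩
  have hanti : ∀ N, F (N + 1) ⊆ F N := by
    rintro N q ⟨hq, h⟩
    refine ⟨hq, ?_⟩
    have hq' : ∀ n, q n ∈ Icc ε (1 - ε) := fun n => hq n trivial
    obtain ⟨P, hP⟩ := exists_isBernoulliProduct fun e => hI (rsqHI_critical_mem hq' e)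
    have := hP.1
    rw [← hGP' _ q hq' P hP] at h ⊢
    exact h.trans (measureReal_mono (exits_antitone N.le_succ))
  obtain ⟨q, hq⟩ := IsCompact.nonempty_iInter_of_sequence_nonempty_isCompact_isClosed F hanti hne
    (hTc.of_isClosed_subset (hcl 0) fun q hq => hq.1) hcl
  rw [mem_iInter] at hq
  have hq' : ∀ n, q n ∈ Icc ε (1 - ε) := fun n => (hq 0).1 n trivial
  obtain ⟨P, hP⟩ := exists_isBernoulliProduct fun e => hI (rsqHI_critical_mem hq' e)
  have := hP.1
  have hlim := tendsto_exits P
  rw [real_infinite_eq_zero hP hε hq'] at hlim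
  obtain ⟨N, hN⟩ := (hlim.eventually_lt_const hη).exists
  rw [hGP' N q hq' P hP] at hN
  exact absurd (hq N).2 (not_le.2 hN)

theorem exits_of_card {N : ℕ} {ω : Config SqE}
    (h : (((2 * N + 1) * (2 * N + 1) + 1 : ℕ) : ℕ∞) ≤ (clus {0} ω).encard) : exits N ω := by
  by_contra hc
  have hsub : clus {0} ω ⊆ ((Finset.Icc (-N : ℤ) N ×ˢ Finset.Icc (-N : ℤ) N : Finset _) : Set _) := by
    rintro u ⟨a, rfl, hu⟩
    by_contra hu'
    exact hc ⟨u, hu, by simpa using hu'⟩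
  have h1 := h.trans (encard_le_encard hsub)
  rw [encard_coe_eq_coe_finsetCard, Finset.card_product, Int.card_Icc, Nat.cast_le,
    show ((N : ℤ) + 1 - -N).toNat = 2 * N + 1 by omega] at h1
  omega

theorem encard_clus_shift (v : ℤ × ℤ) (ω : Config SqE) :
    (clus {v} ω).encard = (clus {0} (shift v.1 v.2 ω)).encard := by
  have := clus_shift v.1 v.2 ω
  simp only [Prod.mk.eta] at this
  rw [this, (vshift v.1 v.2).injective.encard_image]

theorem exists_uniform_card {ε : ℝ} (hε : 0 < ε) {η : ℝ} (hη : 0 < η) :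
    ∃ M : ℕ, ∀ q : ℤ → ℝ, (∀ n, q n ∈ Icc ε (1 - ε)) → ∀ P : Measure (Config SqE),
      IsBernoulliProduct (rsqHI q fun n => 1 - q n) P →
      ∀ v, P.real {ω | ((M + 1 : ℕ) : ℕ∞) ≤ (clus {v} ω).encard} ≤ η := by
  obtain ⟨N, hN⟩ := exists_uniform_exits hε hη
  refine ⟨(2 * N + 1) * (2 * N + 1), fun q hq P hP v => ?_⟩
  have hP' := shift_law hP v.1 v.2
  have := hP'.1
  simp only [encard_clus_shift v]
  have h1 := hN _ (fun n => hq (n + (v.1 + v.2))) _ hP'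
  have hsub : {ω | (((2 * N + 1) * (2 * N + 1) + 1 : ℕ) : ℕ∞) ≤ (clus {0} ω).encard} ⊆
      {ω | exits N ω} := fun ω hω => exits_of_card hω
  have h2 := measureReal_mono (μ := P.map (shift v.1 v.2)) hsub
  rw [map_measureReal_apply (measurable_shift _ _) (incFin_card_le _ _).measurableSet] at h2
  exact h2.trans h1.le

/-- Exponential decay of the cluster size in the integer model. -/
theorem exists_exp_decay {q q' : ℤ → ℝ} (hq : ∀ n, q n ∈ Ioo (0 : ℝ) 1)
    (hq' : ∀ n, q' n ∈ Ioo (0 : ℝ) 1) {δ : ℝ} (hδ : 0 < δ) (hκ : ∀ n, kappaS (q n) (q' n) ≤ -δ)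
    {Q : Measure (Config SqE)} (hQ : IsBernoulliProduct (rsqHI q q') Q) :
    ∃ c : ℝ, 0 < c ∧ ∃ d : ℝ, 0 < d ∧ ∀ v (k : ℕ),
      Q.real {ω | (k : ℕ∞) ≤ (clus {v} ω).encard} ≤ c * Real.exp (-d * k) := by
  simp only [kappaS] at hκ
  have hδ1 : δ < 1 := by linarith [hκ 0, (hq 0).1, (hq' 0).1]
  set p : ℤ → ℝ := fun n => q n + (1 - q n - q' n) / 2 with hp
  have hpn : ∀ n, p n = q n + (1 - q n - q' n) / 2 := fun n => rfl
  have hpI : ∀ n, p n ∈ Icc (δ / 2) (1 - δ / 2) := fun n =>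
    ⟨by linarith [hκ n, (hq n).1, hpn n], by linarith [hκ n, (hq' n).1, hpn n]⟩
  have hI : ∀ e, rsqHI p (fun n => 1 - p n) e ∈ Icc (0 : ℝ) 1 := fun e =>
    Icc_subset_Icc (by linarith) (by linarith) (rsqHI_critical_mem hpI e)
  obtain ⟨P, hP⟩ := exists_isBernoulliProduct hI
  obtain ⟨M, hM⟩ := exists_uniform_card (ε := δ / 2) (by linarith) (η := δ / 2 / 2) (by linarith)
  have hdec := exp_decay_of_uniform hP hQ hI
    (rsqHI_mem (fun n => Ioo_subset_Icc_self (hq n)) fun n => Ioo_subset_Icc_self (hq' n))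
    (ψ := δ / 2) (by linarith) (by linarith) (fun e => by
      unfold rsqHI
      have h1 := hκ (e.1 + e.2.1)
      have h2 := hpI (e.1 + e.2.1)
      have h3 := hpn (e.1 + e.2.1)
      simp only
      split_ifs
      · nlinarith [h2.1, h2.2]
      · nlinarith [h2.1, h2.2]) (hM p hpI P hP)
  set r : ℝ := 1 - δ / 2 / (2 * (M + 1)) with hr
  have hr1 : r < 1 := by
    have : 0 < δ / 2 / (2 * ((M : ℝ) + 1)) := by positivity
    linarith
  have hr0 : 0 < r := by
    have : δ / 2 / (2 * ((M : ℝ) + 1)) < 1 := by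
      rw [div_lt_one (by positivity)]
      have : (0 : ℝ) ≤ M := Nat.cast_nonneg M
      linarith
    linarith
  refine ⟨1 / (1 - δ / 2), by apply one_div_pos.2; linarith, -Real.log r,
    neg_pos.2 (Real.log_neg hr0 hr1), fun v k => (hdec v k).trans (le_of_eq ?_)⟩
  rw [neg_neg, mul_comm (Real.log r), Real.exp_nat_mul, Real.exp_log hr0]
  ring

/-- Almost sure finiteness of all clusters in the integer model. -/
theorem measure_exists_infinite_eq_zero {q q' : ℤ → ℝ} (hq : ∀ n, q n ∈ Ioo (0 : ℝ) 1)
    (hq' : ∀ n, q' n ∈ Ioo (0 : ℝ) 1) {ε : ℝ} (hε : 0 < ε)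
    (hκ : ∀ n, kappaS (q n) (q' n) ≤ 0 ∧ q n ≤ 1 - ε ∧ q' n ≤ 1 - ε)
    {Q : Measure (Config SqE)} (hQ : IsBernoulliProduct (rsqHI q q') Q) :
    Q {ω | ∃ v, (clus {v} ω).Infinite} = 0 := by
  have := hQ.1
  set ε' : ℝ := min ε (1 / 2) with hε'
  have hε'0 : 0 < ε' := lt_min hε (by norm_num)
  have hε'1 : ε' ≤ ε := min_le_left _ _
  have hε'2 : ε' ≤ 1 / 2 := min_le_right _ _
  set p : ℤ → ℝ := fun n => max (q n) ε' with hp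
  have hpI : ∀ n, p n ∈ Icc ε' (1 - ε') := fun n =>
    ⟨le_max_right _ _, max_le (by linarith [(hκ n).2.1]) (by linarith)⟩
  have hpq' : ∀ n, q' n ≤ 1 - p n := by
    intro n
    have h1 := (hκ n).1
    simp only [kappaS] at h1
    have : p n ≤ 1 - q' n := max_le (by linarith) (by linarith [(hκ n).2.2])
    linarith
  have hI : ∀ e, rsqHI p (fun n => 1 - p n) e ∈ Icc (0 : ℝ) 1 := fun e =>
    Icc_subset_Icc (by linarith) (by linarith) (rsqHI_critical_mem hpI e)
  obtain ⟨P, hP⟩ := exists_isBernoulliProduct hI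
  have key : ∀ v, Q {ω | (clus {v} ω).Infinite} = 0 := by
    intro v
    have hP' := shift_law hP v.1 v.2
    have hQ' := shift_law hQ v.1 v.2
    have := hP'.1
    have := hQ'.1
    have h0 := real_infinite_eq_zero hP' hε'0 fun n => hpI (n + (v.1 + v.2))
    have hle : ∀ N, (Q.map (shift v.1 v.2)).real {ω | exits N ω} ≤
        (P.map (shift v.1 v.2)).real {ω | exits N ω} := fun N =>
      (incFin_exits N).le_of_le hQ' hP'
        (rsqHI_mem (fun n => Ioo_subset_Icc_self (hq _)) fun n => Ioo_subset_Icc_self (hq' _))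
        (fun e => Icc_subset_Icc (by linarith) (by linarith)
          (rsqHI_critical_mem (fun n => hpI (n + (v.1 + v.2))) e)) fun e => by
            unfold rsqHI
            split_ifs
            · exact le_max_left _ _
            · exact hpq' _
    have h1 := le_of_tendsto_of_tendsto' (tendsto_exits _) (tendsto_exits _) hle
    rw [h0] at h1
    have h2 := le_antisymm h1 measureReal_nonneg
    have hm : MeasurableSet {ω | (clus {0} ω).Infinite} := by
      rw [setOf_infinite_eq]
      exact MeasurableSet.iInter fun N => (incFin_exits N).measurableSet
    rw [measureReal_eq_zero_iff, Measure.map_apply (measurable_shift _ _) hm] at h2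
    convert h2 using 2
    ext ω
    have := encard_clus_shift v ω
    simp only [mem_preimage, mem_ofPred_eq, ← encard_eq_top_iff, this]
  have : {ω | ∃ v, (clus {v} ω).Infinite} = ⋃ v, {ω | (clus {v} ω).Infinite} := by
    ext ω
    simp
  rw [this]
  exact measure_iUnion_null key

theorem mem_clus_iff_of_open {A : Set (ℤ × ℤ)} {ω : Config SqE} {e : SqE} (h : ω e = true) :
    src e ∈ clus A ω ↔ tgt e ∈ clus A ω := by
  have hz : zadj ω (src e) (tgt e) := ⟨e, h, Or.inl ⟨rfl, rfl⟩⟩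
  constructor
  · rintro ⟨x, hx, hc⟩
    exact ⟨x, hx, hc.trans (conn.single hz trivial trivial)⟩
  · rintro ⟨x, hx, hc⟩
    exact ⟨x, hx, hc.trans (conn.single hz.symm trivial trivial)⟩

/-- If the face to the right of the last vertex of a finite cluster on a horizontal ray has a dual
cluster avoiding the columns to the left of `a`, a parity contradiction arises. -/
theorem exists_mem_dual_clus_left {ω : Config SqE} {a b : ℤ} (hfin : (clus {(a, b)} ω).Finite)
    {k : ℕ} (hk : (a + k, b) ∈ clus {(a, b)} ω) (hlast : ∀ j : ℕ, k < j →
      (a + j, b) ∉ clus {(a, b)} ω) :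
    ∃ z ∈ clus {(a + k, b)} (dual ω), z.1 < a := by
  by_contra hcon
  push Not at hcon
  set C := clus {(a, b)} ω with hC
  set D := clus {((a + k : ℤ), b)} (dual ω) with hD
  set χ : ℤ → ℤ → ZMod 2 := fun x y => ind2 ((x, y) ∈ C) with hχ
  set η : ℤ → ℤ → ZMod 2 := fun x y => ind2 ((x, y) ∈ D) with hη
  have two : (2 : ZMod 2) = 0 := rfl
  have hcol : ∀ x y, x < a → η x y = 0 := fun x y hx =>
    ind2_false fun h => absurd (hcon _ h) (by simpa using hx)
  have hopT : ∀ x y, ω (x, y, true) = true → χ x y = χ (x + 1) y := fun x y h => by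
    have := mem_clus_iff_of_open (A := {(a, b)}) h
    simp only [src, tgt, if_true] at this
    simp only [hχ, hC, this]
  have hopF : ∀ x y, ω (x, y, false) = true → χ x y = χ x (y + 1) := fun x y h => by
    have := mem_clus_iff_of_open (A := {(a, b)}) h
    simp only [src, tgt, Bool.false_eq_true, if_false] at this
    simp only [hχ, hC, this]
  have hT : ∀ x y, η x y * (χ x y + χ (x + 1) y) = η x (y + 1) * (χ x y + χ (x + 1) y) := by
    intro x y
    cases h : ω (x, y, true)
    · have hd : dual ω (x, y, false) = true := by simp [dual, dualE, h]
      have := mem_clus_iff_of_open (A := {((a + k : ℤ), b)}) hd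
      simp only [src, tgt, Bool.false_eq_true, if_false] at this
      simp only [hη, hD, this]
    · rw [hopT x y h, zmod2_add_self, mul_zero, mul_zero]
  have hF : ∀ x y, η (x + 1) (y + 1) * (χ (x + 1) y + χ (x + 1) (y + 1)) =
      η x (y + 1) * (χ (x + 1) y + χ (x + 1) (y + 1)) := by
    intro x y
    cases h : ω (x + 1, y, false)
    · have hd : dual ω (x, y + 1, true) = true := by simp [dual, dualE, h]
      have := mem_clus_iff_of_open (A := {((a + k : ℤ), b)}) hd
      simp only [src, tgt, if_true] at this
      simp only [hη, hD, this]
    · rw [hopF _ y h, zmod2_add_self, mul_zero, mul_zero]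
  set f : ℕ → ℤ → ZMod 2 := fun n y =>
    ∑ i ∈ Finset.range n, η (a + i) y * (χ (a + i) y + χ (a + i + 1) y) with hf
  have hf0 : ∀ y, f 0 y = 0 := fun y => by simp [hf]
  have hfs : ∀ n y, f (n + 1) y = f n y + η (a + n) y * (χ (a + n) y + χ (a + n + 1) y) :=
    fun n y => Finset.sum_range_succ _ _
  have hstep : ∀ (n : ℕ) y, f n y + f n (y + 1) =
      η (a + n) (y + 1) * (χ (a + n) y + χ (a + n) (y + 1)) := by
    intro n y
    induction n with
    | zero =>
      have h := hF (a - 1) y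
      rw [hcol (a - 1) _ (by omega), sub_add_cancel] at h
      simp only [hf0, Nat.cast_zero, add_zero, h]
      simp
    | succ n ih =>
      have h := hF (a + n) y
      rw [hfs, hfs, show a + ((n + 1 : ℕ) : ℤ) = a + n + 1 by push_cast; ring, h]
      linear_combination ih + hT (a + n) y +
        η (a + n) (y + 1) * (χ (a + n) y + χ (a + n) (y + 1)) * two
  have hg : ∀ (z : ℤ × ℤ), z ∈ C → f (z.1 - a).toNat z.2 = 0 := by
    rintro z ⟨x, rfl, hc⟩
    rw [← conn.eq_of_invariant (g := fun z : ℤ × ℤ => f (z.1 - a).toNat z.2) ?_ ?_ hc]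
    · simp [hf0]
    · intro x y hxy _ _
      obtain hx | hx := lt_or_ge x a
      · simp [Int.toNat_of_nonpos (show x - a ≤ 0 by omega), hf0]
      · obtain ⟨n, rfl⟩ : ∃ n : ℕ, x = a + n := ⟨(x - a).toNat, by omega⟩
        have := hstep n y
        rw [hopF _ y hxy, zmod2_add_self, mul_zero] at this
        simpa using zmod2_eq_of_add this
    · intro x y hxy _ _
      obtain hx | hx := lt_or_ge x a
      · simp [Int.toNat_of_nonpos (show x - a ≤ 0 by omega),
          Int.toNat_of_nonpos (show x + 1 - a ≤ 0 by omega), hf0]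
      · obtain ⟨n, rfl⟩ : ∃ n : ℕ, x = a + n := ⟨(x - a).toNat, by omega⟩
        have := hfs n y
        rw [hopT _ y hxy, zmod2_add_self, mul_zero, add_zero] at this
        simp only
        rw [show (a + n - a).toNat = n by omega, show (a + n + 1 - a).toNat = n + 1 by omega, this]
  have hfk : ∀ n : ℕ, k < n → f n b = 1 := by
    intro n hn
    induction n, hn using Nat.le_induction with
    | base =>
      have h0 : f k b = 0 := by simpa using hg _ hk
      have h1 : η (a + k) b = 1 := ind2_true ⟨_, rfl, conn.refl _ _ _⟩
      have h2 : χ (a + k) b = 1 := ind2_true hk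
      have h3 : χ (a + k + 1) b = 0 := ind2_false (by
        have := hlast (k + 1) (by omega)
        rwa [Nat.cast_succ, ← add_assoc] at this)
      rw [hfs, h0, h1, h2, h3]
      simp
    | succ n hn ih =>
      have h2 : χ (a + n) b = 0 := ind2_false (hlast n hn)
      have h3 : χ (a + n + 1) b = 0 := ind2_false (by
        have := hlast (n + 1) (by omega)
        rwa [Nat.cast_succ, ← add_assoc] at this)
      rw [hfs, ih, h2, h3]
      simp
  obtain ⟨B₁, hB₁⟩ := (hfin.image Prod.fst).bddAbove
  obtain ⟨B₂, hB₂⟩ := (hfin.image Prod.snd).bddAbove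
  have hx0 : ∀ x y, B₁ < x → χ x y = 0 := fun x y hx =>
    ind2_false fun h => absurd (hB₁ ⟨_, h, rfl⟩) (by simpa using hx)
  have hy0 : ∀ x y, B₂ < y → χ x y = 0 := fun x y hy =>
    ind2_false fun h => absurd (hB₂ ⟨_, h, rfl⟩) (by simpa using hy)
  set n : ℕ := max (k + 1) (B₁ - a + 1).toNat with hn
  have hup : ∀ m : ℕ, f n (b + m) = 1 := by
    intro m
    induction m with
    | zero => simpa using hfk n (by omega)
    | succ m ih =>
      have h := hstep n (b + m)
      rw [hx0 _ _ (by omega), hx0 _ _ (by omega), ih] at h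
      rw [Nat.cast_succ, ← add_assoc]
      simp only [add_zero, mul_zero] at h
      exact (zmod2_eq_of_add h).symm
  have h0 : f n (b + (B₂ - b + 1).toNat) = 0 :=
    Finset.sum_eq_zero fun i _ => by rw [hy0 _ _ (by omega), hy0 _ _ (by omega)]; simp
  rw [hup] at h0
  exact one_ne_zero h0

theorem exists_mem_clus_column {ω : Config SqE} {u w : ℤ × ℤ} (h : conn ω univ u w) {i : ℤ}
    (h1 : w.1 ≤ i) (h2 : i ≤ u.1) : ∃ z ∈ clus {u} ω, z.1 = i := by
  induction h with
  | refl => exact ⟨u, ⟨u, rfl, conn.refl _ _ _⟩, by omega⟩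
  | @tail x y hx hxy ih =>
    by_cases hy : y.1 = i
    · exact ⟨y, ⟨u, rfl, hx.tail hxy⟩, hy⟩
    · refine ih ?_
      obtain ⟨⟨⟨c, d, t⟩, -, he⟩, -, -⟩ := hxy
      cases t <;> simp only [src, tgt] at he <;> rcases he with ⟨rfl, rfl⟩ | ⟨rfl, rfl⟩ <;>
        simp_all <;> omega

/-- A finite cluster containing `(a, b)` and `(a + M, b)` is enclosed by a large dual cluster. -/
theorem exists_dual_card {ω : Config SqE} {a b : ℤ} {M : ℕ} (hfin : (clus {(a, b)} ω).Finite)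
    (hM : (a + M, b) ∈ clus {(a, b)} ω) :
    ∃ k : ℕ, M ≤ k ∧ (k : ℕ∞) ≤ (clus {(a + k, b)} (dual ω)).encard := by
  have hS : {j : ℕ | (a + j, b) ∈ clus {(a, b)} ω}.Finite :=
    hfin.preimage (f := fun j : ℕ => (a + (j : ℤ), b)) (fun i _ j _ h => by simpa using h)
  obtain ⟨k, hk, hmax⟩ := hS.exists_maximal ⟨M, hM⟩
  refine ⟨k, ?_, ?_⟩
  · by_contra h
    exact h (hmax hM (le_of_not_ge h))
  · obtain ⟨z, ⟨_, rfl, hz⟩, hza⟩ := exists_mem_dual_clus_left hfin hk fun j hj hj' =>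
      absurd (hmax hj' hj.le) (by omega)
    have hsub : (fun j : ℕ => a + (j : ℤ)) '' (Finset.range k : Set ℕ) ⊆
        Prod.fst '' clus {((a + k : ℤ), b)} (dual ω) := by
      rintro _ ⟨j, hj, rfl⟩
      have hj' : j < k := by simpa using hj
      obtain ⟨y, hy, hyj⟩ := exists_mem_clus_column hz (i := a + j) (by omega) (by simp; omega)
      exact ⟨y, hy, hyj⟩
    calc (k : ℕ∞) = ((fun j : ℕ => a + (j : ℤ)) '' (Finset.range k : Set ℕ)).encard := by
          rw [Function.Injective.encard_image fun i j h => by simpa using h,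
            Set.encard_coe_eq_coe_finsetCard, Finset.card_range]
      _ ≤ _ := (encard_le_encard hsub).trans (encard_image_le _ _)

theorem measurableSet_infinite_clus (v : ℤ × ℤ) : MeasurableSet {ω | (clus {v} ω).Infinite} := by
  have : {ω | (clus {v} ω).Infinite} = ⋂ k : ℕ, {ω | (k : ℕ∞) ≤ (clus {v} ω).encard} := by
    ext ω
    simp only [mem_ofPred_eq, mem_iInter, ← encard_eq_top_iff, ENat.eq_top_iff_forall_ge]
  rw [this]
  exact MeasurableSet.iInter fun k => (incFin_card_le v k).measurableSet

/-- The `M` horizontal edges to the right of `v`. -/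
def rayE (v : ℤ × ℤ) (M : ℕ) : Finset SqE :=
  (Finset.range M).image fun j : ℕ => (v.1 + (j : ℤ), v.2, true)

theorem card_rayE_le (v : ℤ × ℤ) (M : ℕ) : (rayE v M).card ≤ M :=
  Finset.card_image_le.trans (Finset.card_range M).le

theorem mem_clus_setOn_rayE (v : ℤ × ℤ) (M : ℕ) (ω : Config SqE) :
    (v.1 + M, v.2) ∈ clus {v} (setOn (rayE v M) true ω) := by
  have : ∀ j : ℕ, j ≤ M → (v.1 + (j : ℤ), v.2) ∈ clus {v} (setOn (rayE v M) true ω) := by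
    intro j hj
    induction j with
    | zero => exact ⟨v, rfl, by simpa using! conn.refl _ _ _⟩
    | succ j ih =>
      have hopen : setOn (rayE v M) true ω (v.1 + (j : ℤ), v.2, true) = true :=
        if_pos (Finset.mem_image_of_mem _ (Finset.mem_range.2 hj))
      have := (mem_clus_iff_of_open hopen).1 (ih (by omega))
      simpa [tgt, ← add_assoc] using this
  exact this M le_rfl

theorem exists_uniform_infinite {q q' : ℤ → ℝ} (hq : ∀ n, q n ∈ Ioo (0 : ℝ) 1)
    (hq' : ∀ n, q' n ∈ Ioo (0 : ℝ) 1) {δ : ℝ} (hδ : 0 < δ) (hκ : ∀ n, δ ≤ kappaS (q n) (q' n))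
    {Q : Measure (Config SqE)} (hQ : IsBernoulliProduct (rsqHI q q') Q) :
    ∃ θ : ℝ, 0 < θ ∧ ∀ v, θ ≤ Q.real {ω | (clus {v} ω).Infinite} := by
  have := hQ.1
  have hmem : ∀ (r : ℤ → ℝ), (∀ n, r n ∈ Ioo (0 : ℝ) 1) → ∀ n, 1 - r n ∈ Ioo (0 : ℝ) 1 :=
    fun r hr n => ⟨by linarith [(hr n).2], by linarith [(hr n).1]⟩
  obtain ⟨c, hc, d, hd, hdec⟩ := exists_exp_decay (hmem q' hq') (hmem q hq) hδ
    (fun n => by have := hκ n; unfold kappaS at *; linarith) (dual_law hQ)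
  have hdec' : ∀ v (k : ℕ), Q {ω | (k : ℕ∞) ≤ (clus {v} (dual ω)).encard} ≤
      ENNReal.ofReal (c * Real.exp (-d * k)) := by
    intro v k
    have hm := (incFin_card_le v k).measurableSet
    have h := hdec v k
    rw [map_measureReal_apply measurable_dual hm] at h
    rw [← ofReal_measureReal]
    exact ENNReal.ofReal_le_ofReal h
  have hsum : Summable fun k : ℕ => c * Real.exp (-d * k) := by
    refine Summable.mul_left _ ?_
    exact Real.summable_exp_nat_mul_of_ge (c := -d) (by linarith)
      (f := fun k : ℕ => (k : ℝ)) fun i => le_rfl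
  have htop : ∑' k : ℕ, ENNReal.ofReal (c * Real.exp (-d * k)) ≠ ⊤ := hsum.tsum_ofReal_ne_top
  obtain ⟨M, hM⟩ := ((ENNReal.tendsto_sum_nat_add _ htop).eventually_lt_const
    (show (0 : ENNReal) < 2⁻¹ by simp)).exists
  refine ⟨δ ^ M * (1 / 2), by positivity, fun v => ?_⟩
  set A := {ω | (clus {v} ω).Infinite} with hA
  have hAm : MeasurableSet A := measurableSet_infinite_clus v
  have hsub : (setOn (rayE v M) true ⁻¹' A)ᶜ ⊆
      ⋃ k : ℕ, {ω | ((k + M : ℕ) : ℕ∞) ≤ (clus {(v.1 + (k + M : ℕ), v.2)} (dual ω)).encard} := by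
    intro ω hω
    have hfin : (clus {(v.1, v.2)} (setOn (rayE v M) true ω)).Finite := by
      simpa [hA] using hω
    obtain ⟨k, hk, hcard⟩ := exists_dual_card hfin (mem_clus_setOn_rayE v M ω)
    obtain ⟨j, rfl⟩ : ∃ j, k = j + M := ⟨k - M, by omega⟩
    refine mem_iUnion.2 ⟨j, hcard.trans (encard_le_encard (clus_mono subset_rfl ?_))⟩
    intro e
    simp only [dual, setOn]
    split_ifs <;> simp
  have hhalf : Q (setOn (rayE v M) true ⁻¹' A)ᶜ ≤ 2⁻¹ :=
    (measure_mono hsub).trans <| (measure_iUnion_le _).trans <|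
      (ENNReal.tsum_le_tsum fun k => hdec' _ (k + M)).trans hM.le
  have hhalf' : 1 / 2 ≤ Q.real (setOn (rayE v M) true ⁻¹' A) := by
    have h1 := ENNReal.toReal_mono (by simp) hhalf
    have h2 := probReal_compl_eq_one_sub (μ := Q) (measurable_setOn (rayE v M) true hAm)
    rw [measureReal_def] at h2
    rw [h2] at h1
    simp at h1
    linarith
  have hδ1 : δ ≤ 1 := by
    have := hκ 0
    unfold kappaS at this
    linarith [(hq 0).2, (hq' 0).2]
  have hδe : ∀ e, δ ≤ rsqHI q q' e := fun e => rsqHI_mem (I := Ici δ)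
    (fun n => by have := hκ n; unfold kappaS at this; simp only [mem_Ici]; linarith [(hq' n).2])
    (fun n => by have := hκ n; unfold kappaS at this; simp only [mem_Ici]; linarith [(hq n).2]) e
  have hprod : δ ^ M ≤ ∏ e ∈ rayE v M, rsqHI q q' e :=
    calc δ ^ M ≤ δ ^ (rayE v M).card := pow_le_pow_of_le_one hδ.le hδ1 (card_rayE_le v M)
      _ = ∏ e ∈ rayE v M, δ := by rw [Finset.prod_const]
      _ ≤ _ := Finset.prod_le_prod (fun _ _ => hδ.le) fun e _ => hδe e
  have hfe := hQ.finite_energy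
    (rsqHI_mem (fun n => Ioo_subset_Icc_self (hq n)) fun n => Ioo_subset_Icc_self (hq' n))
    true (rayE v M) hAm
  simp only [if_true] at hfe
  calc δ ^ M * (1 / 2) ≤ (∏ e ∈ rayE v M, rsqHI q q' e) *
        Q.real (setOn (rayE v M) true ⁻¹' A) :=
      mul_le_mul hprod hhalf' (by norm_num) (Finset.prod_nonneg fun e _ => hδ.le.trans (hδe e))
    _ = _ := hfe.symm
    _ ≤ Q.real A := measureReal_mono inter_subset_left

theorem finite_setOf_zadj (ω : Config SqE) (x : ℤ × ℤ) : {y | zadj ω x y}.Finite := by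
  refine Set.Finite.subset (s := {(x.1 + 1, x.2), (x.1 - 1, x.2), (x.1, x.2 + 1), (x.1, x.2 - 1)})
    (by simp) ?_
  rintro y ⟨⟨c, d, t⟩, -, he⟩
  cases t <;> simp only [src, tgt] at he <;> rcases he with ⟨rfl, rfl⟩ | ⟨rfl, rfl⟩ <;> simp

theorem conn.eq_or_exists_step {ω : Config SqE} {S : Set (ℤ × ℤ)} {x z : ℤ × ℤ}
    (h : conn ω Sᶜ x z) :
    z = x ∨ ∃ y, zadj ω x y ∧ y ∉ insert x S ∧ conn ω (insert x S)ᶜ y z := by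
  induction h with
  | refl => exact Or.inl rfl
  | @tail z w _ hzw ih =>
    by_cases hw : w = x
    · exact Or.inl hw
    have hwS : w ∉ insert x S := by simpa [hw] using hzw.2.2
    obtain rfl | ⟨y, hxy, hy, hyz⟩ := ih
    · exact Or.inr ⟨w, hzw.1, hwS, conn.refl _ _ _⟩
    · exact Or.inr ⟨y, hxy, hy, hyz.tail ⟨hzw.1, hyz.mem_of_mem hy, hwS⟩⟩

theorem exists_infinite_step {ω : Config SqE} {S : Set (ℤ × ℤ)} {x : ℤ × ℤ}
    (h : {z | conn ω Sᶜ x z}.Infinite) :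
    ∃ y, zadj ω x y ∧ y ∉ insert x S ∧ {z | conn ω (insert x S)ᶜ y z}.Infinite := by
  by_contra! hcon
  refine h (Set.Finite.subset (s := {x} ∪ ⋃ y ∈ {y | zadj ω x y ∧ y ∉ insert x S},
    {z | conn ω (insert x S)ᶜ y z}) ?_ ?_)
  · refine (finite_singleton x).union (Set.Finite.biUnion
      ((finite_setOf_zadj ω x).subset fun y hy => hy.1) fun y hy => ?_)
    exact hcon y hy.1 hy.2
  · intro z hz
    obtain rfl | ⟨y, hxy, hy, hyz⟩ := conn.eq_or_exists_step hz
    · exact Or.inl rfl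
    · exact Or.inr (mem_biUnion (show y ∈ {y | zadj ω x y ∧ y ∉ insert x S} from ⟨hxy, hy⟩) hyz)

/-- König's lemma for open clusters. -/
theorem exists_injective_path {ω : Config SqE} {v : ℤ × ℤ} (h : (clus {v} ω).Infinite) :
    ∃ γ : ℕ → ℤ × ℤ, γ 0 = v ∧ Function.Injective γ ∧ ∀ n, zadj ω (γ n) (γ (n + 1)) := by
  let St := {s : Set (ℤ × ℤ) × (ℤ × ℤ) // s.2 ∉ s.1 ∧ {z | conn ω s.1ᶜ s.2 z}.Infinite}
  have hnext : ∀ s : St, ∃ t : St, zadj ω s.1.2 t.1.2 ∧ t.1.1 = insert s.1.2 s.1.1 := by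
    rintro ⟨⟨S, x⟩, hx, hinf⟩
    obtain ⟨y, hxy, hy, hyinf⟩ := exists_infinite_step hinf
    exact ⟨⟨(insert x S, y), hy, hyinf⟩, hxy, rfl⟩
  choose next hadj hset using hnext
  have h0 : {z | conn ω (∅ : Set (ℤ × ℤ))ᶜ v z}.Infinite := by
    simpa [clus] using h
  let s : ℕ → St := Nat.rec ⟨(∅, v), notMem_empty v, h0⟩ fun _ => next
  have hmem : ∀ m n, m < n → (s m).1.2 ∈ (s n).1.1 := by
    intro m n hmn
    induction n, hmn using Nat.le_induction with
    | base => exact (hset (s m)).symm ▸ mem_insert _ _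
    | succ n hn ih => exact (hset (s n)).symm ▸ mem_insert_of_mem _ ih
  refine ⟨fun n => (s n).1.2, rfl, ?_, fun n => hadj (s n)⟩
  have hne : ∀ m n, m < n → (s m).1.2 ≠ (s n).1.2 := fun m n hmn heq =>
    (s n).2.1 (heq ▸ hmem m n hmn)
  intro m n hmn
  by_contra hcon
  obtain h | h := lt_or_gt_of_ne hcon
  · exact hne m n h hmn
  · exact hne n m h hmn.symm

/-- The embedding of `ℤ²` as the vertex set of the rotated square lattice. -/
noncomputable def rvert (v : ℤ × ℤ) : Pt := rv v.1 v.2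

theorem rvert_injective : Function.Injective rvert := by
  rintro ⟨a, b⟩ ⟨c, d⟩ h
  have h2 : Real.sqrt 2 ≠ 0 := by positivity
  simp only [rvert, rv, Prod.mk.injEq, div_left_inj' h2] at h
  have h1 : (a : ℝ) = c := by linarith [h.1, h.2]
  have h3 : (b : ℝ) = d := by linarith [h.1, h.2]
  exact Prod.ext (by exact_mod_cast h1) (by exact_mod_cast h3)

theorem rsqLattice_ends (e : SqE) : rsqLattice.ends e = (rvert (src e), rvert (tgt e)) := by
  obtain ⟨a, b, t⟩ := e
  cases t <;> simp [rsqLattice, rvert, src, tgt]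

theorem vertexSet_rsqLattice : vertexSet rsqLattice = range rvert := by
  ext p
  simp only [vertexSet, mem_iUnion, rsqLattice_ends]
  constructor
  · rintro ⟨e, rfl | rfl⟩
    · exact ⟨_, rfl⟩
    · exact ⟨_, rfl⟩
  · rintro ⟨v, rfl⟩
    exact ⟨(v.1, v.2, true), Or.inl rfl⟩

theorem zadj.openAdj {ω : Config SqE} {u v : ℤ × ℤ} (h : zadj ω u v) :
    openAdj rsqLattice ω (rvert u) (rvert v) := by
  obtain ⟨e, he, ⟨rfl, rfl⟩ | ⟨rfl, rfl⟩⟩ := h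
  · exact ⟨e, he, Or.inl (rsqLattice_ends e)⟩
  · exact ⟨e, he, Or.inr (rsqLattice_ends e)⟩

theorem openAdj.exists_zadj {ω : Config SqE} {u : ℤ × ℤ} {p : Pt}
    (h : openAdj rsqLattice ω (rvert u) p) : ∃ v, zadj ω u v ∧ rvert v = p := by
  obtain ⟨e, he, h | h⟩ := h <;> rw [rsqLattice_ends, Prod.mk.injEq] at h
  · exact ⟨tgt e, ⟨e, he, Or.inl ⟨rvert_injective h.1, rfl⟩⟩, h.2⟩
  · exact ⟨src e, ⟨e, he, Or.inr ⟨rfl, rvert_injective h.2⟩⟩, h.1⟩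

theorem cluster_rvert (ω : Config SqE) (v : ℤ × ℤ) :
    cluster rsqLattice ω (rvert v) = rvert '' clus {v} ω := by
  ext p
  constructor
  · intro h
    change Relation.ReflTransGen _ _ _ at h
    induction h with
    | refl => exact ⟨v, ⟨v, rfl, conn.refl _ _ _⟩, rfl⟩
    | tail _ hpq ih =>
      obtain ⟨u, ⟨_, rfl, hu⟩, rfl⟩ := ih
      obtain ⟨w, huw, rfl⟩ := openAdj.exists_zadj hpq
      exact ⟨w, ⟨_, rfl, hu.trans (conn.single huw trivial trivial)⟩, rfl⟩
  · rintro ⟨u, ⟨_, rfl, hu⟩, rfl⟩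
    exact Relation.ReflTransGen.lift rvert (fun _ _ h => h.1.openAdj) _ _ hu

theorem connToInfinity_of_infinite {ω : Config SqE} {v : ℤ × ℤ} (h : (clus {v} ω).Infinite) :
    ConnToInfinity rsqLattice ω (rvert v) := by
  obtain ⟨γ, h0, hinj, hadj⟩ := exists_injective_path h
  exact ⟨rvert ∘ γ, congrArg rvert h0, rvert_injective.comp hinj, fun n => (hadj n).openAdj⟩

/-- Sub/supercriticality of the highly inhomogeneous measure
`P^□_{q,q'}` on the diagonally oriented square lattice:
(a) if `κ_□(q_n,q'_n) ≤ 0` and `q_n, q'_n ≤ 1 - ε` for all `n` (some `ε > 0`), there is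
a.s. no infinite open cluster;
(b) if `κ_□(q_n,q'_n) ≤ -δ` for all `n` (some `δ > 0`), the cluster volumes have
exponential tails, uniformly in the vertex;
(c) if `κ_□(q_n,q'_n) ≥ δ` for all `n` (some `δ > 0`), the measure is uniformly
supercritical. -/
theorem highly_inhomogeneous_square_criticality (q q' : ℤ → ℝ)
    (hq : ∀ n, q n ∈ Set.Ioo (0 : ℝ) 1) (hq' : ∀ n, q' n ∈ Set.Ioo (0 : ℝ) 1) :
    -- part (a)
    ((∃ ε : ℝ, 0 < ε ∧ ∀ n : ℤ, kappaS (q n) (q' n) ≤ 0 ∧ q n ≤ 1 - ε ∧ q' n ≤ 1 - ε) →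
      ∀ P : Measure (Config SqE), IsBernoulliProduct (rsqHI q q') P →
        P {ω | ∃ v ∈ vertexSet rsqLattice, (cluster rsqLattice ω v).Infinite} = 0) ∧
    -- part (b)
    ((∃ δ : ℝ, 0 < δ ∧ ∀ n : ℤ, kappaS (q n) (q' n) ≤ -δ) →
      ∀ P : Measure (Config SqE), IsBernoulliProduct (rsqHI q q') P →
        ∃ c : ℝ, 0 < c ∧ ∃ d : ℝ, 0 < d ∧
          ∀ v ∈ vertexSet rsqLattice, ∀ k : ℕ,
            P {ω | (k : ℕ∞) ≤ (cluster rsqLattice ω v).encard} ≤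
              ENNReal.ofReal (c * Real.exp (-d * k))) ∧
    -- part (c): uniform supercriticality
    ((∃ δ : ℝ, 0 < δ ∧ ∀ n : ℤ, δ ≤ kappaS (q n) (q' n)) →
      ∀ P : Measure (Config SqE), IsBernoulliProduct (rsqHI q q') P →
        ∃ θ : ℝ, 0 < θ ∧ ∀ v ∈ vertexSet rsqLattice,
          ENNReal.ofReal θ ≤ P {ω | ConnToInfinity rsqLattice ω v}) := by
  rw [vertexSet_rsqLattice]
  refine ⟨?_, ?_, ?_⟩
  · rintro ⟨ε, hε, hκ⟩ P hP
    refine measure_mono_null ?_ (measure_exists_infinite_eq_zero hq hq' hε hκ hP)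
    rintro ω ⟨_, ⟨v, rfl⟩, hv⟩
    rw [cluster_rvert] at hv
    exact ⟨v, hv.of_image _⟩
  · rintro ⟨δ, hδ, hκ⟩ P hP
    have := hP.1
    obtain ⟨c, hc, d, hd, h⟩ := exists_exp_decay hq hq' hδ hκ hP
    refine ⟨c, hc, d, hd, ?_⟩
    rintro _ ⟨v, rfl⟩ k
    simp only [cluster_rvert, rvert_injective.encard_image]
    rw [← ofReal_measureReal]
    exact ENNReal.ofReal_le_ofReal (h v k)
  · rintro ⟨δ, hδ, hκ⟩ P hP
    have := hP.1
    obtain ⟨θ, hθ, h⟩ := exists_uniform_infinite hq hq' hδ hκ hP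
    refine ⟨θ, hθ, ?_⟩
    rintro _ ⟨v, rfl⟩
    have hsub : {ω | (clus {v} ω).Infinite} ⊆ {ω | ConnToInfinity rsqLattice ω (rvert v)} :=
      fun ω hω => connToInfinity_of_infinite hω
    refine le_trans ?_ (measure_mono hsub)
    rw [← ofReal_measureReal]
    exact ENNReal.ofReal_le_ofReal (h v)

end Perc
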